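/- Among all Gorenstein* lattices of rank n, the cd-index is coefficientwise minimized by the Boolean algebra: if Λ is a Gorenstein* lattice of rank n, then Ψ_Λ ≥ Ψ_{B} coefficientwise, where B is the Boolean algebra of rank n+1 with its maximal element removed (equivalently, the face lattice of an (n−1)-dimensional simplex with the maximal face removed). -/

import Mathlib

open scoped Classical

noncomputable section

/-- The ring of polynomials in two non-commuting variables `a`, `b` (with rational
coefficients), in which `ab`-indices and `cd`-indices live. -/
abbrev NC := FreeAlgebra ℚ (Fin 2)

/-- The variable `a`. -/
def va : NC := FreeAlgebra.ι ℚ 0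
/-- The variable `b`. -/
def vb : NC := FreeAlgebra.ι ℚ 1
/-- `c = a + b`. -/
def vc : NC := va + vb
/-- `d = ab + ba`. -/
def vd : NC := va * vb + vb * va

/-- A `cd`-monomial, encoded as a list of booleans (`false` = `c`, `true` = `d`),
viewed inside `NC` via `c = a+b`, `d = ab+ba`. -/
def cdMonomial : List Bool → NC
  | [] => 1
  | s :: w => (if s then vd else vc) * cdMonomial w

/-- Degree of a `cd`-monomial (`c` has degree 1, `d` has degree 2). -/
def cdDeg (w : List Bool) : ℕ := (w.map fun s => if s then 2 else 1).sum

/-- Evaluation of an integer combination of `cd`-monomials in `NC`. -/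
def cdEval (f : List Bool →₀ ℤ) : NC := f.sum fun w z => (z : ℚ) • cdMonomial w

/-- The weight of a chain, computed from the (strictly increasing) list of absolute ranks
of its elements; `N` is the absolute rank of the (possibly formal) maximal element `1̂`.
For a list `[r₀, r₁, …, r_k]` this is
`(a-b)^(r₁-r₀-1) · b · (a-b)^(r₂-r₁-1) · b ⋯ b · (a-b)^(N-1-r_k)`. -/
def wtRanks (N : ℕ) : List ℕ → NC
  | [] => 1
  | [r] => (va - vb) ^ (N - 1 - r)
  | r :: s :: l => (va - vb) ^ (s - r - 1) * vb * wtRanks N (s :: l)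


/-- A finite type has a finite `WithTop`. -/
instance {α : Type*} [Fintype α] : Fintype (WithTop α) := inferInstanceAs (Fintype (Option α))

/-- A lexicographic sum of finite types is finite. -/
instance {α β : Type*} [Fintype α] [Fintype β] : Fintype (α ⊕ₗ β) :=
  inferInstanceAs (Fintype (α ⊕ β))

section Posets

variable {P : Type*} [Fintype P] [PartialOrder P]

/-- `y` is a chain of the subposet `S ⊆ P` whose minimal element is `m`, containing `m`
(chains of a poset always contain the minimal element `0̂ = m`). -/
def chainIn (S : Set P) (m : P) (y : Finset P) : Prop :=
  m ∈ y ∧ ↑y ⊆ S ∧ IsChain (· < ·) (↑y : Set P)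

/-- The `ab`-index `Ψ` of the subposet `S ⊆ P` with minimal element `m`, of rank `n`
(so the adjoined maximal element `1̂` has absolute rank `rk m + n + 1`); ranks of
elements are computed by the ambient rank function `rk`. -/
def absIndexOn (S : Set P) (m : P) (rk : P → ℕ) (n : ℕ) : NC :=
  ∑ y : Finset P,
    if chainIn S m y then wtRanks (rk m + n + 1) ((y.image rk).sort (· ≤ ·)) else 0

/-- The simplicial boundary operator relative to a chain `x`: a chain `y ⊇ x` is sent to
the signed sum of the chains `y ∖ {σ}` for `σ ∈ y ∖ x`, the sign of `σ` being determined
by its position in `y`.  Together with the grading by cardinality, this is the cellular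
(chain) complex of the order complex computing (relative) simplicial homology. -/
def bnd (x : Finset P) : (Finset P →₀ ℝ) →ₗ[ℝ] (Finset P →₀ ℝ) :=
  Finsupp.lsum ℝ fun y => LinearMap.id.smulRight
    (∑ σ ∈ y \ x, ((-1 : ℝ) ^ (y.filter fun τ => τ < σ).card) • Finsupp.single (y.erase σ) (1 : ℝ))

/-- The degree-`k` term of the cellular complex of (the order complex of) the subposet
`S` with minimal element `m`, relative to the chain `x`: the span of all chains `y ⊇ x`
in `S` with `k` elements. -/
def cellSpace (S : Set P) (m : P) (x : Finset P) (k : ℕ) : Submodule ℝ (Finset P →₀ ℝ) :=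
  Submodule.span ℝ
    {f | ∃ y : Finset P, chainIn S m y ∧ x ⊆ y ∧ y.card = k ∧ f = Finsupp.single y 1}

/-- The homological Gorenstein condition for the subposet `S ⊆ P` with minimal element
`m`, of rank `n`: the order complex is a real homology sphere, i.e. for every chain `x`
the cellular complex of the interval `[x, 1̂)` of the order complex is exact except at the
top (chains of `n+1` elements), where the homology is 1-dimensional. -/
def GorensteinOn (S : Set P) (m : P) (n : ℕ) : Prop :=
  ∀ x : Finset P, chainIn S m x → ∀ k : ℕ,
    Module.finrank ℝ ↥(LinearMap.ker (bnd x) ⊓ cellSpace S m x k) =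
      Module.finrank ℝ ↥(Submodule.map (bnd x) (cellSpace S m x (k + 1))) +
        (if k = n + 1 then 1 else 0)

/-- `S ⊆ P` is a graded (sub)poset of rank `n` with minimal element `m`: covers in `S`
increase the ambient rank `rk` by one, and all maximal elements of `S` have rank
`rk m + n`. -/
def IsGradedOn (S : Set P) (m : P) (rk : P → ℕ) (n : ℕ) : Prop :=
  m ∈ S ∧ (∀ x ∈ S, m ≤ x) ∧
    (∀ a ∈ S, ∀ b ∈ S, a < b → (¬ ∃ c ∈ S, a < c ∧ c < b) → rk b = rk a + 1) ∧
    (∀ a ∈ S, (∀ b ∈ S, ¬ a < b) → rk a = rk m + n)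

/-- `S ⊆ P` (with minimal element `m` and ambient rank function `rk`) is a Gorenstein*
poset of rank `n`. -/
def IsGorensteinStarOn (S : Set P) (m : P) (rk : P → ℕ) (n : ℕ) : Prop :=
  IsGradedOn S m rk n ∧ GorensteinOn S m n

/-- The pair `(S, B)` (with minimal element `m` and ambient rank function `rk`) is a
near-Gorenstein* poset of rank `n` with boundary `B`: `B` is an order ideal of `S` of
rank `n-1` which is Gorenstein* of rank `n-1`, and the order complex of `S` is a real
homology ball with boundary the order complex of `B`: for every chain `x` of `S`, the
cellular complex of `[x, 1̂)` is exact, except that when `x` is not a chain of `B` the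
homology at the top is 1-dimensional. -/
def IsNearGorensteinStarOn (S B : Set P) (m : P) (rk : P → ℕ) (n : ℕ) : Prop :=
  IsGradedOn S m rk n ∧ B ⊆ S ∧ (∀ σ ∈ B, ∀ τ ∈ S, τ ≤ σ → τ ∈ B) ∧
    IsGradedOn B m rk (n - 1) ∧ GorensteinOn B m (n - 1) ∧
    ∀ x : Finset P, chainIn S m x → ∀ k : ℕ,
      Module.finrank ℝ ↥(LinearMap.ker (bnd x) ⊓ cellSpace S m x k) =
        Module.finrank ℝ ↥(Submodule.map (bnd x) (cellSpace S m x (k + 1))) +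
          (if k = n + 1 ∧ ¬(↑x ⊆ B) then 1 else 0)

end Posets

end

universe u

set_option linter.unusedSectionVars false

noncomputable section

namespace NC

/-- The algebra automorphism exchanging `a` and `b`. -/
def swap : NC →ₐ[ℚ] NC := FreeAlgebra.lift ℚ ![vb, va]

@[simp] lemma swap_va : swap va = vb := by simp [swap, va]
@[simp] lemma swap_vb : swap vb = va := by simp [swap, vb]
@[simp] lemma swap_vc : swap vc = vc := by simp [vc, add_comm]
@[simp] lemma swap_vd : swap vd = vd := by simp [vd, add_comm]

/-- A representation of `NC` detecting the part of a polynomial ending in `a`. -/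
def foxMatrix : NC →ₐ[ℚ] Matrix (Fin 2) (Fin 2) NC :=
  FreeAlgebra.lift ℚ ![!![va, 1; 0, 0], !![vb, 0; 0, 0]]

lemma foxMatrix_apply (x : NC) :
    foxMatrix x 0 0 = x ∧ foxMatrix x 1 0 = 0 := by
  induction x using FreeAlgebra.induction with
  | grade0 r => simp [Algebra.algebraMap_eq_smul_one]
  | grade1 i => fin_cases i <;> simp [foxMatrix, va, vb]
  | mul x y hx hy => simp [Matrix.mul_apply, Fin.sum_univ_two, hx, hy]
  | add x y hx hy => simp [hx, hy]

lemma eq_zero_of_mul_va_add_mul_vb {x y : NC} (h : x * va + y * vb = 0) : x = 0 := by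
  have h1 : (foxMatrix (x * va + y * vb)) 0 1 = 0 := by rw [h]; simp
  have ha : foxMatrix va = !![va, 1; 0, 0] := by simp [foxMatrix, va]
  have hb : foxMatrix vb = !![vb, 0; 0, 0] := by simp [foxMatrix, vb]
  simpa [Matrix.mul_apply, Fin.sum_univ_two, ha, hb, foxMatrix_apply] using h1

lemma mul_va_sub_vb_eq_zero {x : NC} (h : x * (va - vb) = 0) : x = 0 :=
  eq_zero_of_mul_va_add_mul_vb (y := -x) (by rw [← h]; noncomm_ring)

/-- The polynomials in `c` and `d` with nonnegative integer coefficients. -/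
def cone : Subsemiring NC := Subsemiring.closure {vc, vd}

lemma vc_mem_cone : vc ∈ cone := Subsemiring.subset_closure (by simp)
lemma vd_mem_cone : vd ∈ cone := Subsemiring.subset_closure (by simp)

lemma swap_of_mem_cone {x : NC} (h : x ∈ cone) : swap x = x := by
  induction h using Subsemiring.closure_induction with
  | mem x hx => rcases hx with rfl | rfl <;> simp
  | zero => simp
  | one => simp
  | add x y _ _ hx hy => simp [hx, hy]
  | mul x y _ _ hx hy => simp [hx, hy]

lemma cdMonomial_append (u w : List Bool) :
    cdMonomial (u ++ w) = cdMonomial u * cdMonomial w := by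
  induction u with
  | nil => simp [cdMonomial]
  | cons s u ih => simp [cdMonomial, ih, mul_assoc]

lemma cdEval_add (f g : List Bool →₀ ℤ) : cdEval (f + g) = cdEval f + cdEval g := by
  unfold cdEval
  rw [Finsupp.sum_add_index'] <;> intros <;> simp [add_smul]

lemma cdEval_single (w : List Bool) (z : ℤ) :
    cdEval (Finsupp.single w z) = (z : ℚ) • cdMonomial w := by
  simp [cdEval]

lemma exists_cdEval_of_mem_cone {x : NC} (h : x ∈ cone) :
    ∃ f : List Bool →₀ ℤ, x = cdEval f ∧ ∀ w, 0 ≤ f w := by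
  rw [cone, Subsemiring.mem_closure_iff] at h
  induction h using AddSubmonoid.closure_induction with
  | mem x hx =>
    suffices ∃ w, x = cdMonomial w by
      obtain ⟨w, rfl⟩ := this
      refine ⟨Finsupp.single w 1, by simp [cdEval_single], fun u => ?_⟩
      rw [Finsupp.single_apply]; split_ifs <;> simp
    induction hx using Submonoid.closure_induction with
    | mem x hx =>
      rcases hx with rfl | rfl
      · exact ⟨[false], by simp [cdMonomial]⟩
      · exact ⟨[true], by simp [cdMonomial]⟩
    | one => exact ⟨[], rfl⟩
    | mul x y _ _ hx hy =>
      obtain ⟨u, rfl⟩ := hx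
      obtain ⟨w, rfl⟩ := hy
      exact ⟨u ++ w, (cdMonomial_append u w).symm⟩
  | zero => exact ⟨0, by simp [cdEval], by simp⟩
  | add x y _ _ hx hy =>
    obtain ⟨f, rfl, hf⟩ := hx
    obtain ⟨g, rfl, hg⟩ := hy
    exact ⟨f + g, (cdEval_add f g).symm, fun w => add_nonneg (hf w) (hg w)⟩

/-- A derivation given on generators, realized on the trivial square-zero extension. -/
def derivHom (u : Fin 2 → NC) : NC →ₐ[ℚ] TrivSqZeroExt NC NC :=
  FreeAlgebra.lift ℚ fun i => TrivSqZeroExt.inl (FreeAlgebra.ι ℚ i) + TrivSqZeroExt.inr (u i)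

lemma fst_derivHom (u : Fin 2 → NC) (x : NC) : (derivHom u x).fst = x := by
  have : (TrivSqZeroExt.fstHom ℚ NC NC).comp (derivHom u) = AlgHom.id ℚ NC := by
    ext i; simp [derivHom]
  exact DFunLike.congr_fun this x

/-- The derivation of `NC` with prescribed values on the variables. -/
def deriv (u : Fin 2 → NC) : NC →ₗ[ℚ] NC :=
  (TrivSqZeroExt.sndHom NC NC).restrictScalars ℚ ∘ₗ (derivHom u).toLinearMap

lemma deriv_mul (u : Fin 2 → NC) (x y : NC) :
    deriv u (x * y) = deriv u x * y + x * deriv u y := by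
  simp [deriv, fst_derivHom, add_comm]

lemma deriv_va (u : Fin 2 → NC) : deriv u va = u 0 := by simp [deriv, derivHom, va]
lemma deriv_vb (u : Fin 2 → NC) : deriv u vb = u 1 := by simp [deriv, derivHom, vb]
lemma deriv_one (u : Fin 2 → NC) : deriv u 1 = 0 := by
  have := deriv_mul u 1 1
  simpa using this

/-- The derivation with `a, b ↦ ba`. -/
def D : NC →ₗ[ℚ] NC := deriv ![vb * va, vb * va]
/-- The derivation with `a ↦ ba`, `b ↦ ab`. -/
def G : NC →ₗ[ℚ] NC := deriv ![vb * va, va * vb]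

lemma D_mul (x y : NC) : D (x * y) = D x * y + x * D y := deriv_mul _ x y
lemma G_mul (x y : NC) : G (x * y) = G x * y + x * G y := deriv_mul _ x y
@[simp] lemma D_one : D 1 = 0 := deriv_one _
@[simp] lemma G_one : G 1 = 0 := deriv_one _
@[simp] lemma D_va : D va = vb * va := deriv_va _
@[simp] lemma D_vb : D vb = vb * va := deriv_vb _
@[simp] lemma G_va : G va = vb * va := deriv_va _
@[simp] lemma G_vb : G vb = va * vb := deriv_vb _

lemma D_va_sub_vb_pow (k : ℕ) : D ((va - vb) ^ k) = 0 := by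
  induction k with
  | zero => simp
  | succ k ih => simp [pow_succ, D_mul, ih]

lemma G_eq (x : NC) : G x = va * x - x * va + D x := by
  induction x using FreeAlgebra.induction with
  | grade0 r => simp [Algebra.algebraMap_eq_smul_one]
  | grade1 i =>
    fin_cases i
    · change G va = _ * va - va * _ + D va; simp
    · change G vb = _ * vb - vb * _ + D vb; simp
  | mul x y hx hy => rw [G_mul, D_mul, hx, hy]; noncomm_ring
  | add x y hx hy => rw [map_add, map_add, hx, hy]; noncomm_ring

lemma G_mem_cone {x : NC} (h : x ∈ cone) : G x ∈ cone := by
  induction h using Subsemiring.closure_induction with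
  | mem x hx =>
    rcases hx with rfl | rfl
    · have : G vc = vd := by simp [vc, vd, add_comm]
      rw [this]; exact vd_mem_cone
    · have : G vd = vc * vd := by simp [vc, vd, G_mul]; noncomm_ring
      rw [this]; exact mul_mem vc_mem_cone vd_mem_cone
  | zero => simp
  | one => simp
  | add x y _ _ hx hy => rw [map_add]; exact add_mem hx hy
  | mul x y hx' hy' hx hy =>
    rw [G_mul]
    exact add_mem (mul_mem hx hy') (mul_mem hx' hy)

/-- The effect on the `ab`-index of taking the pyramid. -/
def pyr : NC →ₗ[ℚ] NC := LinearMap.mulRight ℚ vc + G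

lemma pyr_apply (x : NC) : pyr x = x * vc + G x := rfl

lemma pyr_eq (x : NC) : pyr x = va * x + x * vb + D x := by
  rw [pyr_apply, G_eq, vc]; noncomm_ring

lemma pyr_mem_cone {x : NC} (h : x ∈ cone) : pyr x ∈ cone :=
  add_mem (mul_mem h vc_mem_cone) (G_mem_cone h)

/-- The `ab`-index of the boundary of a simplex with `k` vertices. -/
def bool : ℕ → NC
  | k => (va - vb) ^ (k - 1) +
      ∑ j : Fin k, if 0 < j.1 then
        (k.choose j : ℚ) • (bool j * vb * (va - vb) ^ (k - j - 1)) else 0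

lemma bool_eq (k : ℕ) : bool k = (va - vb) ^ (k - 1) +
    ∑ j ∈ Finset.range k, if 0 < j then
      (k.choose j : ℚ) • (bool j * vb * (va - vb) ^ (k - j - 1)) else 0 := by
  rw [bool, Finset.sum_range]

lemma bool_succ_eq (m : ℕ) : bool (m + 1) = (va - vb) ^ m +
    ∑ i ∈ Finset.range m,
      ((m + 1).choose (i + 1) : ℚ) • (bool (i + 1) * vb * (va - vb) ^ (m - i - 1)) := by
  rw [bool_eq, Finset.sum_range_succ']
  simp only [Nat.add_sub_cancel, Nat.succ_pos, if_true, lt_irrefl, if_false, add_zero]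
  congr 1
  refine Finset.sum_congr rfl fun i _ => ?_
  rw [show m + 1 - (i + 1) - 1 = m - i - 1 by omega]

lemma bool_one : bool 1 = 1 := by rw [bool_succ_eq]; simp

lemma bool_add_two (m : ℕ) : bool (m + 2) = pyr (bool (m + 1)) := by
  induction m using Nat.strong_induction_on with
  | _ m ih =>
  have hD : D (bool (m + 1)) = ∑ i ∈ Finset.range m, ((m + 1).choose (i + 1) : ℚ) •
      ((bool (i + 2) * vb * (va - vb) ^ (m - i - 1)) -
        va * (bool (i + 1) * vb * (va - vb) ^ (m - i - 1)) +
        bool (i + 1) * vb * (va - vb) ^ (m - i)) := by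
    rw [bool_succ_eq, map_add, D_va_sub_vb_pow, zero_add, map_sum]
    refine Finset.sum_congr rfl fun i hi => ?_
    rw [Finset.mem_range] at hi
    rw [map_smul, D_mul, D_mul, D_va_sub_vb_pow, ih i hi, pyr_eq]
    congr 1
    rw [show m - i = (m - i - 1) + 1 by omega, pow_succ', D_vb]
    simp only [Nat.add_sub_cancel]
    noncomm_ring
  have hL : va * bool (m + 1) = va * (va - vb) ^ m + ∑ i ∈ Finset.range m,
      ((m + 1).choose (i + 1) : ℚ) • (va * (bool (i + 1) * vb * (va - vb) ^ (m - i - 1))) := by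
    rw [bool_succ_eq m, mul_add, Finset.mul_sum]
    simp only [mul_smul_comm]
  have hR : bool (m + 2) = (va - vb) ^ (m + 1) +
      (∑ i ∈ Finset.range m, ((m + 1).choose (i + 1) : ℚ) •
        (bool (i + 1) * vb * (va - vb) ^ (m - i)) + bool (m + 1) * vb) +
      (∑ i ∈ Finset.range m, ((m + 1).choose (i + 1) : ℚ) •
        (bool (i + 2) * vb * (va - vb) ^ (m - i - 1)) + vb * (va - vb) ^ m) := by
    have h1 : ∑ i ∈ Finset.range m, ((m + 1).choose (i + 1) : ℚ) •
        (bool (i + 1) * vb * (va - vb) ^ (m - i)) + bool (m + 1) * vb =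
        ∑ i ∈ Finset.range (m + 1), ((m + 1).choose (i + 1) : ℚ) •
        (bool (i + 1) * vb * (va - vb) ^ (m - i)) := by
      rw [Finset.sum_range_succ]; simp
    have h2 : ∑ i ∈ Finset.range m, ((m + 1).choose (i + 1) : ℚ) •
        (bool (i + 2) * vb * (va - vb) ^ (m - i - 1)) + vb * (va - vb) ^ m =
        ∑ i ∈ Finset.range (m + 1), ((m + 1).choose i : ℚ) •
        (bool (i + 1) * vb * (va - vb) ^ (m - i)) := by
      rw [Finset.sum_range_succ']
      simp [bool_one, Nat.sub_sub, add_assoc]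
    rw [h1, h2, add_assoc, ← Finset.sum_add_distrib, bool_succ_eq (m + 1)]
    congr 1
    refine Finset.sum_congr rfl fun i hi => ?_
    rw [← add_smul, Nat.choose_succ_succ' (m + 1) i, Nat.cast_add, add_comm,
      show m + 1 - i - 1 = m - i by omega, add_comm (_ : ℚ)]
  rw [hR, pyr_eq, hD, hL]
  simp only [smul_add, smul_sub, Finset.sum_add_distrib, Finset.sum_sub_distrib]
  rw [pow_succ' _ m]
  noncomm_ring

lemma bool_mem_cone (m : ℕ) : bool (m + 1) ∈ cone := by
  induction m with
  | zero => rw [bool_one]; exact one_mem _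
  | succ m ih => rw [bool_add_two]; exact pyr_mem_cone ih

variable {L : Type*} [Fintype L] [PartialOrder L]

/-- The `ab`-index of the open interval `(o, σ)` of a graded poset. -/
def interval (ρ : L → ℕ) (o σ : L) : NC :=
  ∑ θ : {θ : L // o ≤ θ ∧ θ < σ},
    (if θ.1 = o then 1 else interval ρ o θ.1 * vb) * (va - vb) ^ (ρ σ - ρ θ.1 - 1)
termination_by (wellFounded_lt (α := L)).wrap σ
decreasing_by exact θ.2.2

/-- The sum of the weights of the chains from `o` whose last element is `θ`. -/
def last (ρ : L → ℕ) (o θ : L) : NC := if θ = o then 1 else interval ρ o θ * vb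

variable {ρ : L → ℕ}

lemma interval_eq_zero {o σ : L} (h : ¬ o < σ) : interval ρ o σ = 0 := by
  rw [interval]
  have : IsEmpty {θ : L // o ≤ θ ∧ θ < σ} := ⟨fun θ => h (θ.2.1.trans_lt θ.2.2)⟩
  simp

lemma last_eq_zero {o σ : L} (h : ¬ o ≤ σ) : last ρ o σ = 0 := by
  rw [last, if_neg (by rintro rfl; exact h le_rfl), interval_eq_zero (fun h' => h h'.le), zero_mul]

@[simp] lemma last_self (o : L) : last ρ o o = 1 := by simp [last]

lemma last_of_ne {o σ : L} (h : σ ≠ o) : last ρ o σ = interval ρ o σ * vb := by simp [last, h]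

lemma interval_eq (o σ : L) : interval ρ o σ =
    ∑ θ, if θ < σ then last ρ o θ * (va - vb) ^ (ρ σ - ρ θ - 1) else 0 := by
  rw [interval]
  change ∑ θ : {θ : L // o ≤ θ ∧ θ < σ}, last ρ o θ.1 * (va - vb) ^ (ρ σ - ρ θ.1 - 1) = _
  rw [← Finset.sum_subtype (Finset.univ.filter fun θ : L => o ≤ θ ∧ θ < σ) (by simp)
    fun θ => last ρ o θ * (va - vb) ^ (ρ σ - ρ θ - 1), Finset.sum_filter]
  refine Finset.sum_congr rfl fun θ _ => ?_
  by_cases h : o ≤ θ <;> simp [h, last_eq_zero]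

lemma interval_eq_right {o σ : L} (h : o < σ) : interval ρ o σ =
    (va - vb) ^ (ρ σ - ρ o - 1) + ∑ θ, if θ < σ then
      interval ρ o θ * vb * (va - vb) ^ (ρ σ - ρ θ - 1) else 0 := by
  rw [interval_eq]
  have : ∀ θ, (if θ < σ then last ρ o θ * (va - vb) ^ (ρ σ - ρ θ - 1) else 0) =
      (if o = θ then (va - vb) ^ (ρ σ - ρ o - 1) else 0) + if θ < σ then
      interval ρ o θ * vb * (va - vb) ^ (ρ σ - ρ θ - 1) else 0 := by
    intro θ
    by_cases e : o = θ
    · subst e; simp [h, interval_eq_zero]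
    · rw [last_of_ne (Ne.symm e), if_neg e, zero_add]
  simp only [this, Finset.sum_add_distrib, Finset.sum_ite_eq, Finset.mem_univ, if_true]

lemma interval_eq_left (o σ : L) (h : o < σ) : interval ρ o σ =
    (va - vb) ^ (ρ σ - ρ o - 1) + ∑ θ, if o < θ then
      (va - vb) ^ (ρ θ - ρ o - 1) * vb * interval ρ θ σ else 0 := by
  induction σ using WellFoundedLT.induction with
  | ind σ ih =>
  rw [interval_eq_right h]
  congr 1
  have h1 : ∀ x, (if x < σ then interval ρ o x * vb * (va - vb) ^ (ρ σ - ρ x - 1) else 0) =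
      (if x < σ ∧ o < x then
        (va - vb) ^ (ρ x - ρ o - 1) * vb * (va - vb) ^ (ρ σ - ρ x - 1) else 0) +
      ∑ θ, if x < σ ∧ o < θ then (va - vb) ^ (ρ θ - ρ o - 1) * vb *
        (interval ρ θ x * vb * (va - vb) ^ (ρ σ - ρ x - 1)) else 0 := by
    intro x
    by_cases hx : x < σ
    · by_cases ho : o < x
      · rw [if_pos hx, ih x hx ho]
        simp only [hx, ho, true_and, and_self, if_true, add_mul, Finset.sum_mul, ite_mul, zero_mul,
          mul_assoc]
      · simp only [hx, ho, if_true, and_false, if_false, zero_add, true_and, interval_eq_zero ho,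
          zero_mul]
        symm
        refine Finset.sum_eq_zero fun θ _ => ?_
        split_ifs with hθ
        · rw [interval_eq_zero fun h' => ho (hθ.trans h')]; simp
        · rfl
    · simp [hx]
  rw [Finset.sum_congr rfl fun x _ => h1 x, Finset.sum_add_distrib, Finset.sum_comm,
    ← Finset.sum_add_distrib]
  refine Finset.sum_congr rfl fun θ _ => ?_
  by_cases hθ : o < θ
  · by_cases hs : θ < σ
    · simp only [hθ, hs, and_self, if_true, and_true, interval_eq_right hs, mul_add, Finset.mul_sum,
        mul_ite, mul_zero]
    · simp only [hθ, hs, if_false, zero_add, interval_eq_zero hs, mul_zero, and_true,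
        if_true]
      refine Finset.sum_eq_zero fun x _ => ?_
      split_ifs with hx
      · rw [interval_eq_zero fun h' => hs (h'.trans hx)]; simp
      · rfl
  · simp [hθ]

lemma D_interval (o σ : L) : D (interval ρ o σ) =
    ∑ y, interval ρ o y * vb * va * interval ρ y σ := by
  induction σ using WellFoundedLT.induction with
  | ind σ ih =>
  by_cases h : o < σ
  · rw [interval_eq_right h, map_add, D_va_sub_vb_pow, zero_add, map_sum]
    have h1 : ∀ x, D (if x < σ then interval ρ o x * vb * (va - vb) ^ (ρ σ - ρ x - 1) else 0) =
        (if x < σ then interval ρ o x * vb * va * (va - vb) ^ (ρ σ - ρ x - 1) else 0) +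
        ∑ y, interval ρ o y * vb * va * (if x < σ then interval ρ y x * vb *
          (va - vb) ^ (ρ σ - ρ x - 1) else 0) := by
      intro x
      by_cases hx : x < σ
      · simp only [hx, if_true, D_mul, D_va_sub_vb_pow, ih x hx, D_vb, Finset.sum_mul, mul_zero,
          add_zero, mul_assoc]
        rw [add_comm]
      · simp [hx]
    rw [Finset.sum_congr rfl fun x _ => h1 x, Finset.sum_add_distrib, Finset.sum_comm,
      ← Finset.sum_add_distrib]
    refine Finset.sum_congr rfl fun y _ => ?_
    by_cases hy : y < σ
    · rw [interval_eq_right hy, if_pos hy, mul_add, Finset.mul_sum]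
    · rw [if_neg hy, interval_eq_zero hy, zero_add, mul_zero]
      refine Finset.sum_eq_zero fun x _ => ?_
      split_ifs with hx
      · rw [interval_eq_zero fun h' => hy (h'.trans hx)]; simp
      · simp
  · rw [interval_eq_zero h, map_zero]
    symm
    refine Finset.sum_eq_zero fun y _ => ?_
    by_cases h1 : o < y
    · rw [interval_eq_zero (o := y) fun h2 => h (h1.trans h2), mul_zero]
    · rw [interval_eq_zero h1]; simp

/-- The weighted `ab`-index up to rank `m`, with weight function `w`. -/
def index (ρ : L → ℕ) (o : L) (m : ℕ) (w : L → ℚ) : NC :=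
  ∑ σ, if ρ σ ≤ m then w σ • (last ρ o σ * (va - vb) ^ (m - ρ σ)) else 0

/-- The dual weight function at level `k`. -/
def dualWeight (ρ : L → ℕ) (k : ℕ) (w : L → ℚ) (η : L) : ℚ :=
  ∑ ξ, if η ≤ ξ ∧ ρ ξ ≤ k then (-1) ^ (k - ρ ξ) * w ξ else 0

lemma swap_pow (j : ℕ) : swap ((va - vb) ^ j) = (-1 : ℚ) ^ j • (va - vb) ^ j := by
  rw [map_pow, map_sub, swap_va, swap_vb, ← smul_pow]
  congr 1
  simp

lemma sum_last_mul (hρ : StrictMono ρ) {o ξ : L} {k : ℕ} (hk : ρ ξ ≤ k)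
    (hs : o < ξ → swap (interval ρ o ξ) = interval ρ o ξ) :
    (∑ η, if η ≤ ξ then last ρ o η * (va - vb) ^ (k - ρ η) else 0) =
      swap (last ρ o ξ) * (va - vb) ^ (k - ρ ξ) := by
  have h1 : ∀ η, (if η ≤ ξ then last ρ o η * (va - vb) ^ (k - ρ η) else 0) =
      (if ξ = η then last ρ o ξ * (va - vb) ^ (k - ρ ξ) else 0) +
      (if η < ξ then last ρ o η * (va - vb) ^ (ρ ξ - ρ η - 1) else 0) *
        ((va - vb) * (va - vb) ^ (k - ρ ξ)) := by
    intro η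
    by_cases h : η < ξ
    · rw [if_pos h.le, if_neg h.ne', if_pos h, zero_add, ← pow_succ', mul_assoc, ← pow_add]
      have := hρ h
      congr 2
      omega
    · by_cases e : ξ = η
      · subst e; simp
      · have : ¬ η ≤ ξ := fun h' => h (lt_of_le_of_ne h' (Ne.symm e))
        simp [h, e, this]
  rw [Finset.sum_congr rfl fun η _ => h1 η, Finset.sum_add_distrib, ← Finset.sum_mul,
    ← interval_eq]
  simp only [Finset.sum_ite_eq, Finset.mem_univ, if_true]
  rw [← mul_assoc, ← add_mul]
  congr 1
  by_cases e : ξ = o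
  · subst e; simp [interval_eq_zero]
  · rw [last_of_ne e, map_mul, swap_vb]
    by_cases h : o < ξ
    · rw [hs h]; noncomm_ring
    · simp [interval_eq_zero h]

lemma index_dualWeight (hρ : StrictMono ρ) {o : L} {k : ℕ} (w : L → ℚ)
    (hs : ∀ ξ, o < ξ → ρ ξ ≤ k → swap (interval ρ o ξ) = interval ρ o ξ) :
    index ρ o k (dualWeight ρ k w) = swap (index ρ o k w) := by
  have h1 : ∀ η, (if ρ η ≤ k then dualWeight ρ k w η • (last ρ o η * (va - vb) ^ (k - ρ η)) else 0)
      = ∑ ξ, if ρ ξ ≤ k then ((-1) ^ (k - ρ ξ) * w ξ) •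
        (if η ≤ ξ then last ρ o η * (va - vb) ^ (k - ρ η) else 0) else 0 := by
    intro η
    rw [dualWeight, Finset.sum_smul]
    by_cases h : ρ η ≤ k
    · rw [if_pos h]
      refine Finset.sum_congr rfl fun ξ _ => ?_
      by_cases h1 : η ≤ ξ <;> by_cases h2 : ρ ξ ≤ k <;> simp [h1, h2]
    · rw [if_neg h]
      symm
      refine Finset.sum_eq_zero fun ξ _ => ?_
      split_ifs with h1 h2
      · exact absurd ((hρ.monotone h2).trans h1) h
      · simp
      · rfl
  rw [index, Finset.sum_congr rfl fun η _ => h1 η, Finset.sum_comm, index, map_sum]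
  refine Finset.sum_congr rfl fun ξ _ => ?_
  by_cases h : ρ ξ ≤ k
  · simp only [h, if_true, ← Finset.smul_sum]
    rw [sum_last_mul hρ h fun h' => hs ξ h' h, map_smul, map_mul, swap_pow, mul_smul_comm,
      smul_smul, mul_comm]
  · simp [h]

lemma neg_one_pow_sub {k r : ℕ} (h : r ≤ k) : (-1 : ℚ) ^ (k - r) = (-1) ^ k * (-1) ^ r := by
  obtain ⟨j, rfl⟩ := Nat.exists_eq_add_of_le h
  rw [Nat.add_sub_cancel_left, pow_add, mul_right_comm, ← mul_pow]
  simp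

/-- The Eulerian relations for all intervals, with respect to a rank function. -/
def Eulerian (ρ : L → ℕ) : Prop :=
  ∀ η σ : L, η < σ → (∑ ξ, if η ≤ ξ ∧ ξ ≤ σ then (-1 : ℚ) ^ ρ ξ else 0) = 0

lemma swap_interval (hρ : StrictMono ρ) (hE : Eulerian ρ) (o σ : L) :
    swap (interval ρ o σ) = interval ρ o σ := by
  induction hr : ρ σ using Nat.strong_induction_on generalizing σ with
  | _ r ih =>
  subst hr
  by_cases ho : o < σ
  swap; · simp [interval_eq_zero ho]
  have hlt : 0 < ρ σ := (Nat.zero_le _).trans_lt (hρ ho)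
  have h1 : interval ρ o σ = index ρ o (ρ σ - 1) (fun ξ => if ξ < σ then 1 else 0) := by
    rw [interval_eq, index]
    refine Finset.sum_congr rfl fun θ _ => ?_
    by_cases h : θ < σ
    · have := hρ h
      rw [if_pos h, if_pos (by omega), if_pos h, one_smul, Nat.sub_right_comm]
    · simp [h]
  have h2 : dualWeight ρ (ρ σ - 1) (fun ξ => if ξ < σ then 1 else 0) =
      fun ξ => if ξ < σ then 1 else 0 := by
    funext η
    rw [dualWeight]
    by_cases h : η < σ
    · rw [if_pos h]
      have e := hE η σ h
      have h3 : ∀ ξ, (if η ≤ ξ ∧ ρ ξ ≤ ρ σ - 1 then (-1 : ℚ) ^ (ρ σ - 1 - ρ ξ) *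
          (if ξ < σ then 1 else 0) else 0) = (-1) ^ (ρ σ - 1) *
          ((if η ≤ ξ ∧ ξ ≤ σ then (-1 : ℚ) ^ ρ ξ else 0) - if σ = ξ then (-1) ^ ρ σ else 0) := by
        intro ξ
        by_cases h4 : ξ < σ
        · have := hρ h4
          have h5 : ρ ξ ≤ ρ σ - 1 := by omega
          simp [h4, h4.le, h4.ne', h5, neg_one_pow_sub h5]
        · by_cases h5 : σ = ξ
          · subst h5; simp [h.le]
          · have : ¬ ξ ≤ σ := fun h' => h4 (lt_of_le_of_ne h' (Ne.symm h5))
            simp [h4, h5, this]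
      rw [Finset.sum_congr rfl fun ξ _ => h3 ξ, ← Finset.mul_sum, Finset.sum_sub_distrib, e]
      simp only [Finset.sum_ite_eq, Finset.mem_univ, if_true]
      obtain ⟨j, hj⟩ := Nat.exists_eq_succ_of_ne_zero hlt.ne'
      rw [hj, Nat.succ_eq_add_one, Nat.add_sub_cancel, pow_succ]
      have : ((-1 : ℚ) ^ j) * (-1) ^ j = 1 := by rw [← mul_pow]; simp
      linear_combination this
    · rw [if_neg h]
      refine Finset.sum_eq_zero fun ξ _ => ?_
      split_ifs with h1 h2
      · exact absurd (h1.1.trans_lt h2) h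
      · simp
      · rfl
  conv_lhs => rw [h1, ← index_dualWeight hρ _ fun ξ _ hk => ih (ρ ξ) (by omega) ξ rfl]
  rw [h2, ← h1]

variable {L : Type*} [Fintype L] [PartialOrder L] {ρ : L → ℕ}

/-- The chains from `o` avoiding the filter of `v` whose last element has join `y` with `v`;
the map `J` is the join with `v`. -/
def joinPart (ρ : L → ℕ) (o v : L) (J : L → L) (y : L) : NC :=
  ∑ x, if ¬ v ≤ x ∧ J x = y then last ρ o x * (va - vb) ^ (ρ y - ρ x - 1) else 0

/-- The sum of the join parts strictly below `y`. -/
def joinBelow (ρ : L → ℕ) (o v : L) (J : L → L) (y : L) : NC :=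
  ∑ y', if y' < y then joinPart ρ o v J y' * (va - vb) ^ (ρ y - ρ y' - 1) else 0

/-- The local contribution of `y` to the pyramid decomposition. -/
def joinLocal (ρ : L → ℕ) (o v : L) (J : L → L) (y : L) : NC :=
  joinPart ρ o v J y - joinBelow ρ o v J y * vb

variable {o v : L} {J : L → L}

lemma le_join (hJ : ∀ x z, J x ≤ z ↔ x ≤ z ∧ v ≤ z) (x : L) : x ≤ J x :=
  ((hJ x (J x)).1 le_rfl).1

lemma le_join' (hJ : ∀ x z, J x ≤ z ↔ x ≤ z ∧ v ≤ z) (x : L) : v ≤ J x :=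
  ((hJ x (J x)).1 le_rfl).2

lemma joinPart_eq_zero (hJ : ∀ x z, J x ≤ z ↔ x ≤ z ∧ v ≤ z) {y : L} (h : ¬ v ≤ y) :
    joinPart ρ o v J y = 0 := by
  refine Finset.sum_eq_zero fun x _ => if_neg ?_
  rintro ⟨-, rfl⟩
  exact h (le_join' hJ x)

lemma lt_of_join_eq (hJ : ∀ x z, J x ≤ z ↔ x ≤ z ∧ v ≤ z) {x y : L} (hx : ¬ v ≤ x)
    (h : J x = y) : x < y := by
  subst h
  refine lt_of_le_of_ne (le_join hJ x) fun h' => hx ?_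
  rw [h']
  exact le_join' hJ x

lemma sum_not_le (hρ : StrictMono ρ) (hJ : ∀ x z, J x ≤ z ↔ x ≤ z ∧ v ≤ z) {z : L} (hz : v ≤ z) :
    (∑ x, if ¬ v ≤ x ∧ x < z then last ρ o x * (va - vb) ^ (ρ z - ρ x - 1) else 0) =
      joinPart ρ o v J z + joinBelow ρ o v J z * (va - vb) := by
  have h1 : ∀ x, (if ¬ v ≤ x ∧ x < z then last ρ o x * (va - vb) ^ (ρ z - ρ x - 1) else 0) =
      (if ¬ v ≤ x ∧ J x = z then last ρ o x * (va - vb) ^ (ρ z - ρ x - 1) else 0) +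
      ∑ y, if y < z then (if ¬ v ≤ x ∧ J x = y then last ρ o x * (va - vb) ^ (ρ y - ρ x - 1)
        else 0) * (va - vb) ^ (ρ z - ρ y - 1) * (va - vb) else 0 := by
    intro x
    by_cases hx : v ≤ x
    · simp [hx]
    have h2 : ∀ y, (if y < z then (if ¬ v ≤ x ∧ J x = y then
        last ρ o x * (va - vb) ^ (ρ y - ρ x - 1) else 0) * (va - vb) ^ (ρ z - ρ y - 1) *
          (va - vb) else 0) = if J x = y then (if J x < z then
        last ρ o x * (va - vb) ^ (ρ z - ρ x - 1) else 0) else 0 := by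
      intro y
      by_cases e : J x = y
      · subst e
        by_cases h3 : J x < z
        · simp only [h3, hx, not_false_eq_true, and_self, if_true, mul_assoc, ← pow_succ, ← pow_add]
          have := hρ h3
          have := hρ (lt_of_join_eq hJ hx rfl)
          congr 2
          omega
        · simp [h3]
      · simp [e]
    rw [Finset.sum_congr rfl fun y _ => h2 y]
    simp only [Finset.sum_ite_eq, Finset.mem_univ, if_true, hx, not_false_eq_true, true_and]
    by_cases h3 : x < z
    · have h4 : J x ≤ z := (hJ x z).2 ⟨h3.le, hz⟩
      rcases h4.lt_or_eq with h5 | h5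
      · simp [h3, h5, h5.ne]
      · simp [h3, h5]
    · have h4 : ¬ J x ≤ z := fun h => by
        rcases (le_join hJ x).trans h |>.lt_or_eq with h5 | h5
        · exact h3 h5
        · exact hx (h5 ▸ hz)
      have h5 : J x ≠ z := fun h => h4 h.le
      have h6 : ¬ J x < z := fun h => h4 h.le
      simp [h3, h5, h6]
  rw [Finset.sum_congr rfl fun x _ => h1 x, Finset.sum_add_distrib, Finset.sum_comm]
  congr 1
  rw [joinBelow, Finset.sum_mul]
  refine Finset.sum_congr rfl fun y _ => ?_
  by_cases h : y < z
  · simp only [h, if_true, joinPart, Finset.sum_mul]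
  · simp [h]

lemma interval_eq_joinPart (hρ : StrictMono ρ) (hJ : ∀ x z, J x ≤ z ↔ x ≤ z ∧ v ≤ z)
    (hov : o < v) {z : L} (hz : v ≤ z) : interval ρ o z =
      (∑ y, joinPart ρ o v J y * va * interval ρ y z) + joinPart ρ o v J z := by
  induction z using WellFoundedLT.induction with
  | ind z ih =>
  have h1 : ∀ x, (if x < z then last ρ o x * (va - vb) ^ (ρ z - ρ x - 1) else 0) =
      (if ¬ v ≤ x ∧ x < z then last ρ o x * (va - vb) ^ (ρ z - ρ x - 1) else 0) +
      (∑ y, if x < z then joinPart ρ o v J y * va * interval ρ y x * vb *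
        (va - vb) ^ (ρ z - ρ x - 1) else 0) +
      if x < z then joinPart ρ o v J x * vb * (va - vb) ^ (ρ z - ρ x - 1) else 0 := by
    intro x
    by_cases hxz : x < z
    swap; · simp [hxz]
    by_cases hx : v ≤ x
    · simp only [hxz, hx, if_true, not_true_eq_false, false_and, if_false, zero_add]
      rw [last_of_ne (hov.trans_le hx).ne', ih x hxz hx]
      simp only [add_mul, Finset.sum_mul]
    · simp only [hxz, hx, if_true, not_false_eq_true, true_and, joinPart_eq_zero hJ hx, zero_mul,
        add_zero]
      symm
      rw [add_eq_left]
      refine Finset.sum_eq_zero fun y _ => ?_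
      by_cases hy : v ≤ y
      · rw [interval_eq_zero fun h => hx (hy.trans h.le)]; simp
      · simp [joinPart_eq_zero hJ hy]
  rw [interval_eq, Finset.sum_congr rfl fun x _ => h1 x, Finset.sum_add_distrib,
    Finset.sum_add_distrib, sum_not_le hρ hJ hz, Finset.sum_comm]
  have h2 : ∀ y, joinPart ρ o v J y * va * interval ρ y z =
      (if y < z then joinPart ρ o v J y * (va - vb) ^ (ρ z - ρ y - 1) else 0) * (va - vb) +
      (∑ x, if x < z then joinPart ρ o v J y * va * interval ρ y x * vb *
        (va - vb) ^ (ρ z - ρ x - 1) else 0) +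
      if y < z then joinPart ρ o v J y * vb * (va - vb) ^ (ρ z - ρ y - 1) else 0 := by
    intro y
    by_cases hy : y < z
    · rw [interval_eq_right hy, if_pos hy, if_pos hy, mul_add, Finset.mul_sum]
      simp only [mul_ite, mul_zero, ← mul_assoc]
      have : (va - vb) ^ (ρ z - ρ y - 1) * (va - vb) = (va - vb) * (va - vb) ^ (ρ z - ρ y - 1) := by
        rw [← pow_succ, ← pow_succ']
      rw [mul_assoc _ _ (va - vb), this]
      noncomm_ring
    · rw [interval_eq_zero hy, if_neg hy, if_neg hy]
      simp only [mul_zero, zero_mul, add_zero, zero_add]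
      symm
      refine Finset.sum_eq_zero fun x _ => ?_
      split_ifs with hx
      · rw [interval_eq_zero fun h => hy (h.trans hx)]; simp
      · rfl
  rw [Finset.sum_congr rfl fun y _ => h2 y, Finset.sum_add_distrib, Finset.sum_add_distrib,
    joinBelow, Finset.sum_mul]
  abel

lemma joinBelow_eq (y : L) : joinBelow ρ o v J y =
    ∑ y', joinLocal ρ o v J y' * interval ρ y' y := by
  have h1 : ∀ y', joinLocal ρ o v J y' * interval ρ y' y = joinPart ρ o v J y' * interval ρ y' y -
      ∑ x, if x < y' then joinPart ρ o v J x * (va - vb) ^ (ρ y' - ρ x - 1) * vb *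
        interval ρ y' y else 0 := by
    intro y'
    rw [joinLocal, joinBelow, sub_mul, Finset.sum_mul, Finset.sum_mul]
    simp only [ite_mul, zero_mul]
  rw [Finset.sum_congr rfl fun y' _ => h1 y', Finset.sum_sub_distrib, Finset.sum_comm,
    ← Finset.sum_sub_distrib, joinBelow]
  refine Finset.sum_congr rfl fun x _ => ?_
  by_cases hx : x < y
  · rw [if_pos hx, interval_eq_left x y hx, mul_add, Finset.mul_sum, add_sub_assoc, left_eq_add,
      sub_eq_zero]
    simp only [mul_ite, mul_zero, ← mul_assoc]
  · rw [if_neg hx, interval_eq_zero hx, mul_zero, zero_sub, eq_comm, neg_eq_zero]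
    refine Finset.sum_eq_zero fun y' _ => ?_
    split_ifs with h
    · rw [interval_eq_zero fun h' => hx (h.trans h'), mul_zero]
    · rfl

lemma interval_eq_joinLocal (hρ : StrictMono ρ) (hJ : ∀ x z, J x ≤ z ↔ x ≤ z ∧ v ≤ z)
    (hov : o < v) {z : L} (hz : v ≤ z) : interval ρ o z =
      (∑ y, joinLocal ρ o v J y * pyr (interval ρ y z)) + joinLocal ρ o v J z := by
  have hX : ∀ y, joinPart ρ o v J y = joinLocal ρ o v J y +
      (∑ y', joinLocal ρ o v J y' * interval ρ y' y) * vb := by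
    intro y; rw [← joinBelow_eq, joinLocal, sub_add_cancel]
  rw [interval_eq_joinPart hρ hJ hov hz]
  have h1 : ∀ y, joinPart ρ o v J y * va * interval ρ y z =
      joinLocal ρ o v J y * va * interval ρ y z + ∑ y', joinLocal ρ o v J y' *
        (interval ρ y' y * vb * va * interval ρ y z) := by
    intro y
    rw [hX y, add_mul, add_mul, Finset.sum_mul, Finset.sum_mul, Finset.sum_mul]
    simp only [mul_assoc]
  rw [Finset.sum_congr rfl fun y _ => h1 y, Finset.sum_add_distrib, Finset.sum_comm, hX z,
    Finset.sum_mul]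
  simp only [Finset.mul_sum, D_interval, pyr_eq, mul_add, Finset.sum_add_distrib, ← mul_assoc]
  abel

lemma joinLocal_self (hρ : StrictMono ρ) (hJ : ∀ x z, J x ≤ z ↔ x ≤ z ∧ v ≤ z) (hov : o < v)
    (hv : ρ v = ρ o + 1) : joinLocal ρ o v J v = 1 := by
  have h1 : joinBelow ρ o v J v = 0 := by
    refine Finset.sum_eq_zero fun y _ => ?_
    split_ifs with h
    · rw [joinPart_eq_zero hJ (not_le_of_gt h), zero_mul]
    · rfl
  rw [joinLocal, h1, zero_mul, sub_zero, joinPart, Finset.sum_eq_single o]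
  · rw [if_pos, last_self, hv]
    · simp
    · exact ⟨not_le_of_gt hov, le_antisymm ((hJ o v).2 ⟨hov.le, le_rfl⟩) (le_join' hJ o)⟩
  · intro x _ hx
    split_ifs with h
    · rw [last_eq_zero, zero_mul]
      intro hox
      have h1 := hρ (lt_of_le_of_ne hox (Ne.symm hx))
      have h2 := hρ (lt_of_join_eq hJ h.1 h.2)
      omega
    · rfl
  · simp

lemma index_below (hρ : StrictMono ρ) (hJ : ∀ x z, J x ≤ z ↔ x ≤ z ∧ v ≤ z) {y : L} (hy : v ≤ y) :
    index ρ o (ρ y - 1) (fun x => if ¬ v ≤ x ∧ x ≤ y then 1 else 0) =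
      joinPart ρ o v J y + joinBelow ρ o v J y * (va - vb) := by
  rw [← sum_not_le hρ hJ hy, index]
  refine Finset.sum_congr rfl fun x _ => ?_
  by_cases hx : v ≤ x
  · simp [hx]
  by_cases h : x < y
  · have := hρ h
    simp only [hx, h, h.le, not_false_eq_true, and_self, if_true, one_smul]
    rw [if_pos (by omega), Nat.sub_right_comm]
  · have : ¬ x ≤ y := fun h' => h'.lt_or_eq.elim h fun e => hx (e ▸ hy)
    simp [h, this]

lemma dualWeight_below (hρ : StrictMono ρ) (hE : Eulerian ρ)
    (hJ : ∀ x z, J x ≤ z ↔ x ≤ z ∧ v ≤ z) {y : L} (hy : v ≤ y) (hpos : 0 < ρ y) :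
    dualWeight ρ (ρ y - 1) (fun x => if ¬ v ≤ x ∧ x ≤ y then 1 else 0) =
      fun x => if ¬ v ≤ x ∧ J x = y then 1 else 0 := by
  funext η
  rw [dualWeight]
  have h1 : ∀ ξ, (if η ≤ ξ ∧ ρ ξ ≤ ρ y - 1 then (-1 : ℚ) ^ (ρ y - 1 - ρ ξ) *
      (if ¬ v ≤ ξ ∧ ξ ≤ y then 1 else 0) else 0) =
      (-1) ^ (ρ y - 1) * ((if η ≤ ξ ∧ ξ ≤ y then (-1) ^ ρ ξ else 0) -
        if J η ≤ ξ ∧ ξ ≤ y then (-1) ^ ρ ξ else 0) := by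
    intro ξ
    simp only [hJ]
    by_cases h1 : η ≤ ξ
    swap; · simp [h1]
    by_cases h2 : v ≤ ξ
    · simp [h1, h2]
    by_cases h3 : ξ ≤ y
    swap; · simp [h3]
    have h4 : ξ < y := lt_of_le_of_ne h3 fun e => h2 (e ▸ hy)
    have := hρ h4
    have h5 : ρ ξ ≤ ρ y - 1 := by omega
    simp [h1, h2, h3, h5, neg_one_pow_sub h5]
  rw [Finset.sum_congr rfl fun ξ _ => h1 ξ, ← Finset.mul_sum, Finset.sum_sub_distrib]
  by_cases hη : v ≤ η
  · have : ∀ ξ, J η ≤ ξ ↔ η ≤ ξ := fun ξ => by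
      rw [hJ]; exact ⟨fun h => h.1, fun h => ⟨h, hη.trans h⟩⟩
    simp [this, hη]
  have hz : ∀ x, x ≠ y → (∑ ξ, if x ≤ ξ ∧ ξ ≤ y then (-1 : ℚ) ^ ρ ξ else 0) = 0 := by
    intro x hx
    by_cases hxy : x < y
    · exact hE x y hxy
    · refine Finset.sum_eq_zero fun ξ _ => if_neg ?_
      rintro ⟨h1, h2⟩
      exact hxy (lt_of_le_of_ne (h1.trans h2) hx)
  rw [hz η (fun e => hη (e ▸ hy)), zero_sub]
  by_cases h : J η = y
  · have h2 : ∀ ξ, (if J η ≤ ξ ∧ ξ ≤ y then (-1 : ℚ) ^ ρ ξ else 0) =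
        if y = ξ then (-1) ^ ρ y else 0 := by
      intro ξ
      rw [h]
      by_cases e : y = ξ
      · subst e; simp
      · rw [if_neg e, if_neg]; exact fun h => e (le_antisymm h.1 h.2)
    rw [Finset.sum_congr rfl fun ξ _ => h2 ξ]
    simp only [Finset.sum_ite_eq, Finset.mem_univ, if_true, h, hη, not_false_eq_true, and_self]
    obtain ⟨j, hj⟩ := Nat.exists_eq_succ_of_ne_zero hpos.ne'
    rw [hj, Nat.succ_eq_add_one, Nat.add_sub_cancel, pow_succ]
    have : ((-1 : ℚ) ^ j) * (-1) ^ j = 1 := by rw [← mul_pow]; simp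
    linear_combination this
  · rw [hz _ h]; simp [h]

lemma index_joinPart (hρ : StrictMono ρ) (hJ : ∀ x z, J x ≤ z ↔ x ≤ z ∧ v ≤ z) {y : L} :
    index ρ o (ρ y - 1) (fun x => if ¬ v ≤ x ∧ J x = y then 1 else 0) = joinPart ρ o v J y := by
  rw [index, joinPart]
  refine Finset.sum_congr rfl fun x _ => ?_
  by_cases h : ¬ v ≤ x ∧ J x = y
  · have := hρ (lt_of_join_eq hJ h.1 h.2)
    rw [if_pos (by omega), if_pos h, if_pos h, one_smul, Nat.sub_right_comm]
  · simp [h]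

/-- The decomposition `α a + β b + γ d` with `α, β, γ` in the cone. -/
def Decomposes (x : NC) : Prop :=
  ∃ α ∈ cone, ∃ β ∈ cone, ∃ γ ∈ cone, x = α * va + β * vb + γ * vd

lemma joinLocal_mem_cone (hρ : StrictMono ρ) (hE : Eulerian ρ)
    (hJ : ∀ x z, J x ≤ z ↔ x ≤ z ∧ v ≤ z) {y : L} (hy : v ≤ y) (hpos : 0 < ρ y)
    (hdec : Decomposes
      (index ρ o (ρ y - 1) (fun x => if ¬ v ≤ x ∧ x ≤ y then 1 else 0))) :
    joinLocal ρ o v J y ∈ cone := by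
  obtain ⟨α, hα, β, hβ, γ, hγ, h⟩ := hdec
  have h2 := index_dualWeight (o := o) (k := ρ y - 1) hρ
    (fun x => if ¬ v ≤ x ∧ x ≤ y then 1 else 0) fun ξ _ _ => swap_interval hρ hE o ξ
  rw [dualWeight_below hρ hE hJ hy hpos, index_joinPart hρ hJ, h] at h2
  simp only [map_add, map_mul, swap_va, swap_vb, swap_vd, swap_of_mem_cone hα, swap_of_mem_cone hβ,
    swap_of_mem_cone hγ] at h2
  rw [index_below hρ hJ hy] at h
  have h3 : joinBelow ρ o v J y = α - β := by
    rw [← sub_eq_zero]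
    refine mul_va_sub_vb_eq_zero ?_
    rw [h2] at h
    calc _ = (α * vb + β * va + γ * vd + joinBelow ρ o v J y * (va - vb)) -
        (α * vb + β * va + γ * vd) - (α - β) * (va - vb) := by noncomm_ring
      _ = 0 := by rw [h]; noncomm_ring
  have : joinLocal ρ o v J y = β * vc + γ * vd := by
    rw [joinLocal, h2, h3, vc]; noncomm_ring
  rw [this]
  exact add_mem (mul_mem hβ vc_mem_cone) (mul_mem hγ vd_mem_cone)

variable {L : Type*} [Fintype L] [PartialOrder L] {ρ : L → ℕ}

lemma joinLocal_eq_zero {o v : L} {J : L → L} (hJ : ∀ x z, J x ≤ z ↔ x ≤ z ∧ v ≤ z) {y : L}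
    (h : ¬ v ≤ y) : joinLocal ρ o v J y = 0 := by
  have h1 : joinBelow ρ o v J y = 0 := by
    refine Finset.sum_eq_zero fun y' _ => ?_
    split_ifs with h'
    · rw [joinPart_eq_zero hJ fun h'' => h (h''.trans h'.le), zero_mul]
    · rfl
  rw [joinLocal, h1, joinPart_eq_zero hJ h]; simp

/-- The numerical part of the comparison with the Boolean algebra. -/
theorem interval_sub_bool_mem_cone (hρ : StrictMono ρ) (hcov : ∀ a b : L, a ⋖ b → ρ b = ρ a + 1)
    (hE : Eulerian ρ) (hlat : ∀ x y : L, ∃ z, IsLUB {x, y} z)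
    (hdec : ∀ o v y : L, o < v → v ≤ y → ρ o + 2 ≤ ρ y →
      Decomposes (index ρ o (ρ y - 1) (fun x => if ¬ v ≤ x ∧ x ≤ y then 1 else 0)))
    {o z : L} (hoz : o < z) : interval ρ o z - bool (ρ z - ρ o) ∈ cone := by
  induction hk : ρ z - ρ o using Nat.strong_induction_on generalizing o with
  | _ k ih =>
  subst hk
  obtain ⟨v, hov, hvz⟩ := exists_covBy_le_of_lt hoz
  have hv := hcov o v hov
  rcases hvz.eq_or_lt with rfl | hvz'
  · have h1 : interval ρ o v = 1 := by
      rw [interval_eq_right hoz, hv]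
      simp only [add_tsub_cancel_left, tsub_self, pow_zero, add_eq_left]
      refine Finset.sum_eq_zero fun θ _ => ?_
      split_ifs with h
      · rw [interval_eq_zero fun h' => hov.2 h' h]; simp
      · rfl
    rw [h1, hv, Nat.add_sub_cancel_left, bool_one, sub_self]
    exact zero_mem _
  choose j hj using fun x => hlat x v
  have hJ : ∀ x z, j x ≤ z ↔ x ≤ z ∧ v ≤ z := fun x z => by
    rw [isLUB_le_iff (hj x)]; simp [upperBounds]
  have hlt := hρ hvz'
  have hcone : ∀ y, v ≤ y → y < z → interval ρ y z ∈ cone := by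
    intro y hvy hyz
    have h1 := hρ.monotone hvy
    have h2 := hρ hyz
    have h3 := ih (ρ z - ρ y) (by omega) hyz rfl
    have h4 := bool_mem_cone (ρ z - ρ y - 1)
    rw [Nat.sub_add_cancel (by omega)] at h4
    have := add_mem h3 h4
    rwa [sub_add_cancel] at this
  have hloc : ∀ y, y ≠ v → joinLocal ρ o v j y ∈ cone := by
    intro y hy
    by_cases h : v ≤ y
    · have := hρ (lt_of_le_of_ne h (Ne.symm hy))
      exact joinLocal_mem_cone hρ hE hJ h (by omega) (hdec o v y hov.lt h (by omega))
    · rw [joinLocal_eq_zero hJ h]; exact zero_mem _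
  rw [interval_eq_joinLocal hρ hJ hov.lt hvz, ← Finset.add_sum_erase _ _ (Finset.mem_univ v),
    joinLocal_self hρ hJ hov.lt hv, one_mul]
  obtain ⟨m, hm⟩ : ∃ m, ρ z - ρ o = m + 2 := ⟨ρ z - ρ o - 2, by omega⟩
  rw [hm, bool_add_two]
  have h5 : pyr (interval ρ v z) - pyr (bool (m + 1)) ∈ cone := by
    rw [← map_sub, show m + 1 = ρ z - ρ v by omega]
    exact pyr_mem_cone (ih _ (by omega) hvz' rfl)
  have h6 : (∑ y ∈ Finset.univ.erase v, joinLocal ρ o v j y * pyr (interval ρ y z)) ∈ cone := by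
    refine sum_mem fun y hy => ?_
    by_cases h : v ≤ y
    · by_cases h' : y < z
      · exact mul_mem (hloc y (Finset.ne_of_mem_erase hy)) (pyr_mem_cone (hcone y h h'))
      · rw [interval_eq_zero h']; simp
    · rw [joinLocal_eq_zero hJ h]; simp
  have := add_mem (add_mem h5 h6) (hloc z hvz'.ne')
  convert this using 1
  abel

/-- Incidence numbers on a finite ranked poset making every closed interval of positive length
acyclic. -/
structure Incidence {L : Type u} [Fintype L] [PartialOrder L] (ρ : L → ℕ) where
  ε : L → L → ℝ
  supp : ∀ {a b}, ε a b ≠ 0 → a < b ∧ ρ b = ρ a + 1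
  sq : ∀ a b, ∑ τ, ε a τ * ε τ b = 0
  homotopy : ∀ η ζ, η < ζ → ∃ H : L → L → ℝ,
    (∀ a b, H a b ≠ 0 → (η ≤ a ∧ a ≤ ζ) ∧ η ≤ b ∧ b ≤ ζ) ∧
    ∀ a b, η ≤ a → a ≤ ζ → η ≤ b → b ≤ ζ →
      ∑ τ, (ε a τ * H τ b + H a τ * ε τ b) = if a = b then 1 else 0

variable {L : Type u} [Fintype L] [PartialOrder L] {ρ : L → ℕ}

lemma Incidence.eulerian (I : Incidence ρ) : Eulerian ρ := by
  intro η σ h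
  obtain ⟨H, hs, hH⟩ := I.homotopy η σ h
  suffices hR : (∑ ξ, if η ≤ ξ ∧ ξ ≤ σ then (-1 : ℝ) ^ ρ ξ else 0) = 0 by
    have : ((∑ ξ, if η ≤ ξ ∧ ξ ≤ σ then (-1 : ℚ) ^ ρ ξ else 0 : ℚ) : ℝ) = 0 := by
      push_cast [apply_ite]
      simpa using hR
    exact_mod_cast this
  have h1 : ∀ ξ, (if η ≤ ξ ∧ ξ ≤ σ then (-1 : ℝ) ^ ρ ξ else 0) =
      (∑ τ, (-1) ^ ρ ξ * (I.ε ξ τ * H τ ξ)) + ∑ τ, (-1) ^ ρ ξ * (H ξ τ * I.ε τ ξ) := by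
    intro ξ
    rw [← Finset.sum_add_distrib]
    simp only [← mul_add, ← Finset.mul_sum]
    by_cases hξ : η ≤ ξ ∧ ξ ≤ σ
    · rw [hH ξ ξ hξ.1 hξ.2 hξ.1 hξ.2]; simp [hξ]
    · rw [if_neg hξ]
      symm
      refine mul_eq_zero_of_right _ (Finset.sum_eq_zero fun τ _ => ?_)
      have e1 : H τ ξ = 0 := by_contra fun h' => hξ (hs _ _ h').2
      have e2 : H ξ τ = 0 := by_contra fun h' => hξ (hs _ _ h').1
      simp [e1, e2]
  rw [Finset.sum_congr rfl fun ξ _ => h1 ξ, Finset.sum_add_distrib,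
    Finset.sum_comm (f := fun ξ τ => (-1 : ℝ) ^ ρ ξ * (H ξ τ * I.ε τ ξ)),
    ← Finset.sum_add_distrib]
  refine Finset.sum_eq_zero fun ξ _ => ?_
  rw [← Finset.sum_add_distrib]
  refine Finset.sum_eq_zero fun τ _ => ?_
  by_cases h0 : I.ε ξ τ = 0
  · simp [h0]
  · rw [(I.supp h0).2, pow_succ]; ring

/-- A sheaf of finite-dimensional real vector spaces on a poset. The restriction maps are only
constrained between comparable elements. -/
structure Sh (L : Type u) [PartialOrder L] where
  V : L → Type u
  [grp : ∀ σ, AddCommGroup (V σ)]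
  [mod : ∀ σ, Module ℝ (V σ)]
  [fin : ∀ σ, FiniteDimensional ℝ (V σ)]
  r : ∀ σ τ, V σ →ₗ[ℝ] V τ
  r_self : ∀ σ x, r σ σ x = x
  r_comp : ∀ {σ τ υ}, σ ≤ τ → τ ≤ υ → ∀ x, r τ υ (r σ τ x) = r σ υ x

attribute [instance] Sh.grp Sh.mod Sh.fin

/-- Morphisms of sheaves. -/
structure Sh.Hom (A B : Sh L) where
  app : ∀ σ, A.V σ →ₗ[ℝ] B.V σ
  natural : ∀ {σ τ}, σ ≤ τ → ∀ x, app τ (A.r σ τ x) = B.r σ τ (app σ x)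

/-- The dimension function of a sheaf. -/
def Sh.dim (M : Sh L) (σ : L) : ℚ := Module.finrank ℝ (M.V σ)

/-- The cellular differential of a sheaf on the filter of `η`. -/
def Sh.dd (I : Incidence ρ) (M : Sh L) (η : L) (f : ∀ σ, M.V σ) (ζ : L) : M.V ζ :=
  ∑ θ, if η ≤ θ then I.ε θ ζ • M.r θ ζ (f θ) else 0

/-- Exactness of the cellular complex of a sheaf on the filter of `η` at rank `i`. -/
def Sh.Ex (I : Incidence ρ) (M : Sh L) (η : L) (i : ℕ) : Prop :=
  ∀ f : ∀ σ, M.V σ, (∀ ζ, η ≤ ζ → ρ ζ = i + 1 → M.dd I η f ζ = 0) →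
    ∃ g : ∀ σ, M.V σ, ∀ ξ, η ≤ ξ → ρ ξ = i → M.dd I η g ξ = f ξ

/-- The Cohen–Macaulay condition up to rank `m`. -/
def Sh.CM (I : Incidence ρ) (M : Sh L) (m : ℕ) : Prop := ∀ η, ∀ i < m, M.Ex I η i

namespace Sh

variable {I : Incidence ρ} {M A B C : Sh L} {η : L}

lemma CM.mono {m m' : ℕ} (h : M.CM I m) (hm : m' ≤ m) : M.CM I m' :=
  fun η i hi => h η i (hi.trans_le hm)

lemma dd_congr {f g : ∀ σ, M.V σ} {ζ : L}
    (h : ∀ θ, η ≤ θ → ρ ζ = ρ θ + 1 → f θ = g θ) : M.dd I η f ζ = M.dd I η g ζ := by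
  refine Finset.sum_congr rfl fun θ _ => ?_
  by_cases h0 : I.ε θ ζ = 0
  · simp [h0]
  · by_cases h1 : η ≤ θ
    · rw [if_pos h1, if_pos h1, h θ h1 (I.supp h0).2]
    · simp [h1]

lemma dd_sub (f g : ∀ σ, M.V σ) (ζ : L) :
    M.dd I η (fun σ => f σ - g σ) ζ = M.dd I η f ζ - M.dd I η g ζ := by
  simp only [dd, ← Finset.sum_sub_distrib]
  refine Finset.sum_congr rfl fun θ _ => ?_
  split_ifs <;> simp [smul_sub]

lemma dd_dd (f : ∀ σ, M.V σ) (ζ : L) : M.dd I η (M.dd I η f) ζ = 0 := by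
  have h1 : ∀ τ, (if η ≤ τ then I.ε τ ζ • M.r τ ζ (M.dd I η f τ) else 0) =
      ∑ θ, (I.ε θ τ * I.ε τ ζ) • (if η ≤ θ then M.r θ ζ (f θ) else 0) := by
    intro τ
    by_cases h0 : I.ε τ ζ = 0
    · simp [h0]
    have h1 := (I.supp h0).1.le
    by_cases hτ : η ≤ τ
    · rw [if_pos hτ, dd, map_sum, Finset.smul_sum]
      refine Finset.sum_congr rfl fun θ _ => ?_
      by_cases h3 : I.ε θ τ = 0
      · simp [h3]
      split_ifs with h4
      · rw [map_smul, M.r_comp (I.supp h3).1.le h1, smul_smul, mul_comm]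
      · simp
    · rw [if_neg hτ]
      symm
      refine Finset.sum_eq_zero fun θ _ => ?_
      by_cases h3 : I.ε θ τ = 0
      · simp [h3]
      rw [if_neg fun h => hτ (h.trans (I.supp h3).1.le), smul_zero]
  rw [dd, Finset.sum_congr rfl fun τ _ => h1 τ, Finset.sum_comm]
  refine Finset.sum_eq_zero fun θ _ => ?_
  rw [← Finset.sum_smul, I.sq, zero_smul]

lemma Hom.dd (φ : A.Hom B) (f : ∀ σ, A.V σ) (ζ : L) :
    φ.app ζ (A.dd I η f ζ) = B.dd I η (fun σ => φ.app σ (f σ)) ζ := by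
  rw [Sh.dd, Sh.dd, map_sum]
  refine Finset.sum_congr rfl fun θ _ => ?_
  by_cases h0 : I.ε θ ζ = 0
  · simp [h0]
  split_ifs
  · rw [map_smul, φ.natural (I.supp h0).1.le]
  · simp

lemma Ex.coker (φ : A.Hom B) (ψ : B.Hom C) {i : ℕ}
    (hψ : ∀ σ, Function.Surjective (ψ.app σ))
    (hex : ∀ σ x, ψ.app σ x = 0 ↔ ∃ y, φ.app σ y = x)
    (hinj : ∀ σ, ρ σ = i + 2 → Function.Injective (φ.app σ))
    (hB : B.Ex I η i) (hA : A.Ex I η (i + 1)) : C.Ex I η i := by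
  intro f hf
  choose F hF using fun σ => hψ σ (f σ)
  have h1 : ∀ ξ, ∃ y, η ≤ ξ → ρ ξ = i + 1 → φ.app ξ y = B.dd I η F ξ := by
    intro ξ
    by_cases h : η ≤ ξ ∧ ρ ξ = i + 1
    · obtain ⟨y, hy⟩ := (hex ξ (B.dd I η F ξ)).1 (by
        rw [ψ.dd]; simp only [hF]; exact hf ξ h.1 h.2)
      exact ⟨y, fun _ _ => hy⟩
    · exact ⟨0, fun h1 h2 => absurd ⟨h1, h2⟩ h⟩
  choose a ha using h1
  obtain ⟨a', ha'⟩ := hA a fun ζ hζ hr => by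
    apply hinj ζ hr
    rw [φ.dd, map_zero, ← dd_dd F ζ]
    exact dd_congr fun θ hθ hr' => ha θ hθ (by omega)
  obtain ⟨g, hg⟩ := hB (fun σ => F σ - φ.app σ (a' σ)) fun ζ hζ hr => by
    rw [dd_sub, ← φ.dd, ha' ζ hζ hr, ha ζ hζ hr, sub_self]
  refine ⟨fun σ => ψ.app σ (g σ), fun ξ hξ hr => ?_⟩
  rw [← ψ.dd, hg ξ hξ hr, map_sub, hF, (hex ξ _).2 ⟨_, rfl⟩, sub_zero]

lemma Ex.ker (φ : A.Hom B) (ψ : B.Hom C) {i : ℕ}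
    (hψ : ∀ σ, Function.Surjective (ψ.app σ))
    (hex : ∀ σ x, ψ.app σ x = 0 ↔ ∃ y, φ.app σ y = x)
    (hinj : ∀ σ, Function.Injective (φ.app σ))
    (hB : B.Ex I η i) (hC : ∀ j, j + 1 = i → C.Ex I η j) : A.Ex I η i := by
  intro f hf
  obtain ⟨g, hg⟩ := hB (fun σ => φ.app σ (f σ)) fun ζ hζ hr => by rw [← φ.dd, hf ζ hζ hr, map_zero]
  cases i with
  | zero =>
    refine ⟨0, fun ξ hξ hr => ?_⟩
    apply hinj ξ
    rw [← hg ξ hξ hr, φ.dd]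
    refine dd_congr fun θ _ h => by omega
  | succ j =>
    obtain ⟨h, hh⟩ := hC j rfl (fun σ => ψ.app σ (g σ)) fun ζ hζ hr => by
      rw [← ψ.dd, hg ζ hζ hr]; exact (hex ζ _).2 ⟨_, rfl⟩
    choose H hH using fun σ => hψ σ (h σ)
    have h1 : ∀ ξ, ∃ y, η ≤ ξ → ρ ξ = j → φ.app ξ y = g ξ - B.dd I η H ξ := by
      intro ξ
      by_cases h : η ≤ ξ ∧ ρ ξ = j
      · obtain ⟨y, hy⟩ := (hex ξ (g ξ - B.dd I η H ξ)).1 (by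
          rw [map_sub, ψ.dd]; simp only [hH]; rw [hh ξ h.1 h.2, sub_self])
        exact ⟨y, fun _ _ => hy⟩
      · exact ⟨0, fun h1 h2 => absurd ⟨h1, h2⟩ h⟩
    choose a ha using h1
    refine ⟨a, fun ξ hξ hr => hinj ξ ?_⟩
    rw [φ.dd, dd_congr (g := fun σ => g σ - B.dd I η H σ) fun θ hθ hr' => ha θ hθ (by omega),
      dd_sub, dd_dd, sub_zero, hg ξ hξ hr]

/-- The cokernel of a morphism of sheaves. -/
lemma exists_coker (φ : A.Hom B) : ∃ (C : Sh L) (ψ : B.Hom C),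
    (∀ σ, Function.Surjective (ψ.app σ)) ∧ (∀ σ x, ψ.app σ x = 0 ↔ ∃ y, φ.app σ y = x) := by
  have hle : ∀ {σ τ}, σ ≤ τ → LinearMap.range (φ.app σ) ≤
      (LinearMap.range (φ.app τ)).comap (B.r σ τ) := by
    rintro σ τ h _ ⟨y, rfl⟩
    exact ⟨A.r σ τ y, φ.natural h y⟩
  let C : Sh L :=
    { V := fun σ => B.V σ ⧸ LinearMap.range (φ.app σ)
      r := fun σ τ => if h : σ ≤ τ then Submodule.mapQ _ _ (B.r σ τ) (hle h) else 0
      r_self := by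
        intro σ x
        obtain ⟨x, rfl⟩ := Submodule.mkQ_surjective _ x
        simp [B.r_self]
      r_comp := by
        intro σ τ υ h1 h2 x
        obtain ⟨x, rfl⟩ := Submodule.mkQ_surjective _ x
        simp [h1, h2, h1.trans h2, B.r_comp] }
  refine ⟨C, ⟨fun σ => Submodule.mkQ _, fun {σ τ} h x => by simp [C, h]⟩,
    fun σ => Submodule.mkQ_surjective _, fun σ x => ?_⟩
  exact Submodule.Quotient.mk_eq_zero (LinearMap.range (φ.app σ))

lemma dim_coker (φ : A.Hom B) (ψ : B.Hom C) (hψ : ∀ σ, Function.Surjective (ψ.app σ))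
    (hex : ∀ σ x, ψ.app σ x = 0 ↔ ∃ y, φ.app σ y = x) {σ : L}
    (hinj : Function.Injective (φ.app σ)) : C.dim σ = B.dim σ - A.dim σ := by
  have h1 := LinearMap.finrank_range_add_finrank_ker (ψ.app σ)
  have h2 := LinearMap.finrank_range_of_inj hinj
  have h3 : LinearMap.ker (ψ.app σ) = LinearMap.range (φ.app σ) := by
    ext x; simp [hex]
  rw [LinearMap.range_eq_top.2 (hψ σ), finrank_top, h3, h2] at h1
  simp only [dim, ← h1]
  push_cast
  ring

end Sh

namespace Sh

variable {L : Type u} [Fintype L] [PartialOrder L] {ρ : L → ℕ}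

section Cells

variable (W : L → Type u) [∀ σ, AddCommGroup (W σ)] [∀ σ, Module ℝ (W σ)]

/-- Families supported on a set of elements. -/
def suppOn (p : L → Prop) : Submodule ℝ (∀ σ, W σ) where
  carrier := {e | ∀ σ, ¬ p σ → e σ = 0}
  zero_mem' := fun _ _ => rfl
  add_mem' := fun ha hb σ h => by simp [ha σ h, hb σ h]
  smul_mem' := fun c a ha σ h => by simp [ha σ h]

lemma mem_suppOn {p : L → Prop} {e : ∀ σ, W σ} : e ∈ suppOn W p ↔ ∀ σ, ¬ p σ → e σ = 0 := Iff.rfl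

/-- Truncation of a family to a filter. -/
def trunc (τ : L) : (∀ σ, W σ) →ₗ[ℝ] (∀ σ, W σ) where
  toFun e σ := if τ ≤ σ then e σ else 0
  map_add' x y := by funext σ; simp only [Pi.add_apply]; split_ifs <;> simp
  map_smul' c x := by funext σ; simp only [Pi.smul_apply]; split_ifs <;> simp

lemma trunc_apply (τ σ : L) (e : ∀ σ, W σ) : trunc W τ e σ = if τ ≤ σ then e σ else 0 := rfl

lemma trunc_mem (j : ℕ) (σ τ : L) (e : ∀ σ, W σ) (h : e ∈ suppOn W fun υ => σ ≤ υ ∧ ρ υ = j) :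
    trunc W τ e ∈ suppOn W fun υ => τ ≤ υ ∧ ρ υ = j := by
  intro υ hυ
  rw [trunc_apply]
  split_ifs with h1
  · exact h υ fun h2 => hυ ⟨h1, h2.2⟩
  · rfl

variable [∀ σ, FiniteDimensional ℝ (W σ)]

lemma finrank_suppOn (p : L → Prop) :
    Module.finrank ℝ (suppOn W p) = ∑ σ, if p σ then Module.finrank ℝ (W σ) else 0 := by
  let e : suppOn W p ≃ₗ[ℝ] ∀ σ : {σ // p σ}, W σ.1 :=
    { toFun := fun x σ => x.1 σ.1
      map_add' := fun x y => rfl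
      map_smul' := fun c x => rfl
      invFun := fun g => ⟨fun σ => if h : p σ then g ⟨σ, h⟩ else 0, fun σ h => dif_neg h⟩
      left_inv := fun x => by
        ext σ
        by_cases h : p σ
        · simp [h]
        · simp [h, x.2 σ h]
      right_inv := fun g => by
        funext σ
        simp [σ.2] }
  rw [e.finrank_eq, Module.finrank_pi_fintype, ← Finset.sum_filter]
  exact (Finset.sum_subtype (Finset.univ.filter p) (by simp)
    fun σ => Module.finrank ℝ (W σ)).symm

/-- The sheaf of cochains of rank `j`. -/
def cells (ρ : L → ℕ) (j : ℕ) : Sh L where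
  V η := suppOn W fun υ => η ≤ υ ∧ ρ υ = j
  r σ τ := (trunc W τ).restrict fun e h => trunc_mem W j σ τ e h
  r_self σ x := by
    ext υ
    change trunc W σ x.1 υ = x.1 υ
    rw [trunc_apply]
    split_ifs with h
    · rfl
    · rw [x.2 υ fun h' => h h'.1]
  r_comp {σ τ υ} h1 h2 x := by
    ext ξ
    change trunc W υ (trunc W τ x.1) ξ = trunc W υ x.1 ξ
    simp only [trunc_apply]
    by_cases h : υ ≤ ξ
    · simp [h, h2.trans h]
    · simp [h]

variable {W}

/-- The components of an element of the sheaf of cochains. -/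
def coord {j : ℕ} {η : L} (σ : L) : (cells W ρ j).V η →ₗ[ℝ] W σ :=
  (LinearMap.proj σ).comp (suppOn W fun υ => η ≤ υ ∧ ρ υ = j).subtype

/-- An element of the sheaf of cochains given by its components. -/
def ofCoord {j : ℕ} {η : L} (e : ∀ σ, W σ) (h : ∀ σ, ¬ (η ≤ σ ∧ ρ σ = j) → e σ = 0) :
    (cells W ρ j).V η := (⟨e, h⟩ : suppOn W fun υ => η ≤ υ ∧ ρ υ = j)

lemma coord_ofCoord {j : ℕ} {η : L} (e : ∀ σ, W σ)
    (h : ∀ σ, ¬ (η ≤ σ ∧ ρ σ = j) → e σ = 0) (σ : L) : coord σ (ofCoord e h) = e σ := rfl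

lemma coord_ext {j : ℕ} {η : L} {x y : (cells W ρ j).V η} (h : ∀ σ, coord σ x = coord σ y) :
    x = y := Subtype.ext (funext h)

lemma coord_eq_zero {j : ℕ} {η : L} (x : (cells W ρ j).V η) {σ : L} (h : ¬ (η ≤ σ ∧ ρ σ = j)) :
    coord σ x = 0 := x.2 σ h

lemma coord_r {j : ℕ} {σ τ : L} (x : (cells W ρ j).V σ) (υ : L) :
    coord υ ((cells W ρ j).r σ τ x) = if τ ≤ υ then coord υ x else 0 := rfl

lemma dim_cells (j : ℕ) (η : L) :
    (cells W ρ j).dim η = ∑ σ, if η ≤ σ ∧ ρ σ = j then (Module.finrank ℝ (W σ) : ℚ) else 0 := by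
  rw [dim]
  change ((Module.finrank ℝ (suppOn W fun υ => η ≤ υ ∧ ρ υ = j) : ℕ) : ℚ) = _
  rw [finrank_suppOn]
  push_cast
  rfl

lemma coord_dd {I : Incidence ρ} {j : ℕ} {η : L} (f : ∀ σ, (cells W ρ j).V σ) (ζ σ : L) :
    coord σ ((cells W ρ j).dd I η f ζ) =
      if ζ ≤ σ then ∑ θ, if η ≤ θ then I.ε θ ζ • coord σ (f θ) else 0 else 0 := by
  have h1 : coord σ ((cells W ρ j).dd I η f ζ) =
      ∑ θ, if η ≤ θ then I.ε θ ζ • (if ζ ≤ σ then coord σ (f θ) else 0) else 0 := by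
    rw [dd, map_sum]
    refine Finset.sum_congr rfl fun θ _ => ?_
    split_ifs with h1 h2
    · rw [map_smul, coord_r, if_pos h2]
    · rw [map_smul, coord_r, if_neg h2]
    · rw [map_zero]
  rw [h1]
  split_ifs <;> simp

variable (W) in
lemma cells_CM (I : Incidence ρ) (j : ℕ) : (cells W ρ j).CM I j := by
  intro η i hij f hf
  choose! H hs hH using fun σ => I.homotopy η σ
  let F : ∀ σ, L → W σ := fun σ τ => if η ≤ τ ∧ ρ τ = i then coord σ (f τ) else 0
  have hg : ∀ ξ σ, ¬ (ξ ≤ σ ∧ ρ σ = j) →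
      (if η < σ ∧ ρ σ = j then ∑ τ, H σ τ ξ • F σ τ else 0) = 0 := by
    intro ξ σ hσ
    split_ifs with h
    · refine Finset.sum_eq_zero fun τ _ => ?_
      have : H σ τ ξ = 0 := by_contra fun h' => hσ ⟨(hs σ h.1 _ _ h').2.2, h.2⟩
      rw [this, zero_smul]
    · rfl
  refine ⟨fun ξ => ofCoord _ (hg ξ), fun ξ hξ hr => coord_ext fun σ => ?_⟩
  rw [coord_dd]
  simp only [coord_ofCoord]
  by_cases hσ : ξ ≤ σ ∧ ρ σ = j
  swap
  · rw [coord_eq_zero _ hσ]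
    by_cases h : ξ ≤ σ
    · have h' : ¬ (η < σ ∧ ρ σ = j) := fun h' => hσ ⟨h, h'.2⟩
      simp [h, h']
    · simp [h]
  have hησ : η < σ := lt_of_le_of_ne (hξ.trans hσ.1) fun e => by
    have : ξ = σ := le_antisymm hσ.1 (e ▸ hξ)
    have h2 := hσ.2
    rw [← this] at h2
    omega
  simp only [hσ, hησ, and_self, if_true]
  have h1 : ∀ θ, (if η ≤ θ then I.ε θ ξ • ∑ τ, H σ τ θ • F σ τ else 0) =
      ∑ τ, (H σ τ θ * I.ε θ ξ) • F σ τ := by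
    intro θ
    split_ifs with h
    · rw [Finset.smul_sum]
      exact Finset.sum_congr rfl fun τ _ => by rw [smul_smul, mul_comm]
    · symm
      refine Finset.sum_eq_zero fun τ _ => ?_
      have : H σ τ θ = 0 := by_contra fun h' => h (hs σ hησ _ _ h').2.1
      rw [this, zero_mul, zero_smul]
  have h2 : ∀ τ, (∑ θ, (H σ τ θ * I.ε θ ξ) • F σ τ) =
      (if τ = ξ then F σ τ else 0) - ∑ θ, (I.ε τ θ * H σ θ ξ) • F σ τ := by
    intro τ
    by_cases hτ : F σ τ = 0
    · simp [hτ]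
    have h3 : η ≤ τ ∧ ρ τ = i := by_contra fun h => hτ (if_neg h)
    have h4 : τ ≤ σ := by_contra fun h => hτ (by
      simp only [F, if_pos h3]; exact coord_eq_zero _ fun h' => h h'.1)
    have h5 := hH σ hησ τ ξ h3.1 h4 hξ hσ.1
    rw [eq_sub_iff_add_eq, ← Finset.sum_smul, ← Finset.sum_smul, ← add_smul,
      ← Finset.sum_add_distrib]
    rw [Finset.sum_congr rfl fun x _ => add_comm _ _, h5]
    split_ifs <;> simp
  rw [Finset.sum_congr rfl fun θ _ => h1 θ, Finset.sum_comm, Finset.sum_congr rfl fun τ _ => h2 τ,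
    Finset.sum_sub_distrib, Finset.sum_comm]
  simp only [Finset.sum_ite_eq', Finset.mem_univ, if_true]
  have h3 : F σ ξ = coord σ (f ξ) := if_pos ⟨hξ, hr⟩
  rw [h3, sub_eq_self]
  refine Finset.sum_eq_zero fun θ _ => ?_
  by_cases hθ : H σ θ ξ = 0
  · simp [hθ]
  have h4 := (hs σ hησ _ _ hθ).1
  suffices h5 : ∑ τ, I.ε τ θ • F σ τ = 0 by
    simp only [mul_comm (I.ε _ θ), mul_smul, ← Finset.smul_sum, h5, smul_zero]
  by_cases hrθ : ρ θ = i + 1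
  · have h6 := congrArg (coord σ) (hf θ h4.1 hrθ)
    rw [coord_dd, if_pos h4.2, map_zero] at h6
    rw [← h6]
    refine Finset.sum_congr rfl fun τ _ => ?_
    by_cases h7 : I.ε τ θ = 0
    · simp [h7]
    · have := (I.supp h7).2
      have h8 : ρ τ = i := by omega
      simp only [F, h8, and_true]
      split_ifs <;> simp
  · refine Finset.sum_eq_zero fun τ _ => ?_
    by_cases h7 : I.ε τ θ = 0
    · simp [h7]
    · have := (I.supp h7).2
      have h8 : ¬ ρ τ = i := by omega
      simp [F, h8]

end Cells

section ToCells

variable {I : Incidence ρ} {M : Sh L}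

/-- The evaluation of a section on the elements of rank `m`. -/
def toCells (ρ : L → ℕ) (M : Sh L) (m : ℕ) : M.Hom (cells M.V ρ m) where
  app η :=
    { toFun := fun x => ofCoord (fun σ => if η ≤ σ ∧ ρ σ = m then M.r η σ x else 0)
        fun σ h => if_neg h
      map_add' := fun x y => coord_ext fun σ => by
        simp only [map_add, coord_ofCoord]
        split_ifs <;> simp
      map_smul' := fun c x => coord_ext fun σ => by
        simp only [map_smul, coord_ofCoord, RingHom.id_apply]
        split_ifs <;> simp }
  natural {σ τ} h x := coord_ext fun υ => by
    rw [coord_r]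
    simp only [LinearMap.coe_mk, AddHom.coe_mk, coord_ofCoord]
    by_cases h1 : τ ≤ υ
    · simp [h1, h.trans h1, M.r_comp h h1]
    · simp [h1]

lemma coord_toCells {m : ℕ} {η σ : L} (x : M.V η) :
    coord σ ((toCells ρ M m).app η x) = if η ≤ σ ∧ ρ σ = m then M.r η σ x else 0 := rfl

lemma eq_zero_of_Ex {η : L} (h : M.Ex I η (ρ η)) (x : M.V η)
    (hx : ∀ ζ, I.ε η ζ ≠ 0 → M.r η ζ x = 0) : x = 0 := by
  obtain ⟨g, hg⟩ := h (Pi.single η x) fun ζ _ _ => by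
    refine Finset.sum_eq_zero fun θ _ => ?_
    by_cases e : θ = η
    · subst e
      by_cases h0 : I.ε θ ζ = 0
      · simp [h0]
      · simp [hx ζ h0]
    · simp [e]
  have h1 := hg η le_rfl rfl
  rw [Pi.single_eq_same] at h1
  rw [← h1]
  refine Finset.sum_eq_zero fun θ _ => ?_
  split_ifs with h2
  · have : I.ε θ η = 0 := by_contra fun h3 => not_le_of_gt (I.supp h3).1 h2
    rw [this, zero_smul]
  · rfl

lemma eq_zero_of_CM {m : ℕ} (h : M.CM I m) {η : L} (hη : ρ η ≤ m) (x : M.V η)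
    (hx : ∀ σ, η ≤ σ → ρ σ = m → M.r η σ x = 0) : x = 0 := by
  obtain ⟨k, hk⟩ := Nat.exists_eq_add_of_le hη
  induction k generalizing η with
  | zero => rw [← M.r_self η x]; exact hx η le_rfl hk.symm
  | succ k ih =>
    refine eq_zero_of_Ex (h η (ρ η) (by omega)) x fun ζ hζ => ?_
    obtain ⟨h1, h2⟩ := I.supp hζ
    refine ih (by omega) _ (fun σ hσ hr => ?_) (by omega)
    rw [M.r_comp h1.le hσ, hx σ (h1.le.trans hσ) hr]

lemma toCells_injective {m : ℕ} (h : M.CM I m) {η : L} (hη : ρ η ≤ m) :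
    Function.Injective ((toCells ρ M m).app η) := by
  rw [injective_iff_map_eq_zero]
  intro x hx
  refine eq_zero_of_CM h hη x fun σ h1 h2 => ?_
  have h3 := congrArg (coord σ) hx
  rwa [coord_toCells, if_pos ⟨h1, h2⟩, map_zero] at h3

/-- The cokernel of the evaluation at rank `m + 1`. -/
lemma exists_coker_toCells {m : ℕ} (h : M.CM I (m + 1)) : ∃ N : Sh L, N.CM I m ∧
    ∀ η, ρ η ≤ m + 1 → N.dim η = (cells M.V ρ (m + 1)).dim η - M.dim η := by
  obtain ⟨N, ψ, hψ, hex⟩ := exists_coker (toCells ρ M (m + 1))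
  refine ⟨N, fun η i hi => ?_, fun η hη => dim_coker _ ψ hψ hex (toCells_injective h hη)⟩
  exact Ex.coker _ ψ hψ hex (fun σ hσ => toCells_injective h (by omega))
    (cells_CM M.V I (m + 1) η i (by omega)) (h η (i + 1) (by omega))

end ToCells

end Sh

namespace Sh

variable {L : Type u} [Fintype L] [PartialOrder L] {ρ : L → ℕ} (I : Incidence ρ) (M : Sh L)

/-- The fibrewise dual of a sheaf. -/
abbrev Du (σ : L) : Type u := Module.Dual ℝ (M.V σ)

/-- The differential on families of functionals. -/
def codiff : (∀ σ, M.Du σ) →ₗ[ℝ] (∀ σ, M.Du σ) where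
  toFun e ξ := ∑ τ, I.ε ξ τ • (e τ).comp (M.r ξ τ)
  map_add' x y := by
    funext ξ
    simp only [Pi.add_apply, LinearMap.add_comp, smul_add, Finset.sum_add_distrib]
  map_smul' c x := by
    funext ξ
    simp only [Pi.smul_apply, LinearMap.smul_comp, Finset.smul_sum, RingHom.id_apply]
    exact Finset.sum_congr rfl fun τ _ => smul_comm _ _ _

variable {M}

lemma codiff_apply (e : ∀ σ, M.Du σ) (ξ : L) (x : M.V ξ) :
    codiff I M e ξ x = ∑ τ, I.ε ξ τ * e τ (M.r ξ τ x) := by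
  simp [codiff]

lemma codiff_eq_zero {e : ∀ σ, M.Du σ} {ξ : L} (h : ∀ τ, ξ ≤ τ → ρ τ = ρ ξ + 1 → e τ = 0) :
    codiff I M e ξ = 0 := by
  ext x
  rw [codiff_apply]
  refine Finset.sum_eq_zero fun τ _ => ?_
  by_cases h0 : I.ε ξ τ = 0
  · simp [h0]
  · rw [h τ (I.supp h0).1.le (I.supp h0).2]; simp

lemma codiff_trunc {e : ∀ σ, M.Du σ} {ξ η : L} (h : η ≤ ξ) :
    codiff I M (trunc M.Du η e) ξ = codiff I M e ξ := by
  rw [← sub_eq_zero, ← Pi.sub_apply, ← map_sub]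
  refine codiff_eq_zero I fun τ hτ _ => ?_
  rw [Pi.sub_apply, trunc_apply, if_pos (h.trans hτ), sub_self]

lemma codiff_codiff (e : ∀ σ, M.Du σ) : codiff I M (codiff I M e) = 0 := by
  funext ξ
  ext x
  rw [codiff_apply]
  have h1 : ∀ τ, I.ε ξ τ * codiff I M e τ (M.r ξ τ x) =
      ∑ υ, I.ε ξ τ * I.ε τ υ * e υ (M.r ξ υ x) := by
    intro τ
    by_cases h0 : I.ε ξ τ = 0
    · simp [h0]
    rw [codiff_apply, Finset.mul_sum]
    refine Finset.sum_congr rfl fun υ _ => ?_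
    by_cases h2 : I.ε τ υ = 0
    · simp [h2]
    rw [M.r_comp (I.supp h0).1.le (I.supp h2).1.le, mul_assoc]
  rw [Finset.sum_congr rfl fun τ _ => h1 τ, Finset.sum_comm]
  refine Finset.sum_eq_zero fun υ _ => ?_
  rw [← Finset.sum_mul, I.sq, zero_mul]

variable (M)

/-- The subspace of cycles among the families of functionals of rank `j` above `η`. -/
def dualSub (j : ℕ) (η : L) : Submodule ℝ (∀ σ, M.Du σ) :=
  (suppOn M.Du fun υ => η ≤ υ ∧ ρ υ = j) ⊓
    (suppOn M.Du fun υ => ¬ η ≤ υ).comap (codiff I M)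

lemma mem_dualSub {j : ℕ} {η : L} {e : ∀ σ, M.Du σ} : e ∈ dualSub I M j η ↔
    (∀ σ, ¬ (η ≤ σ ∧ ρ σ = j) → e σ = 0) ∧ ∀ σ, η ≤ σ → codiff I M e σ = 0 := by
  rw [dualSub, Submodule.mem_inf, Submodule.mem_comap, mem_suppOn, mem_suppOn]
  simp

lemma trunc_mem_dualSub {j : ℕ} {η τ : L} {e : ∀ σ, M.Du σ} (hτ : η ≤ τ)
    (h : e ∈ dualSub I M j η) : trunc M.Du τ e ∈ dualSub I M j τ := by
  rw [mem_dualSub] at h ⊢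
  refine ⟨trunc_mem M.Du j η τ e h.1, fun σ hσ => ?_⟩
  rw [codiff_trunc I hσ, h.2 σ (hτ.trans hσ)]

/-- The dual sheaf at rank `j`. -/
def dualSh (j : ℕ) : Sh L where
  V η := dualSub I M j η
  r σ τ := if h : σ ≤ τ then (trunc M.Du τ).restrict fun _ => trunc_mem_dualSub I M h else 0
  r_self σ x := by
    rw [dif_pos le_rfl]
    ext1
    funext υ
    change trunc M.Du σ x.1 υ = x.1 υ
    rw [trunc_apply]
    split_ifs with h
    · rfl
    · rw [((mem_dualSub I M).1 x.2).1 υ fun h' => h h'.1]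
  r_comp {σ τ υ} h1 h2 x := by
    rw [dif_pos h1, dif_pos h2, dif_pos (h1.trans h2)]
    ext1
    funext ξ
    change trunc M.Du υ (trunc M.Du τ x.1) ξ = trunc M.Du υ x.1 ξ
    simp only [trunc_apply]
    by_cases h : υ ≤ ξ
    · simp [h, h2.trans h]
    · simp [h]

variable {M} in
/-- The family of functionals underlying a section of the dual sheaf. -/
def dualVal {j : ℕ} {η : L} (x : (dualSh I M j).V η) : ∀ σ, M.Du σ := Subtype.val x

variable {M} in
lemma dualVal_ext {j : ℕ} {η : L} {x y : (dualSh I M j).V η} (h : dualVal I x = dualVal I y) :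
    x = y := Subtype.ext h

/-- The inclusion of the dual sheaf into cochains. -/
def dualIncl (j : ℕ) : (dualSh I M j).Hom (cells M.Du ρ j) where
  app η := Submodule.inclusion inf_le_left
  natural {σ τ} h x := by
    simp only [dualSh, dif_pos h]
    rfl

/-- The map from cochains of functionals to the dual sheaf one rank below. -/
def dualProj (j : ℕ) : (cells M.Du ρ (j + 1)).Hom (dualSh I M j) where
  app η := LinearMap.codRestrict (dualSub I M j η)
    ((trunc M.Du η).comp ((codiff I M).comp (Submodule.subtype _))) fun e => by
      rw [mem_dualSub]
      refine ⟨fun σ hσ => ?_, fun σ hσ => ?_⟩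
      · simp only [LinearMap.comp_apply, trunc_apply]
        split_ifs with h
        · refine codiff_eq_zero I fun τ h1 h2 => e.2 τ fun h3 => hσ ⟨h, by omega⟩
        · rfl
      · change codiff I M (trunc M.Du η (codiff I M fun τ => coord τ e)) σ = 0
        rw [codiff_trunc I hσ, codiff_codiff]
        rfl
  natural {σ τ} h x := by
    simp only [dualSh, dif_pos h]
    ext1
    funext ξ
    change trunc M.Du τ (codiff I M (trunc M.Du τ x.1)) ξ =
      trunc M.Du τ (trunc M.Du σ (codiff I M x.1)) ξ
    simp only [trunc_apply]
    by_cases h1 : τ ≤ ξ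
    · simp [h1, h.trans h1, codiff_trunc]
    · simp [h1]

lemma dualProj_app {j : ℕ} {η : L} (e : (cells M.Du ρ (j + 1)).V η) :
    dualVal I ((dualProj I M j).app η e) =
      trunc M.Du η (codiff I M fun σ => coord σ e) := rfl

lemma dualProj_eq_zero {j : ℕ} {η : L} (e : (cells M.Du ρ (j + 1)).V η) :
    (dualProj I M j).app η e = 0 ↔ ∃ y, (dualIncl I M (j + 1)).app η y = e := by
  have h1 : (dualProj I M j).app η e = 0 ↔
      ∀ σ, η ≤ σ → codiff I M (fun σ => coord σ e) σ = 0 := by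
    have h2 : (dualProj I M j).app η e = 0 ↔ dualVal I ((dualProj I M j).app η e) = 0 :=
      ⟨fun h => by rw [h]; rfl, fun h => dualVal_ext I h⟩
    rw [h2, dualProj_app, funext_iff]
    simp only [trunc_apply, Pi.zero_apply]
    refine forall_congr' fun σ => ?_
    by_cases h : η ≤ σ <;> simp [h]
  rw [h1]
  constructor
  · intro h
    exact ⟨⟨e.1, (mem_dualSub I M).2 ⟨e.2, h⟩⟩, rfl⟩
  · rintro ⟨y, rfl⟩
    exact ((mem_dualSub I M).1 y.2).2

lemma dualProj_surjective {j : ℕ} {η : L} (h : M.Ex I η j) :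
    Function.Surjective ((dualProj I M j).app η) := by
  rintro ⟨φ, hφ⟩
  rw [mem_dualSub] at hφ
  let d : (∀ σ, M.V σ) →ₗ[ℝ] (∀ σ, M.V σ) :=
    { toFun := fun f ζ => if η ≤ ζ ∧ ρ ζ = j + 1 then M.dd I η f ζ else 0
      map_add' := fun f g => by
        funext ζ
        simp only [Pi.add_apply]
        split_ifs
        · simp only [dd, ← Finset.sum_add_distrib]
          refine Finset.sum_congr rfl fun θ _ => ?_
          split_ifs <;> simp
        · simp
      map_smul' := fun c g => by
        funext ζ
        simp only [Pi.smul_apply, RingHom.id_apply]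
        split_ifs
        · simp only [dd, Finset.smul_sum]
          refine Finset.sum_congr rfl fun θ _ => ?_
          split_ifs
          · rw [Pi.smul_apply, map_smul, smul_comm]
          · simp
        · simp }
  let Φ : Module.Dual ℝ (∀ σ, M.V σ) := ∑ τ, (φ τ).comp (LinearMap.proj τ)
  have hΦ : ∀ f, Φ f = ∑ τ, φ τ (f τ) := fun f => by simp [Φ]
  have hmem : Φ ∈ LinearMap.range d.dualMap := by
    rw [LinearMap.range_dualMap_eq_dualAnnihilator_ker, Submodule.mem_dualAnnihilator]
    intro f hf
    obtain ⟨g, hg⟩ := h f fun ζ h1 h2 => by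
      have := congrFun (LinearMap.mem_ker.1 hf) ζ
      simpa [d, h1, h2] using this
    rw [hΦ]
    have h1 : ∀ τ, φ τ (f τ) = ∑ θ, if η ≤ θ then I.ε θ τ * φ τ (M.r θ τ (g θ)) else 0 := by
      intro τ
      by_cases h2 : η ≤ τ ∧ ρ τ = j
      · rw [← hg τ h2.1 h2.2, dd, map_sum]
        refine Finset.sum_congr rfl fun θ _ => ?_
        split_ifs <;> simp
      · rw [hφ.1 τ h2]; simp
    rw [Finset.sum_congr rfl fun τ _ => h1 τ, Finset.sum_comm]
    refine Finset.sum_eq_zero fun θ _ => ?_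
    by_cases h3 : η ≤ θ
    · simp only [h3, if_true]
      rw [← codiff_apply, hφ.2 θ h3]; rfl
    · simp [h3]
  obtain ⟨Ψ, hΨ⟩ := hmem
  have hΨ' : ∀ f, Ψ (d f) = Φ f := fun f => by rw [← hΨ]; rfl
  let e : (cells M.Du ρ (j + 1)).V η := ofCoord
    (fun ζ => if η ≤ ζ ∧ ρ ζ = j + 1 then Ψ.comp (LinearMap.single ℝ M.V ζ) else 0)
    fun σ h => if_neg h
  refine ⟨e, dualVal_ext I ?_⟩
  rw [dualProj_app]
  change _ = φ
  funext ξ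
  rw [trunc_apply]
  by_cases hξ : η ≤ ξ ∧ ρ ξ = j
  swap
  · rw [hφ.1 ξ hξ]
    split_ifs with h1
    · refine codiff_eq_zero I fun τ h2 h3 => ?_
      exact if_neg fun h4 => hξ ⟨h1, by omega⟩
    · rfl
  rw [if_pos hξ.1]
  ext x
  have h1 : φ ξ x = Ψ (d (Pi.single ξ x)) := by
    rw [hΨ', hΦ, Finset.sum_eq_single ξ]
    · simp
    · intro b _ hb; simp [Pi.single_eq_of_ne hb]
    · simp
  have h2 : d (Pi.single ξ x) = ∑ τ, I.ε ξ τ • Pi.single τ (M.r ξ τ x) := by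
    funext ζ
    rw [Finset.sum_apply, Finset.sum_eq_single ζ]
    · simp only [d, LinearMap.coe_mk, AddHom.coe_mk, Pi.smul_apply, Pi.single_eq_same]
      have h3 : M.dd I η (Pi.single ξ x) ζ = I.ε ξ ζ • M.r ξ ζ x := by
        rw [dd, Finset.sum_eq_single ξ]
        · simp [hξ.1]
        · intro b _ hb; simp [Pi.single_eq_of_ne hb]
        · simp
      rw [h3]
      by_cases h0 : I.ε ξ ζ = 0
      · simp [h0]
      · rw [if_pos ⟨hξ.1.trans (I.supp h0).1.le, by rw [(I.supp h0).2, hξ.2]⟩]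
    · intro b _ hb; simp [Pi.single_eq_of_ne hb.symm]
    · simp
  rw [h1, h2, codiff_apply, map_sum]
  refine Finset.sum_congr rfl fun τ _ => ?_
  by_cases h0 : I.ε ξ τ = 0
  · simp [h0]
  have h3 : η ≤ τ ∧ ρ τ = j + 1 := ⟨hξ.1.trans (I.supp h0).1.le, by rw [(I.supp h0).2, hξ.2]⟩
  rw [map_smul, smul_eq_mul, coord_ofCoord, if_pos h3]
  rfl

lemma dualSh_CM {m : ℕ} (h : M.CM I m) : ∀ {j : ℕ}, j ≤ m → (dualSh I M j).CM I j
  | 0, _ => fun _ _ hi => absurd hi (Nat.not_lt_zero _)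
  | j + 1, hj => fun η i hi =>
    Ex.ker (dualIncl I M (j + 1)) (dualProj I M j)
      (fun σ => dualProj_surjective I M (h σ j (by omega)))
      (fun _ => dualProj_eq_zero I M)
      (fun _ => Submodule.inclusion_injective inf_le_left)
      (cells_CM M.Du I (j + 1) η i hi)
      fun i' hi' => dualSh_CM h (j := j) (by omega) η i' (by omega)

lemma dim_dualSh {m : ℕ} (h : M.CM I m) : ∀ {j : ℕ}, j ≤ m → ∀ η,
    (dualSh I M j).dim η = dualWeight ρ j M.dim η
  | 0, _, η => by
    have h1 : dualSub I M 0 η = suppOn M.Du fun υ => η ≤ υ ∧ ρ υ = 0 := by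
      refine le_antisymm inf_le_left fun e he => (mem_dualSub I M).2 ⟨he, fun σ hσ => ?_⟩
      exact codiff_eq_zero I fun τ _ h2 => he τ fun h3 => by omega
    rw [dim]
    change ((Module.finrank ℝ (dualSub I M 0 η) : ℕ) : ℚ) = _
    rw [h1, finrank_suppOn, dualWeight]
    push_cast
    refine Finset.sum_congr rfl fun σ _ => ?_
    by_cases h2 : η ≤ σ ∧ ρ σ = 0
    · simp [h2, dim, Subspace.dual_finrank_eq]
    · have : ¬ (η ≤ σ ∧ ρ σ ≤ 0) := fun h => h2 ⟨h.1, by omega⟩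
      simp only [if_neg h2, if_neg this]
  | j + 1, hj, η => by
    have h1 := dim_coker (dualIncl I M (j + 1)) (dualProj I M j)
      (fun σ => dualProj_surjective I M (h σ j (by omega)))
      (fun _ => dualProj_eq_zero I M) (σ := η) (Submodule.inclusion_injective inf_le_left)
    rw [dim_dualSh h (by omega), dim_cells, eq_sub_iff_add_eq, add_comm,
      ← eq_sub_iff_add_eq] at h1
    rw [h1, dualWeight, dualWeight, ← Finset.sum_sub_distrib]
    refine Finset.sum_congr rfl fun σ _ => ?_
    rw [Subspace.dual_finrank_eq]
    by_cases h2 : η ≤ σ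
    · rcases lt_trichotomy (ρ σ) (j + 1) with h3 | h3 | h3
      · have h4 : ρ σ ≤ j := by omega
        have h5 : j + 1 - ρ σ = (j - ρ σ) + 1 := by omega
        simp only [h2, h3.ne, h4, h3.le, and_true, if_true, and_false, if_false, h5, pow_succ]
        ring
      · simp [h2, h3, dim]
      · have h4 : ¬ ρ σ ≤ j := by omega
        have h5 : ¬ ρ σ ≤ j + 1 := by omega
        simp [h2, h3.ne', h4, h5]
    · simp [h2]

end Sh

lemma exists_polynomial_injective {L V W : Type*} [Fintype L] [AddCommGroup V] [Module ℝ V]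
    [FiniteDimensional ℝ V] [AddCommGroup W] [Module ℝ W] [FiniteDimensional ℝ W]
    (hVW : Module.finrank ℝ W = Module.finrank ℝ V) (f : L → V →ₗ[ℝ] W) (t₀ : L → ℝ)
    (h₀ : Function.Injective (∑ σ, t₀ σ • f σ : V →ₗ[ℝ] W)) :
    ∃ p : MvPolynomial L ℝ, p ≠ 0 ∧ ∀ t, MvPolynomial.eval t p ≠ 0 →
      Function.Injective (∑ σ, t σ • f σ : V →ₗ[ℝ] W) := by
  let e : W ≃ₗ[ℝ] V := LinearEquiv.ofFinrankEq _ _ hVW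
  let b := Module.finBasis ℝ V
  let g : (L → ℝ) → V →ₗ[ℝ] V := fun t => e.toLinearMap.comp (∑ σ, t σ • f σ)
  have hg : ∀ t, Function.Injective (∑ σ, t σ • f σ : V →ₗ[ℝ] W) ↔ LinearMap.det (g t) ≠ 0 := by
    intro t
    rw [← isUnit_iff_ne_zero, ← LinearMap.isUnit_iff_isUnit_det, LinearMap.isUnit_iff_ker_eq_bot,
      LinearMap.ker_eq_bot]
    simp only [g, LinearMap.coe_comp, LinearEquiv.coe_coe]
    exact (e.injective.of_comp_iff _).symm
  let A : Matrix _ _ (MvPolynomial L ℝ) := ∑ σ, (MvPolynomial.X σ : MvPolynomial L ℝ) •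
    (LinearMap.toMatrix b b (e.toLinearMap.comp (f σ))).map MvPolynomial.C
  have hA : ∀ t, MvPolynomial.eval t A.det = LinearMap.det (g t) := by
    intro t
    rw [RingHom.map_det, ← LinearMap.det_toMatrix b]
    congr 1
    ext i j
    simp [A, g, Matrix.sum_apply, LinearMap.toMatrix_apply]
  refine ⟨A.det, fun h => ?_, fun t ht => (hg t).2 (by rwa [← hA])⟩
  have := (hg t₀).1 h₀
  rw [← hA, h, map_zero] at this
  exact this rfl

lemma exists_posDef (V : Type*) [AddCommGroup V] [Module ℝ V] [FiniteDimensional ℝ V] :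
    ∃ G : V →ₗ[ℝ] Module.Dual ℝ V, ∀ x, 0 ≤ G x x ∧ (G x x = 0 → x = 0) := by
  let b := Module.finBasis ℝ V
  refine ⟨∑ i, (b.coord i).smulRight (b.coord i), fun x => ?_⟩
  have h : (∑ i, (b.coord i).smulRight (b.coord i) : V →ₗ[ℝ] Module.Dual ℝ V) x x =
      ∑ i, b.repr x i * b.repr x i := by simp
  rw [h]
  refine ⟨Finset.sum_nonneg fun i _ => mul_self_nonneg _, fun h0 => ?_⟩
  rw [Finset.sum_eq_zero_iff_of_nonneg fun i _ => mul_self_nonneg _] at h0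
  exact b.ext_elem fun i => by simpa using h0 i (Finset.mem_univ i)

namespace Sh

variable {L : Type u} [Fintype L] [PartialOrder L] {ρ : L → ℕ} (I : Incidence ρ) (M : Sh L)

/-- The form at `τ` glued from forms at the elements covering `τ`. -/
def glued (G : ∀ σ, M.V σ →ₗ[ℝ] M.Du σ) (t : L → ℝ) (τ : L) : M.V τ →ₗ[ℝ] M.Du τ :=
  ∑ σ, t σ • I.ε τ σ • ((M.r τ σ).dualMap.comp ((G σ).comp (M.r τ σ)))

lemma glued_apply (G : ∀ σ, M.V σ →ₗ[ℝ] M.Du σ) (t : L → ℝ) (τ : L) (x y : M.V τ) :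
    glued I M G t τ x y = ∑ σ, t σ * (I.ε τ σ * G σ (M.r τ σ x) (M.r τ σ y)) := by
  simp [glued]

lemma exists_glued {m : ℕ} (h : M.CM I (m + 1)) : ∃ (G : ∀ σ, M.V σ →ₗ[ℝ] M.Du σ) (t : L → ℝ),
    ∀ τ, ρ τ = m → Function.Injective (glued I M G t τ) := by
  choose G hG using fun σ => exists_posDef (M.V σ)
  have h1 : ∀ τ, ∃ p : MvPolynomial L ℝ, p ≠ 0 ∧ (ρ τ = m →
      ∀ t, MvPolynomial.eval t p ≠ 0 → Function.Injective (glued I M G t τ)) := by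
    intro τ
    by_cases hτ : ρ τ = m
    swap
    · exact ⟨1, one_ne_zero, fun h => absurd h hτ⟩
    obtain ⟨p, hp, hp'⟩ := exists_polynomial_injective (Subspace.dual_finrank_eq)
      (fun σ => I.ε τ σ • ((M.r τ σ).dualMap.comp ((G σ).comp (M.r τ σ)))) (fun σ => I.ε τ σ) (by
        change Function.Injective (glued I M G (fun σ => I.ε τ σ) τ)
        rw [injective_iff_map_eq_zero]
        intro x hx
        have h2 : glued I M G (fun σ => I.ε τ σ) τ x x = 0 := by rw [hx]; rfl
        rw [glued_apply] at h2
        simp only [← mul_assoc] at h2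
        rw [Finset.sum_eq_zero_iff_of_nonneg
          fun σ _ => mul_nonneg (mul_self_nonneg _) (hG σ _).1] at h2
        refine eq_zero_of_Ex (h τ (ρ τ) (by omega)) x fun σ hσ => (hG σ _).2 ?_
        exact (mul_eq_zero.1 (h2 σ (Finset.mem_univ σ))).resolve_left (mul_self_ne_zero.2 hσ))
    exact ⟨p, hp, fun _ => hp'⟩
  choose p hp hp' using h1
  have h2 : (∏ τ, p τ) ≠ 0 := Finset.prod_ne_zero_iff.2 fun τ _ => hp τ
  obtain ⟨t, ht⟩ : ∃ t, MvPolynomial.eval t (∏ τ, p τ) ≠ 0 := by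
    by_contra! h3
    exact h2 (MvPolynomial.funext fun t => by rw [h3, map_zero])
  rw [map_prod, Finset.prod_ne_zero_iff] at ht
  exact ⟨G, t, fun τ hτ => hp' τ hτ t (ht τ (Finset.mem_univ τ))⟩

/-- The morphism to the dual sheaf induced by glued forms. -/
def gluedHom (G : ∀ σ, M.V σ →ₗ[ℝ] M.Du σ) (t : L → ℝ) (k : ℕ) : M.Hom (dualSh I M k) where
  app η := LinearMap.codRestrict (dualSub I M k η)
    (LinearMap.pi fun τ => if η ≤ τ ∧ ρ τ = k then (glued I M G t τ).comp (M.r η τ) else 0)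
    fun x => by
      rw [mem_dualSub]
      refine ⟨fun σ hσ => by simp [hσ], fun ξ hξ => ?_⟩
      ext y
      rw [codiff_apply]
      by_cases hk : ρ ξ + 1 = k
      swap
      · refine Finset.sum_eq_zero fun τ _ => ?_
        by_cases h0 : I.ε ξ τ = 0
        · simp [h0]
        · have : ¬ (η ≤ τ ∧ ρ τ = k) := fun h => hk (by rw [← h.2, (I.supp h0).2])
          simp [this]
      have h1 : ∀ τ, I.ε ξ τ * (LinearMap.pi (fun τ => if η ≤ τ ∧ ρ τ = k then
          (glued I M G t τ).comp (M.r η τ) else 0) x τ) (M.r ξ τ y) =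
          ∑ σ, I.ε ξ τ * I.ε τ σ * (t σ * G σ (M.r η σ x) (M.r ξ σ y)) := by
        intro τ
        by_cases h0 : I.ε ξ τ = 0
        · simp [h0]
        have h2 := I.supp h0
        have h3 : η ≤ τ := hξ.trans h2.1.le
        rw [LinearMap.pi_apply, if_pos ⟨h3, h2.2.trans hk⟩, LinearMap.comp_apply, glued_apply,
          Finset.mul_sum]
        refine Finset.sum_congr rfl fun σ _ => ?_
        by_cases h4 : I.ε τ σ = 0
        · simp [h4]
        rw [M.r_comp h3 (I.supp h4).1.le, M.r_comp h2.1.le (I.supp h4).1.le]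
        ring
      rw [Finset.sum_congr rfl fun τ _ => h1 τ, Finset.sum_comm]
      refine Finset.sum_eq_zero fun σ _ => ?_
      rw [← Finset.sum_mul, I.sq, zero_mul]
  natural {σ τ} h x := by
    apply dualVal_ext
    simp only [dualSh, dif_pos h]
    funext υ
    change (if τ ≤ υ ∧ ρ υ = k then (glued I M G t υ).comp (M.r τ υ) else 0) (M.r σ τ x) =
      trunc M.Du τ (fun υ => (if σ ≤ υ ∧ ρ υ = k then (glued I M G t υ).comp (M.r σ υ) else 0) x) υ
    rw [trunc_apply]
    by_cases h1 : τ ≤ υ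
    · by_cases h2 : ρ υ = k
      · simp [h1, h2, h.trans h1, M.r_comp h h1]
      · simp [h2]
    · simp [h1]

lemma dualVal_gluedHom (G : ∀ σ, M.V σ →ₗ[ℝ] M.Du σ) (t : L → ℝ) (k : ℕ) {η : L} (x : M.V η)
    (τ : L) : dualVal I ((gluedHom I M G t k).app η x) τ =
      (if η ≤ τ ∧ ρ τ = k then (glued I M G t τ).comp (M.r η τ) else 0) x := rfl

lemma exists_coker_dual {k : ℕ} (h : M.CM I (k + 2)) : ∃ K : Sh L, K.CM I k ∧
    ∀ η, ρ η ≤ k + 1 → K.dim η = dualWeight ρ (k + 1) M.dim η - M.dim η := by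
  obtain ⟨G, t, hGt⟩ := exists_glued I M h
  have hinj : ∀ η, ρ η ≤ k + 1 → Function.Injective ((gluedHom I M G t (k + 1)).app η) := by
    intro η hη
    rw [injective_iff_map_eq_zero]
    intro x hx
    refine eq_zero_of_CM (h.mono (Nat.le_succ _)) hη x fun τ h1 h2 => ?_
    have h3 := dualVal_gluedHom I M G t (k + 1) x τ
    rw [hx, if_pos ⟨h1, h2⟩, LinearMap.comp_apply] at h3
    exact hGt τ h2 (by rw [← h3, map_zero]; rfl)
  obtain ⟨K, ψ, hψ, hex⟩ := exists_coker (gluedHom I M G t (k + 1))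
  refine ⟨K, fun η i hi => ?_, fun η hη => ?_⟩
  · exact Ex.coker _ ψ hψ hex (fun σ hσ => hinj σ (by omega))
      (dualSh_CM I M h (by omega) η i (by omega)) (h η (i + 1) (by omega))
  · rw [dim_coker _ ψ hψ hex (hinj η hη), dim_dualSh I M h (by omega)]

end Sh

lemma natCast_smul_one_mem_cone (k : ℕ) : (k : ℚ) • (1 : NC) ∈ cone := by
  rw [Nat.cast_smul_eq_nsmul, nsmul_one]
  exact natCast_mem cone k

lemma eq_of_swap_eq {α β γ : NC} (hα : α ∈ cone) (hβ : β ∈ cone) (hγ : γ ∈ cone)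
    (h : swap (α * va + β * vb + γ * vd) = α * va + β * vb + γ * vd) : α = β := by
  rw [map_add, map_add, map_mul, map_mul, map_mul, swap_of_mem_cone hα, swap_of_mem_cone hβ,
    swap_of_mem_cone hγ, swap_va, swap_vb, swap_vd] at h
  rw [← sub_eq_zero]
  apply mul_va_sub_vb_eq_zero
  rw [← sub_eq_zero.2 h.symm]
  noncomm_ring

section Index

variable {L : Type*} [Fintype L] [PartialOrder L] {ρ : L → ℕ} {o : L}

lemma index_congr {m : ℕ} {w w' : L → ℚ} (h : ∀ σ, ρ σ ≤ m → w σ = w' σ) :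
    index ρ o m w = index ρ o m w' := by
  refine Finset.sum_congr rfl fun σ _ => ?_
  split_ifs with h1
  · rw [h σ h1]
  · rfl

lemma index_sub (m : ℕ) (w w' : L → ℚ) :
    index ρ o m (fun σ => w σ - w' σ) = index ρ o m w - index ρ o m w' := by
  simp only [index, ← Finset.sum_sub_distrib]
  refine Finset.sum_congr rfl fun σ _ => ?_
  split_ifs <;> simp [sub_smul]

lemma index_self (hρ : StrictMono ρ) (w : L → ℚ) : index ρ o (ρ o) w = w o • 1 := by
  rw [index, Finset.sum_eq_single o]
  · simp
  · intro σ _ hσ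
    split_ifs with h
    · rw [last_eq_zero, zero_mul, smul_zero]
      intro h'
      exact absurd (hρ (lt_of_le_of_ne h' hσ.symm)) (by omega)
    · rfl
  · simp

lemma index_succ {k : ℕ} (hk : ρ o ≤ k) (w : L → ℚ) : index ρ o (k + 1) w =
    index ρ o k w * (va - vb) +
      (∑ σ, if ρ σ = k + 1 then w σ • interval ρ o σ else 0) * vb := by
  simp only [index, Finset.sum_mul, ← Finset.sum_add_distrib]
  refine Finset.sum_congr rfl fun σ _ => ?_
  rcases lt_trichotomy (ρ σ) (k + 1) with h | h | h
  · have h1 : ρ σ ≤ k := by omega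
    have h2 : k + 1 - ρ σ = k - ρ σ + 1 := by omega
    simp [h.le, h.ne, h1, h2, pow_succ, mul_assoc]
  · have h1 : ¬ ρ σ ≤ k := by omega
    have h2 : σ ≠ o := by rintro rfl; omega
    simp [h, last_of_ne h2]
  · have h1 : ¬ ρ σ ≤ k := by omega
    have h2 : ¬ ρ σ ≤ k + 1 := by omega
    simp [h1, h2, h.ne']

lemma index_cells (hρ : StrictMono ρ) (k : ℕ) (w : L → ℚ) :
    index ρ o k (fun η => ∑ σ, if η ≤ σ ∧ ρ σ = k + 1 then w σ else 0) =
      ∑ σ, if ρ σ = k + 1 then w σ • interval ρ o σ else 0 := by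
  simp only [index, Finset.sum_smul]
  have h1 : ∀ η, (if ρ η ≤ k then ∑ σ, (if η ≤ σ ∧ ρ σ = k + 1 then w σ else 0) •
      (last ρ o η * (va - vb) ^ (k - ρ η)) else 0) = ∑ σ, if ρ σ = k + 1 then
      (if η < σ then w σ • (last ρ o η * (va - vb) ^ (ρ σ - ρ η - 1)) else 0) else 0 := by
    intro η
    by_cases h : ρ η ≤ k
    · rw [if_pos h]
      refine Finset.sum_congr rfl fun σ _ => ?_
      by_cases h2 : ρ σ = k + 1
      · have h3 : ρ σ - ρ η - 1 = k - ρ η := by omega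
        have h4 : η ≤ σ ↔ η < σ :=
          ⟨fun h => lt_of_le_of_ne h (by rintro rfl; omega), le_of_lt⟩
        simp only [h2, and_true, if_true, h4, ite_smul, zero_smul]
        rw [← h2, h3]
      · simp [h2]
    · rw [if_neg h]
      symm
      refine Finset.sum_eq_zero fun σ _ => ?_
      split_ifs with h2 h3
      · have := hρ h3
        omega
      · rfl
      · rfl
  rw [Finset.sum_congr rfl fun η _ => h1 η, Finset.sum_comm]
  refine Finset.sum_congr rfl fun σ _ => ?_
  split_ifs with h
  · rw [interval_eq, Finset.smul_sum]
    refine Finset.sum_congr rfl fun η _ => ?_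
    split_ifs <;> simp
  · simp

end Index

namespace Sh

variable {L : Type u} [Fintype L] [PartialOrder L] {ρ : L → ℕ}

/-- The index of a Cohen–Macaulay sheaf is nonnegative. -/
theorem decomposes_index (I : Incidence ρ) (hρ : StrictMono ρ) {o : L} {m : ℕ} (hm : ρ o < m) (M : Sh L)
    (h : M.CM I m) : Decomposes (index ρ o m M.dim) := by
  induction m using Nat.strong_induction_on generalizing M with
  | _ m ih =>
  obtain ⟨k, rfl⟩ : ∃ k, m = k + 1 := ⟨m - 1, by omega⟩
  have hk : ρ o ≤ k := by omega
  obtain ⟨N, hN, hNd⟩ := exists_coker_toCells h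
  have hS : index ρ o k M.dim + index ρ o k N.dim =
      ∑ σ, if ρ σ = k + 1 then M.dim σ • interval ρ o σ else 0 := by
    rw [index_congr (w := N.dim) fun σ hσ => hNd σ (by omega), index_sub, add_sub_cancel,
      ← index_cells hρ]
    exact index_congr fun σ _ => dim_cells _ _
  have hsw : swap (index ρ o k M.dim + index ρ o k N.dim) =
      index ρ o k M.dim + index ρ o k N.dim := by
    rw [hS, map_sum]
    refine Finset.sum_congr rfl fun σ _ => ?_
    split_ifs
    · rw [map_smul, swap_interval hρ I.eulerian]
    · rw [map_zero]
  have hI : index ρ o (k + 1) M.dim = index ρ o k M.dim * va + index ρ o k N.dim * vb := by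
    rw [index_succ hk, ← hS]
    noncomm_ring
  rw [hI]
  rcases hk.eq_or_lt with hk | hk
  · subst hk
    rw [index_self hρ, index_self hρ]
    exact ⟨_, natCast_smul_one_mem_cone _, _, natCast_smul_one_mem_cone _, 0, zero_mem _,
      by rw [zero_mul, add_zero]; rfl⟩
  obtain ⟨α', hα', β', hβ', γ', hγ', hu⟩ := ih k (by omega) hk M (h.mono (by omega))
  obtain ⟨α'', hα'', β'', hβ'', γ'', hγ'', hw⟩ := ih k (by omega) hk N hN
  obtain ⟨j, rfl⟩ : ∃ j, k = j + 1 := ⟨k - 1, by omega⟩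
  have hj : ρ o ≤ j := by omega
  obtain ⟨K, hK, hKd⟩ := exists_coker_dual I M h
  have hκ : index ρ o j K.dim = β' - α' := by
    rw [← sub_eq_zero]
    apply mul_va_sub_vb_eq_zero
    have h1 : index ρ o (j + 1) K.dim = index ρ o j K.dim * (va - vb) := by
      rw [index_succ hj, add_eq_left]
      apply mul_eq_zero_of_left
      refine Finset.sum_eq_zero fun σ _ => ?_
      split_ifs with h2
      · have h3 : dualWeight ρ (j + 1) M.dim σ = M.dim σ := by
          rw [dualWeight, Finset.sum_eq_single σ]
          · simp [h2]
          · intro ξ _ hξ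
            rw [if_neg]
            rintro ⟨h4, h5⟩
            have := hρ (lt_of_le_of_ne h4 hξ.symm)
            omega
          · simp
        rw [hKd σ h2.le, h3, sub_self, zero_smul]
      · rfl
    have h2 : index ρ o (j + 1) K.dim =
        swap (index ρ o (j + 1) M.dim) - index ρ o (j + 1) M.dim := by
      rw [index_congr hKd, index_sub, index_dualWeight hρ _ fun ξ _ _ =>
        swap_interval hρ I.eulerian o ξ]
    rw [sub_mul, ← h1, h2, hu, map_add, map_add, map_mul, map_mul, map_mul, swap_of_mem_cone hα',
      swap_of_mem_cone hβ', swap_of_mem_cone hγ', swap_va, swap_vb, swap_vd]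
    noncomm_ring
  have hκc : β' - α' ∈ cone := by
    rw [← hκ]
    rcases hj.eq_or_lt with hj | hj
    · rw [← hj, index_self hρ]
      exact natCast_smul_one_mem_cone _
    · obtain ⟨a, ha, b, hb, c, hc, he⟩ := ih j (by omega) hj K hK
      have h3 : swap (a * va + b * vb + c * vd) = a * va + b * vb + c * vd := by
        rw [← he, hκ, map_sub, swap_of_mem_cone hα', swap_of_mem_cone hβ']
      rw [he, ← eq_of_swap_eq ha hb hc h3, ← mul_add]
      exact add_mem (mul_mem ha vc_mem_cone) (mul_mem hc vd_mem_cone)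
  have hsum : α' + α'' = β' + β'' := by
    refine eq_of_swap_eq (add_mem hα' hα'') (add_mem hβ' hβ'') (add_mem hγ' hγ'') ?_
    have : (α' + α'') * va + (β' + β'') * vb + (γ' + γ'') * vd =
        index ρ o (j + 1) M.dim + index ρ o (j + 1) N.dim := by
      rw [hu, hw]; noncomm_ring
    rw [this, hsw]
  refine ⟨α' * vc + γ' * vd, add_mem (mul_mem hα' vc_mem_cone) (mul_mem hγ' vd_mem_cone),
    β'' * vc + γ'' * vd, add_mem (mul_mem hβ'' vc_mem_cone) (mul_mem hγ'' vd_mem_cone),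
    β' - α', hκc, ?_⟩
  rw [hu, hw, eq_sub_of_add_eq' hsum]
  simp only [vc, vd]
  noncomm_ring

/-- The sections over `σ` of a sheaf supported on the filter of `v`. -/
def aboveSub (v : L) (M : Sh L) (σ : L) : Submodule ℝ (M.V σ) := if v ≤ σ then ⊤ else ⊥

lemma aboveSub_pos {v σ : L} {M : Sh L} (h : v ≤ σ) : aboveSub v M σ = ⊤ := if_pos h

lemma aboveSub_neg {v σ : L} {M : Sh L} (h : ¬ v ≤ σ) : aboveSub v M σ = ⊥ := if_neg h

/-- The sections of a sheaf supported on the filter of `v`. -/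
def above (v : L) (M : Sh L) : Sh L where
  V σ := aboveSub v M σ
  r σ τ := if h : σ ≤ τ then (M.r σ τ).restrict fun x hx => by
      by_cases h1 : v ≤ σ
      · rw [aboveSub_pos (h1.trans h)]; trivial
      · rw [aboveSub_neg h1, Submodule.mem_bot] at hx
        rw [hx, map_zero]; exact zero_mem _ else 0
  r_self σ x := by
    rw [dif_pos le_rfl]
    exact Subtype.ext (M.r_self σ x.1)
  r_comp {σ τ υ} h1 h2 x := by
    rw [dif_pos h1, dif_pos h2, dif_pos (h1.trans h2)]
    exact Subtype.ext (M.r_comp h1 h2 x.1)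

/-- The inclusion of the sections supported on a filter. -/
def aboveIncl (v : L) (M : Sh L) : (above v M).Hom M where
  app σ := Submodule.subtype _
  natural {σ τ} h x := by
    simp only [above, dif_pos h]
    rfl

variable {M : Sh L} {v : L}

lemma aboveIncl_injective (σ : L) : Function.Injective ((aboveIncl v M).app σ) :=
  Subtype.val_injective

lemma aboveIncl_eq_zero {σ : L} (h : ¬ v ≤ σ) (x : (above v M).V σ) :
    (aboveIncl v M).app σ x = 0 := by
  have h1 : ∀ y ∈ aboveSub v M σ, y = 0 := fun y hy => by
    rwa [aboveSub_neg h, Submodule.mem_bot] at hy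
  exact h1 _ x.2

lemma exists_aboveIncl {σ : L} (h : v ≤ σ) (x : M.V σ) : ∃ y, (aboveIncl v M).app σ y = x :=
  ⟨⟨x, by rw [aboveSub_pos h]; trivial⟩, rfl⟩

lemma dim_above (σ : L) : (above v M).dim σ = if v ≤ σ then M.dim σ else 0 := by
  change ((Module.finrank ℝ (aboveSub v M σ) : ℕ) : ℚ) = _
  split_ifs with h
  · rw [aboveSub_pos h, finrank_top]; rfl
  · rw [aboveSub_neg h, finrank_bot, Nat.cast_zero]

lemma Ex.above {I : Incidence ρ} {η j : L} {i : ℕ} (hj : IsLUB {η, v} j) (h : M.Ex I j i) :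
    (above v M).Ex I η i := by
  intro f hf
  have h1 : ∀ (g : ∀ σ, M.V σ) ζ, j ≤ ζ → (∀ θ, ¬ v ≤ θ → g θ = 0) →
      M.dd I j g ζ = M.dd I η g ζ := by
    intro g ζ _ hg
    refine Finset.sum_congr rfl fun θ _ => ?_
    have h2 : j ≤ θ ↔ η ≤ θ ∧ v ≤ θ := by
      rw [isLUB_le_iff hj]; simp [upperBounds]
    by_cases h3 : v ≤ θ
    · simp [h2, h3]
    · simp [hg θ h3]
  have h2 : ∀ {ζ}, η ≤ ζ → v ≤ ζ → j ≤ ζ := fun h3 h4 => hj.2 (by simp [upperBounds, h3, h4])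
  have hj1 : η ≤ j := hj.1 (by simp)
  have hj2 : v ≤ j := hj.1 (by simp)
  obtain ⟨g, hg⟩ := h (fun σ => (aboveIncl v M).app σ (f σ)) fun ζ hζ hr => by
    rw [h1 _ ζ hζ fun θ hθ => aboveIncl_eq_zero hθ _, ← Hom.dd, hf ζ (hj1.trans hζ) hr, map_zero]
  have h3 : ∀ σ, ∃ y, (aboveIncl v M).app σ y = if v ≤ σ then g σ else 0 := by
    intro σ
    split_ifs with h4
    · exact exists_aboveIncl h4 _
    · exact ⟨0, map_zero _⟩
  choose g' hg' using h3
  refine ⟨g', fun ξ hξ hr => aboveIncl_injective ξ ?_⟩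
  by_cases h4 : v ≤ ξ
  · rw [Hom.dd, ← h1 _ ξ (h2 hξ h4) fun θ hθ => aboveIncl_eq_zero hθ _, ← hg ξ (h2 hξ h4) hr]
    refine dd_congr fun θ hθ _ => ?_
    rw [hg', if_pos (hj2.trans hθ)]
  · rw [aboveIncl_eq_zero h4, aboveIncl_eq_zero h4]

theorem decomposes_index_below (I : Incidence ρ) (hρ : StrictMono ρ) (hlat : ∀ x y : L, ∃ z, IsLUB {x, y} z)
    (o v y : L) (hy : ρ o + 2 ≤ ρ y) :
    Decomposes (index ρ o (ρ y - 1) (fun x => if ¬ v ≤ x ∧ x ≤ y then 1 else 0)) := by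
  let W : L → Type u := fun σ => {_u : PUnit.{u + 1} // σ = y} → ℝ
  let M : Sh L := cells W ρ (ρ y)
  have hM : M.CM I (ρ y) := cells_CM W I (ρ y)
  have hMd : ∀ η, M.dim η = if η ≤ y then 1 else 0 := by
    intro η
    rw [dim_cells, Finset.sum_eq_single y]
    · simp [W]
    · intro σ _ hσ
      simp [W, hσ]
    · simp
  obtain ⟨C, ψ, hψ, hex⟩ := exists_coker (aboveIncl v M)
  have hC : C.CM I (ρ y - 1) := fun η i hi => by
    obtain ⟨j, hj⟩ := hlat η v
    exact Ex.coker _ ψ hψ hex (fun σ _ => aboveIncl_injective σ) (hM η i (by omega))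
      (Ex.above hj (hM j (i + 1) (by omega)))
  convert decomposes_index I hρ (o := o) (by omega) C hC using 2
  funext η
  rw [dim_coker _ ψ hψ hex (aboveIncl_injective η), dim_above, hMd]
  by_cases h1 : v ≤ η <;> by_cases h2 : η ≤ y <;> simp [h1, h2]

end Sh

/-- The comparison with the Boolean algebra for a lattice with acyclic incidence numbers. -/
theorem interval_sub_bool_mem_cone_of_incidence {L : Type u} [Fintype L] [PartialOrder L]
    {ρ : L → ℕ} (I : Incidence ρ) (hρ : StrictMono ρ) (hcov : ∀ a b : L, a ⋖ b → ρ b = ρ a + 1)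
    (hlat : ∀ x y : L, ∃ z, IsLUB {x, y} z) {o z : L} (hoz : o < z) :
    interval ρ o z - bool (ρ z - ρ o) ∈ cone :=
  interval_sub_bool_mem_cone hρ hcov I.eulerian hlat
    (fun o v y _ _ h => Sh.decomposes_index_below I hρ hlat o v y h) hoz

section Boundary

variable {P : Type*} [Fintype P] [PartialOrder P]

/-- The sign of an element relative to a chain. -/
def sg (s : Finset P) (σ : P) : ℝ := (-1) ^ (s.filter fun τ => τ < σ).card

/-- The simplicial boundary operator on functions on finite sets. -/
def dl (u : Finset P → ℝ) (s : Finset P) : ℝ :=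
  ∑ σ, if σ ∈ s then 0 else sg s σ * u (insert σ s)

lemma sg_mul_self (s : Finset P) (σ : P) : sg s σ * sg s σ = 1 := by
  rw [sg, ← mul_pow]; simp

lemma sg_ne_zero (s : Finset P) (σ : P) : sg s σ ≠ 0 := by simp [sg]

lemma sg_of_forall_lt {s : Finset P} {σ : P} (h : ∀ τ ∈ s, τ < σ) : sg s σ = (-1) ^ s.card := by
  rw [sg, Finset.filter_true_of_mem h]

lemma sg_insert_of_not_lt {s : Finset P} {θ σ : P} (h : ¬ θ < σ) :
    sg (insert θ s) σ = sg s σ := by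
  rw [sg, sg, Finset.filter_insert, if_neg h]

lemma sg_insert_of_lt {s : Finset P} {θ σ : P} (hθ : θ ∉ s) (h : θ < σ) :
    sg (insert θ s) σ = - sg s σ := by
  rw [sg, sg, Finset.filter_insert, if_pos h, Finset.card_insert_of_notMem (by simp [hθ]), pow_succ]
  ring

lemma dl_add (u v : Finset P → ℝ) (s : Finset P) : dl (fun y => u y + v y) s = dl u s + dl v s := by
  simp only [dl, ← Finset.sum_add_distrib]
  refine Finset.sum_congr rfl fun σ _ => ?_
  split_ifs <;> ring

lemma dl_smul (c : ℝ) (u : Finset P → ℝ) (s : Finset P) :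
    dl (fun y => c * u y) s = c * dl u s := by
  simp only [dl, Finset.mul_sum]
  refine Finset.sum_congr rfl fun σ _ => ?_
  split_ifs <;> ring

lemma dl_congr {u v : Finset P → ℝ} {s : Finset P}
    (h : ∀ σ, σ ∉ s → u (insert σ s) = v (insert σ s)) : dl u s = dl v s := by
  refine Finset.sum_congr rfl fun σ _ => ?_
  split_ifs with h1
  · rfl
  · rw [h σ h1]

lemma dl_ne_zero {u : Finset P → ℝ} {s : Finset P} (h : dl u s ≠ 0) :
    ∃ σ, σ ∉ s ∧ u (insert σ s) ≠ 0 := by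
  by_contra! h1
  refine h (Finset.sum_eq_zero fun σ _ => ?_)
  split_ifs with h2
  · rfl
  · rw [h1 σ h2, mul_zero]

lemma dl_dl {u : Finset P → ℝ} (hu : ∀ y, u y ≠ 0 → IsChain (· < ·) (y : Set P)) (s : Finset P) :
    dl (dl u) s = 0 := by
  have h1 : dl (dl u) s = ∑ σ, ∑ τ, if σ ∈ s ∨ τ ∈ s ∨ σ = τ then 0 else
      sg s σ * (sg (insert σ s) τ * u (insert τ (insert σ s))) := by
    refine Finset.sum_congr rfl fun σ _ => ?_
    split_ifs with h
    · simp [h]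
    · rw [dl, Finset.mul_sum]
      refine Finset.sum_congr rfl fun τ _ => ?_
      by_cases h2 : τ ∈ s
      · simp [h2]
      · by_cases h3 : σ = τ
        · simp [h3]
        · simp [h, h2, h3, Ne.symm h3]
  have h2 : dl (dl u) s = - dl (dl u) s := by
    conv_lhs => rw [h1, Finset.sum_comm]
    rw [h1, ← Finset.sum_neg_distrib]
    refine Finset.sum_congr rfl fun σ _ => ?_
    rw [← Finset.sum_neg_distrib]
    refine Finset.sum_congr rfl fun τ _ => ?_
    by_cases h : τ ∈ s ∨ σ ∈ s ∨ τ = σ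
    · have h' : σ ∈ s ∨ τ ∈ s ∨ σ = τ := by tauto
      rw [if_pos h, if_pos h', neg_zero]
    · have h' : ¬ (σ ∈ s ∨ τ ∈ s ∨ σ = τ) := by tauto
      rw [if_neg h, if_neg h', Finset.insert_comm]
      push Not at h
      by_cases h0 : u (insert τ (insert σ s)) = 0
      · simp [h0]
      have hc : τ < σ ∨ σ < τ := hu _ h0 (by simp) (by simp) h.2.2
      rcases hc with hc | hc
      · rw [sg_insert_of_lt h.1 hc, sg_insert_of_not_lt hc.not_gt]; ring
      · rw [sg_insert_of_lt h.2.1 hc, sg_insert_of_not_lt hc.not_gt]; ring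
  linarith

/-- Functions supported on the chains containing `F` whose elements satisfy `p`. -/
def SuppIn (F : Finset P) (p : P → Prop) (u : Finset P → ℝ) : Prop :=
  ∀ y, u y ≠ 0 → IsChain (· < ·) (y : Set P) ∧ F ⊆ y ∧ ∀ σ ∈ y, p σ

lemma card_add_le_of_isChain {ρ : P → ℕ} (hρ : StrictMono ρ) {y : Finset P}
    (hy : IsChain (· < ·) (y : Set P)) {r m : ℕ} (h : ∀ σ ∈ y, r ≤ ρ σ ∧ ρ σ < m) (hrm : r ≤ m) :
    y.card + r ≤ m := by
  have h1 : y.card ≤ (Finset.Ico r m).card := by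
    refine Finset.card_le_card_of_injOn ρ (fun σ hσ => by simpa using h σ hσ) fun σ hσ τ hτ e => ?_
    by_contra hne
    rcases hy hσ hτ hne with h2 | h2
    · exact (hρ h2).ne e
    · exact (hρ h2).ne' e
  rw [Nat.card_Ico] at h1
  omega

end Boundary

/-- Compatible fundamental cycles for the lower intervals of a ranked poset. -/
structure LocalCycles {L : Type u} [Fintype L] [PartialOrder L] (ρ : L → ℕ) (r₀ : ℕ) where
  T : L → Finset L → ℝ
  k : L → L → ℝ
  G : L → Finset L
  strictMono : StrictMono ρ
  le_rank : ∀ x, r₀ ≤ ρ x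
  supp : ∀ {ξ y}, T ξ y ≠ 0 → IsChain (· < ·) (y : Set L) ∧ (∀ σ ∈ y, σ < ξ) ∧ y.card + r₀ = ρ ξ
  cycle : ∀ {η ξ s}, insert η (G η) ⊆ s → dl (T ξ) s = 0
  T_insert : ∀ {θ ξ y}, θ < ξ → (∀ σ ∈ y, σ < θ) → T ξ (insert θ y) = k θ ξ * T θ y
  k_supp : ∀ {θ ξ}, k θ ξ ≠ 0 → θ < ξ ∧ ρ ξ = ρ θ + 1
  T_G : ∀ θ, T θ (G θ) ≠ 0
  exists_ne : ∀ {η ξ}, η < ξ → ∃ y, insert η (G η) ⊆ y ∧ T ξ y ≠ 0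
  exact : ∀ {η ξ}, η < ξ → ∀ u, SuppIn (insert η (G η)) (· < ξ) u →
    (∀ s, insert η (G η) ⊆ s → dl u s = 0) →
    ∃ c u', SuppIn (insert η (G η)) (· < ξ) u' ∧
      ∀ s, insert η (G η) ⊆ s → u s = c * T ξ s + dl u' s

namespace LocalCycles

variable {L : Type u} [Fintype L] [PartialOrder L] {ρ : L → ℕ} {r₀ : ℕ} (Z : LocalCycles ρ r₀)

lemma card_le (Z : LocalCycles ρ r₀) {y : Finset L} (hy : IsChain (· < ·) (y : Set L)) {ξ : L}
    (h : ∀ σ ∈ y, σ < ξ) : y.card + r₀ ≤ ρ ξ :=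
  card_add_le_of_isChain Z.strictMono hy (fun σ hσ => ⟨Z.le_rank σ, Z.strictMono (h σ hσ)⟩)
    (Z.le_rank ξ)

/-- The chain attached to an element. -/
def F (η : L) : Finset L := insert η (Z.G η)

lemma mem_F (η : L) : η ∈ Z.F η := Finset.mem_insert_self _ _

lemma notMem_G (η : L) : η ∉ Z.G η := fun h => lt_irrefl _ ((Z.supp (Z.T_G η)).2.1 _ h)

lemma le_of_mem_F {η σ : L} (h : σ ∈ Z.F η) : σ ≤ η := by
  rcases Finset.mem_insert.1 h with rfl | h
  · exact le_rfl
  · exact ((Z.supp (Z.T_G η)).2.1 _ h).le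

lemma lt_of_mem {η σ : L} {y : Finset L} (hy : IsChain (· < ·) (y : Set L)) (hF : Z.F η ⊆ y)
    (hσ : σ ∈ y) (h : σ ∉ Z.F η) : η < σ := by
  have h1 : σ ≠ η := by rintro rfl; exact h (Z.mem_F _)
  rcases hy hσ (hF (Z.mem_F η)) h1 with h2 | h2
  · exfalso
    have h3 : insert σ (Z.G η) ⊆ y :=
      Finset.insert_subset hσ ((Finset.subset_insert _ _).trans hF)
    have h4 := Z.card_le (y := insert σ (Z.G η)) (hy.mono (by exact_mod_cast h3)) (ξ := η)
      (by
        intro τ hτ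
        rcases Finset.mem_insert.1 hτ with rfl | hτ
        · exact h2
        · exact (Z.supp (Z.T_G η)).2.1 _ hτ)
    have h5 : σ ∉ Z.G η := fun h6 => h (Finset.mem_insert_of_mem h6)
    rw [Finset.card_insert_of_notMem h5] at h4
    have := (Z.supp (Z.T_G η)).2.2
    omega
  · exact h2

/-- The incidence numbers. -/
def ε (θ ξ : L) : ℝ := (-1) ^ (ρ ξ - r₀) * Z.k θ ξ

lemma ε_supp {θ ξ : L} (h : Z.ε θ ξ ≠ 0) : θ < ξ ∧ ρ ξ = ρ θ + 1 :=
  Z.k_supp fun h' => h (by rw [ε, h', mul_zero])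

lemma T_eq {ξ : L} {s : Finset L} {θ : L} (hθ : θ ∈ s) (hs : ∀ σ ∈ s, σ ≤ θ) :
    Z.T ξ s = Z.k θ ξ * Z.T θ (s.erase θ) := by
  by_cases h : θ < ξ
  · rw [← Z.T_insert h, Finset.insert_erase hθ]
    intro σ hσ
    exact lt_of_le_of_ne (hs σ (Finset.mem_of_mem_erase hσ)) (Finset.ne_of_mem_erase hσ)
  · have h1 : Z.k θ ξ = 0 := by_contra fun h1 => h (Z.k_supp h1).1
    rw [h1, zero_mul]
    by_contra h2
    exact h ((Z.supp h2).2.1 θ hθ)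

lemma ε_sq (θ ξ : L) : ∑ τ, Z.ε θ τ * Z.ε τ ξ = 0 := by
  by_cases hρ : ρ ξ = ρ θ + 2
  swap
  · refine Finset.sum_eq_zero fun τ _ => ?_
    by_contra h
    have h1 := Z.ε_supp (left_ne_zero_of_mul h)
    have h2 := Z.ε_supp (right_ne_zero_of_mul h)
    omega
  have h1 := Z.cycle (η := θ) (ξ := ξ) (s := Z.F θ) subset_rfl
  have h2 : dl (Z.T ξ) (Z.F θ) =
      ∑ τ, (-1) ^ (Z.F θ).card * Z.T θ (Z.G θ) * (Z.k θ τ * Z.k τ ξ) := by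
    refine Finset.sum_congr rfl fun τ _ => ?_
    by_cases hτ : θ < τ
    · have h3 : ∀ σ ∈ Z.F θ, σ < τ := fun σ hσ => (Z.le_of_mem_F hσ).trans_lt hτ
      have h4 : τ ∉ Z.F θ := fun h => lt_irrefl _ (h3 τ h)
      rw [if_neg h4, sg_of_forall_lt h3, Z.T_eq (Finset.mem_insert_self _ _), Finset.erase_insert h4,
        Z.T_eq (Z.mem_F θ) (fun σ => Z.le_of_mem_F), F, Finset.erase_insert (Z.notMem_G θ)]
      · ring
      · intro σ hσ
        rcases Finset.mem_insert.1 hσ with rfl | hσ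
        · exact le_rfl
        · exact (h3 σ hσ).le
    · have h3 : Z.k θ τ = 0 := by_contra fun h => hτ (Z.k_supp h).1
      rw [h3, zero_mul, mul_zero]
      split_ifs with h4
      · rfl
      · refine mul_eq_zero_of_right _ (by_contra fun h5 => hτ ?_)
        exact Z.lt_of_mem (Z.supp h5).1 (Finset.subset_insert _ _) (Finset.mem_insert_self _ _) h4
  rw [h1, ← Finset.mul_sum] at h2
  have h3 : ∑ τ, Z.k θ τ * Z.k τ ξ = 0 :=
    (mul_eq_zero.1 h2.symm).resolve_left (mul_ne_zero (by simp) (Z.T_G θ))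
  have h4 : ∀ τ, Z.ε θ τ * Z.ε τ ξ =
      ((-1) ^ (ρ θ + 1 - r₀) * (-1) ^ (ρ ξ - r₀)) * (Z.k θ τ * Z.k τ ξ) := by
    intro τ
    by_cases h : Z.k θ τ = 0
    · simp [ε, h]
    · rw [ε, ε, (Z.k_supp h).2]; ring
  rw [Finset.sum_congr rfl fun τ _ => h4 τ, ← Finset.mul_sum, h3, mul_zero]

/-- The boundary operator on labelled elements. -/
def bd (w : L → ℝ) (θ : L) : ℝ := ∑ ξ, Z.ε θ ξ * w ξ

/-- The simplicial chain of a labelling of the elements. -/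
def phi (η : L) (w : L → ℝ) (y : Finset L) : ℝ :=
  if Z.F η ⊆ y then ∑ ξ, if ξ ∈ y then w ξ * Z.T ξ (y.erase ξ) else 0 else 0

lemma phi_of_max {η ξ : L} {y : Finset L} (hF : Z.F η ⊆ y) (w : L → ℝ) (hξ : ξ ∈ y)
    (hy : ∀ σ ∈ y, σ ≤ ξ) : Z.phi η w y = w ξ * Z.T ξ (y.erase ξ) := by
  rw [phi, if_pos hF, Finset.sum_eq_single ξ]
  · rw [if_pos hξ]
  · intro σ _ hσ
    split_ifs with h
    · refine mul_eq_zero_of_right _ (by_contra fun h1 => ?_)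
      have := (Z.supp h1).2.1 ξ (Finset.mem_erase.2 ⟨hσ.symm, hξ⟩)
      exact absurd (hy σ h) this.not_ge
    · rfl
  · simp

lemma phi_ne_zero {η : L} {w : L → ℝ} {y : Finset L} (h : Z.phi η w y ≠ 0) :
    IsChain (· < ·) (y : Set L) ∧ Z.F η ⊆ y ∧
      ∃ ξ ∈ y, η ≤ ξ ∧ w ξ ≠ 0 ∧ (∀ σ ∈ y, σ ≤ ξ) ∧ Z.T ξ (y.erase ξ) ≠ 0 := by
  rw [phi] at h
  split_ifs at h with hF
  · obtain ⟨ξ, _, hξ⟩ := Finset.exists_ne_zero_of_sum_ne_zero h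
    split_ifs at hξ with h1
    · have h2 := Z.supp (right_ne_zero_of_mul hξ)
      have h3 : ∀ σ ∈ y, σ ≤ ξ := by
        intro σ hσ
        by_cases e : σ = ξ
        · exact e.le
        · exact (h2.2.1 σ (Finset.mem_erase.2 ⟨e, hσ⟩)).le
      refine ⟨?_, hF, ξ, h1, h3 η (hF (Z.mem_F η)), left_ne_zero_of_mul hξ, h3,
        right_ne_zero_of_mul hξ⟩
      rw [← Finset.insert_erase h1, Finset.coe_insert]
      exact h2.1.insert fun σ hσ _ => Or.inr (h2.2.1 σ hσ)
    · exact absurd rfl hξ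
  · exact absurd rfl h

lemma dl_phi (η : L) (w : L → ℝ) {s : Finset L} (hF : Z.F η ⊆ s) :
    dl (Z.phi η w) s = Z.phi η (Z.bd w) s := by
  have h1 : dl (Z.phi η w) s = ∑ ξ, ∑ σ, if σ ∈ s then 0 else
      sg s σ * (if ξ ∈ insert σ s then w ξ * Z.T ξ ((insert σ s).erase ξ) else 0) := by
    rw [Finset.sum_comm]
    refine Finset.sum_congr rfl fun σ _ => ?_
    split_ifs with h
    · simp
    · rw [phi, if_pos (hF.trans (Finset.subset_insert _ _)), Finset.mul_sum]
  have h2 : ∀ ξ, (∑ σ, if σ ∈ s then 0 else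
      sg s σ * (if ξ ∈ insert σ s then w ξ * Z.T ξ ((insert σ s).erase ξ) else 0)) =
      if ξ ∈ s then 0 else w ξ * ((-1) ^ s.card * Z.T ξ s) := by
    intro ξ
    split_ifs with hξ
    · by_cases hξF : ξ ∈ Z.F η
      · refine Finset.sum_eq_zero fun σ _ => by_contra fun h => ?_
        split_ifs at h with h3 h4
        · exact h rfl
        · have h5 := Z.supp (right_ne_zero_of_mul (right_ne_zero_of_mul h))
          have h6 : ∀ τ ∈ s, τ ≠ ξ → τ ∈ (insert σ s).erase ξ := fun τ h7 h8 =>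
            Finset.mem_erase.2 ⟨h8, Finset.mem_insert_of_mem h7⟩
          by_cases e : η = ξ
          · subst e
            have h7 : insert σ (Z.G η) ⊆ (insert σ s).erase η := by
              refine Finset.insert_subset (Finset.mem_erase.2 ⟨?_, Finset.mem_insert_self _ _⟩)
                fun τ hτ => h6 τ (hF (Finset.mem_insert_of_mem hτ)) ?_
              · rintro rfl; exact h3 hξ
              · rintro rfl; exact Z.notMem_G _ hτ
            have h8 := Finset.card_le_card h7
            rw [Finset.card_insert_of_notMem fun h9 =>
              h3 (hF (Finset.mem_insert_of_mem h9))] at h8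
            have := (Z.supp (Z.T_G η)).2.2
            omega
          · exact absurd (Z.le_of_mem_F hξF) (h5.2.1 η (h6 η (hF (Z.mem_F η)) e)).not_ge
        · simp at h
      have h3 := Z.cycle (η := η) (ξ := ξ) (s := s.erase ξ) (Finset.subset_erase.2 ⟨hF, hξF⟩)
      trans w ξ * dl (Z.T ξ) (s.erase ξ)
      swap
      · rw [h3, mul_zero]
      rw [dl, Finset.mul_sum]
      refine Finset.sum_congr rfl fun σ _ => ?_
      by_cases e : σ = ξ
      · subst e
        have : Z.T σ (insert σ (s.erase σ)) = 0 := by_contra fun h =>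
          lt_irrefl _ ((Z.supp h).2.1 σ (Finset.mem_insert_self _ _))
        rw [Finset.insert_erase hξ] at this
        simp [hξ, this]
      by_cases hσ : σ ∈ s
      · simp [hσ, e]
      · have h4 : (insert σ s).erase ξ = insert σ (s.erase ξ) := by
          rw [Finset.erase_insert_of_ne e]
        rw [if_neg hσ, if_pos (Finset.mem_insert_of_mem hξ), h4,
          if_neg fun h => hσ (Finset.mem_of_mem_erase h)]
        by_cases h5 : Z.T ξ (insert σ (s.erase ξ)) = 0
        · simp [h5]
        have h6 := (Z.supp h5).2.1 σ (Finset.mem_insert_self _ _)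
        have h7 : sg s σ = sg (s.erase ξ) σ := by
          conv_lhs => rw [← Finset.insert_erase hξ]
          exact sg_insert_of_not_lt h6.not_gt
        rw [h7]; ring
    · rw [Finset.sum_eq_single ξ]
      · rw [if_neg hξ, if_pos (Finset.mem_insert_self _ _), Finset.erase_insert hξ]
        by_cases h5 : Z.T ξ s = 0
        · simp [h5]
        rw [sg_of_forall_lt (Z.supp h5).2.1]; ring
      · intro σ _ hσ
        simp [hξ, hσ.symm]
      · simp
  rw [h1, Finset.sum_congr rfl fun ξ _ => h2 ξ]
  by_cases hs : ∃ θ ∈ s, ∀ σ ∈ s, σ ≤ θ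
  · obtain ⟨θ, hθ, hsθ⟩ := hs
    rw [Z.phi_of_max hF _ hθ hsθ, bd, Finset.sum_mul]
    refine Finset.sum_congr rfl fun ξ _ => ?_
    rw [Z.T_eq hθ hsθ, ε]
    by_cases h3 : Z.k θ ξ = 0
    · simp [h3]
    by_cases h4 : Z.T θ (s.erase θ) = 0
    · simp [h4]
    have h5 := Z.k_supp h3
    have h6 : ξ ∉ s := fun h => absurd (hsθ ξ h) h5.1.not_ge
    have h7 := (Z.supp h4).2.2
    rw [Finset.card_erase_of_mem hθ] at h7
    have h8 : 0 < s.card := Finset.card_pos.2 ⟨θ, hθ⟩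
    rw [if_neg h6, h5.2, show ρ θ + 1 - r₀ = s.card by omega]
    ring
  · have h3 : Z.phi η (Z.bd w) s = 0 := by_contra fun h => by
      obtain ⟨_, _, ξ, h1, _, _, h2, _⟩ := Z.phi_ne_zero h
      exact hs ⟨ξ, h1, h2⟩
    rw [h3]
    refine Finset.sum_eq_zero fun ξ _ => ?_
    split_ifs with h4
    · rfl
    · by_cases h5 : Z.T ξ s = 0
      · simp [h5]
      · exfalso
        have hne : s.Nonempty := ⟨η, hF (Z.mem_F η)⟩
        obtain ⟨θ, hθ⟩ := s.exists_maximal hne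
        refine hs ⟨θ, hθ.1, fun σ hσ => ?_⟩
        by_cases e : σ = θ
        · exact e.le
        rcases (Z.supp h5).1 hσ hθ.1 e with h6 | h6
        · exact h6.le
        · exact hθ.2 hσ h6.le

lemma eq_zero_of_phi {η : L} {w : L → ℝ} (h : ∀ s, Z.F η ⊆ s → Z.phi η w s = 0) {ξ : L}
    (hξ : η ≤ ξ) : w ξ = 0 := by
  have h1 : ∃ y, Z.F η ⊆ insert ξ y ∧ Z.T ξ y ≠ 0 := by
    rcases hξ.eq_or_lt with rfl | hξ
    · exact ⟨_, subset_rfl, Z.T_G η⟩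
    · obtain ⟨y, h1, h2⟩ := Z.exists_ne hξ
      exact ⟨y, Finset.Subset.trans h1 (Finset.subset_insert _ _), h2⟩
  obtain ⟨y, hy, hT⟩ := h1
  have h2 := (Z.supp hT).2.1
  have h3 := h _ hy
  rw [Z.phi_of_max hy w (Finset.mem_insert_self _ _), Finset.erase_insert] at h3
  · exact (mul_eq_zero.1 h3).resolve_right hT
  · exact fun h => lt_irrefl _ (h2 _ h)
  · intro σ hσ
    rcases Finset.mem_insert.1 hσ with rfl | hσ
    · exact le_rfl
    · exact (h2 σ hσ).le

end LocalCycles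

lemma SuppIn.add {P : Type*} [Fintype P] [PartialOrder P] {F : Finset P} {p : P → Prop}
    {u v : Finset P → ℝ} (hu : SuppIn F p u) (hv : SuppIn F p v) :
    SuppIn F p fun y => u y + v y := by
  intro y hy
  by_cases h : u y = 0
  · exact hv y fun h' => hy (by simp [h, h'])
  · exact hu y h

namespace LocalCycles

variable {L : Type u} [Fintype L] [PartialOrder L] {ρ : L → ℕ} {r₀ : ℕ} (Z : LocalCycles ρ r₀)

lemma phi_add_smul (η : L) (w w' : L → ℝ) (c : ℝ) (y : Finset L) :
    Z.phi η (fun ξ => w ξ + c * w' ξ) y = Z.phi η w y + c * Z.phi η w' y := by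
  unfold phi
  split_ifs
  · rw [Finset.mul_sum, ← Finset.sum_add_distrib]
    refine Finset.sum_congr rfl fun ξ _ => ?_
    split_ifs <;> ring
  · simp

lemma eq_phi_single {η : L} {u : Finset L → ℝ}
    (hu : SuppIn (Z.F η) (· ∈ Z.F η) u) (s : Finset L) (hs : Z.F η ⊆ s) :
    u s = Z.phi η (Pi.single η (u (Z.F η) / Z.T η (Z.G η))) s := by
  by_cases h : s = Z.F η
  · subst h
    rw [Z.phi_of_max subset_rfl _ (Z.mem_F η) fun σ => Z.le_of_mem_F, Pi.single_eq_same, F,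
      Finset.erase_insert (Z.notMem_G η), div_mul_cancel₀ _ (Z.T_G η)]
  · have h1 : u s = 0 := by_contra fun h1 =>
      h (Finset.Subset.antisymm (fun σ hσ => (hu s h1).2.2 σ hσ) hs)
    rw [h1]
    by_contra h2
    obtain ⟨hc, _, ξ, _, _, h3, h4, _⟩ := Z.phi_ne_zero (Ne.symm h2)
    have h5 : ξ = η := by_contra fun h5 => h3 (Pi.single_eq_of_ne h5 _)
    subst h5
    refine h (Finset.Subset.antisymm (fun σ hσ => ?_) hs)
    by_contra h5
    exact absurd (h4 σ hσ) (Z.lt_of_mem hc hs hσ h5).not_ge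

/-- The part of a chain function above a maximal element `ξ`. -/
def lk (ξ : L) (u : Finset L → ℝ) (t : Finset L) : ℝ :=
  if ∀ σ ∈ t, σ < ξ then u (insert ξ t) else 0

/-- The cone with apex `ξ` over a chain function. -/
def con (ξ : L) (v : Finset L → ℝ) (y : Finset L) : ℝ := if ξ ∈ y then v (y.erase ξ) else 0

lemma dl_lk {ξ : L} {u : Finset L → ℝ}
    (hu : ∀ y, ξ ∈ y → u y ≠ 0 → IsChain (· < ·) (y : Set L) ∧ ∀ σ ∈ y, σ ≤ ξ) {s : Finset L}
    (hs : ∀ σ ∈ s, σ < ξ) : dl (lk ξ u) s = dl u (insert ξ s) := by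
  have h1 : ξ ∉ s := fun h => lt_irrefl _ (hs _ h)
  refine Finset.sum_congr rfl fun σ _ => ?_
  by_cases h2 : σ ∈ s
  · simp [h2]
  rw [if_neg h2]
  by_cases h3 : σ = ξ
  · subst h3
    rw [if_pos (Finset.mem_insert_self _ _), lk, if_neg, mul_zero]
    exact fun h => lt_irrefl _ (h σ (Finset.mem_insert_self _ _))
  rw [if_neg (by simp [h2, h3]), Finset.insert_comm]
  by_cases h4 : σ < ξ
  · rw [sg_insert_of_not_lt h4.not_gt, lk, if_pos]
    intro τ hτ
    rcases Finset.mem_insert.1 hτ with rfl | hτ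
    · exact h4
    · exact hs τ hτ
  · rw [lk, if_neg fun h => h4 (h σ (Finset.mem_insert_self _ _))]
    by_cases h5 : u (insert ξ (insert σ s)) = 0
    · rw [h5, mul_zero, mul_zero]
    · exfalso
      have h6 := (hu _ (Finset.mem_insert_self _ _) h5).2 σ (by simp)
      exact h4 (lt_of_le_of_ne h6 h3)

lemma dl_con {ξ : L} {v : Finset L → ℝ} (hv : ∀ y, v y ≠ 0 → ∀ σ ∈ y, σ < ξ) {s : Finset L}
    (hξ : ξ ∈ s) : dl (con ξ v) s = dl v (s.erase ξ) := by
  refine Finset.sum_congr rfl fun σ _ => ?_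
  by_cases h3 : σ = ξ
  · subst h3
    rw [if_pos hξ, if_neg (Finset.notMem_erase _ _)]
    by_contra h
    exact lt_irrefl _ (hv _ (right_ne_zero_of_mul (Ne.symm h)) σ (Finset.mem_insert_self _ _))
  by_cases h2 : σ ∈ s
  · simp [h2, h3]
  rw [if_neg h2, if_neg fun h => h2 (Finset.mem_of_mem_erase h), con,
    if_pos (Finset.mem_insert_of_mem hξ), Finset.erase_insert_of_ne h3]
  by_cases h : v (insert σ (s.erase ξ)) = 0
  · simp [h]
  have h4 := hv _ h σ (Finset.mem_insert_self _ _)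
  conv_lhs => rw [← Finset.insert_erase hξ]
  rw [sg_insert_of_not_lt h4.not_gt, Finset.insert_erase hξ]

lemma suppIn_lk {η ξ : L} (hξ : η < ξ) {u : Finset L → ℝ} {p : L → Prop}
    (hu : SuppIn (Z.F η) p u) : SuppIn (Z.F η) (· < ξ) (lk ξ u) := by
  intro y hy
  rw [lk] at hy
  split_ifs at hy with h
  · have h1 := hu _ hy
    refine ⟨h1.1.mono (by exact_mod_cast Finset.subset_insert _ _), fun σ hσ => ?_, h⟩
    rcases Finset.mem_insert.1 (h1.2.1 hσ) with rfl | h2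
    · exact absurd (Z.le_of_mem_F hσ) hξ.not_ge
    · exact h2
  · exact absurd rfl hy

lemma suppIn_con {η ξ : L} {S : Finset L} (hξ : ξ ∈ S)
    (hS : ∀ σ τ, τ ∈ S → η < σ → σ < τ → σ ∈ S) {v : Finset L → ℝ}
    (hv : SuppIn (Z.F η) (· < ξ) v) : SuppIn (Z.F η) (fun σ => σ ∈ Z.F η ∨ σ ∈ S) (con ξ v) := by
  intro y hy
  rw [con] at hy
  split_ifs at hy with h
  · have h1 := hv _ hy
    refine ⟨?_, h1.2.1.trans (Finset.erase_subset _ _), fun σ hσ => ?_⟩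
    · rw [← Finset.insert_erase h, Finset.coe_insert]
      exact h1.1.insert fun σ hσ _ => Or.inr (h1.2.2 σ hσ)
    · by_cases e : σ = ξ
      · subst e; exact Or.inr hξ
      have h2 : σ ∈ y.erase ξ := Finset.mem_erase.2 ⟨e, hσ⟩
      by_cases h3 : σ ∈ Z.F η
      · exact Or.inl h3
      · exact Or.inr (hS σ ξ hξ (Z.lt_of_mem h1.1 h1.2.1 h2 h3) (h1.2.2 σ h2))
  · exact absurd rfl hy

lemma exists_phi_add_dl (η : L) (S : Finset L) : (∀ σ ∈ S, η < σ) →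
    (∀ σ τ, τ ∈ S → η < σ → σ < τ → σ ∈ S) → ∀ (w : L → ℝ) (u : Finset L → ℝ),
    SuppIn (Z.F η) (fun σ => σ ∈ Z.F η ∨ σ ∈ S) u →
    (∀ s, Z.F η ⊆ s → dl u s = Z.phi η w s) →
    ∃ w' u', SuppIn (Z.F η) (fun σ => σ ∈ Z.F η ∨ σ ∈ S) u' ∧
      (∀ ξ, w' ξ ≠ 0 → ξ = η ∨ ξ ∈ S) ∧ ∀ s, Z.F η ⊆ s → u s = Z.phi η w' s + dl u' s := by
  induction S using Finset.strongInduction with | H S ih => ?_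
  intro hηS hS w u hu hw
  rcases S.eq_empty_or_nonempty with rfl | hne
  · refine ⟨Pi.single η (u (Z.F η) / Z.T η (Z.G η)), fun _ => 0, fun y hy => absurd rfl hy,
      fun ξ hξ => Or.inl (by_contra fun h => hξ (Pi.single_eq_of_ne h _)), fun s hs => ?_⟩
    rw [Z.eq_phi_single (u := u) (by simpa using hu) s hs]
    simp [dl]
  obtain ⟨ξ, hξ⟩ := S.exists_maximal hne
  have hmax : ∀ σ, (σ ∈ Z.F η ∨ σ ∈ S) → ¬ ξ < σ := by
    intro σ h h1
    rcases h with h | h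
    · exact absurd ((hηS ξ hξ.1).trans h1) (Z.le_of_mem_F h).not_gt
    · exact absurd (hξ.2 h h1.le) h1.not_ge
  have hle : ∀ y : Finset L, ξ ∈ y → IsChain (· < ·) (y : Set L) →
      (∀ σ ∈ y, σ ∈ Z.F η ∨ σ ∈ S) → ∀ σ ∈ y, σ ≤ ξ := by
    intro y h1 h2 h3 σ hσ
    by_cases e : σ = ξ
    · exact e.le
    rcases h2 hσ h1 e with h4 | h4
    · exact h4.le
    · exact absurd h4 (hmax σ (h3 σ hσ))
  have hlk : ∀ s, Z.F η ⊆ s → (∀ σ ∈ s, σ < ξ) → dl (lk ξ u) s = w ξ * Z.T ξ s := by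
    intro s hs h
    rw [dl_lk (fun y hy h0 => ⟨(hu y h0).1, hle y hy (hu y h0).1 (hu y h0).2.2⟩) h,
      hw _ (hs.trans (Finset.subset_insert _ _)),
      Z.phi_of_max (hs.trans (Finset.subset_insert _ _)) _ (Finset.mem_insert_self _ _),
      Finset.erase_insert fun h1 => lt_irrefl _ (h _ h1)]
    intro σ hσ
    rcases Finset.mem_insert.1 hσ with rfl | hσ
    · exact le_rfl
    · exact (h σ hσ).le
  have hvs := Z.suppIn_lk (hηS ξ hξ.1) hu
  have hwξ : w ξ = 0 := by
    obtain ⟨y, hy, hT⟩ := Z.exists_ne (hηS ξ hξ.1)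
    have h1 := hlk y hy (Z.supp hT).2.1
    have h2 : dl (lk ξ u) y = 0 := by
      by_contra h
      obtain ⟨σ, hσ, h3⟩ := dl_ne_zero h
      have h4 := hvs _ h3
      have h5 := Z.card_le h4.1 h4.2.2
      rw [Finset.card_insert_of_notMem hσ] at h5
      have := (Z.supp hT).2.2
      omega
    rw [h2] at h1
    exact (mul_eq_zero.1 h1.symm).resolve_right hT
  obtain ⟨c, v', hv', hv⟩ := Z.exact (hηS ξ hξ.1) (lk ξ u) hvs (by
    intro s hs
    by_cases h : ∀ σ ∈ s, σ < ξ
    · rw [hlk s hs h, hwξ, zero_mul]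
    · by_contra h1
      obtain ⟨σ, hσ, h3⟩ := dl_ne_zero h1
      exact h fun τ hτ => (hvs _ h3).2.2 τ (Finset.mem_insert_of_mem hτ))
  have hcs := Z.suppIn_con hξ.1 hS hv'
  have hlt : S.erase ξ ⊂ S := Finset.erase_ssubset hξ.1
  have hphi : ∀ y, Z.phi η (Pi.single ξ 1) y ≠ 0 → IsChain (· < ·) (y : Set L) ∧
      ∀ σ ∈ y, σ ∈ Z.F η ∨ σ ∈ S := by
    intro y hy
    obtain ⟨h1, h2, ζ, h3, h4, h5, h6, h7⟩ := Z.phi_ne_zero hy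
    have h8 : ζ = ξ := by_contra fun h8 => h5 (Pi.single_eq_of_ne h8 _)
    subst h8
    refine ⟨h1, fun σ hσ => ?_⟩
    by_cases h9 : σ ∈ Z.F η
    · exact Or.inl h9
    rcases (h6 σ hσ).eq_or_lt with rfl | h10
    · exact Or.inr hξ.1
    · exact Or.inr (hS σ ζ hξ.1 (Z.lt_of_mem h1 h2 hσ h9) h10)
  obtain ⟨w', u', hu', hw', h'⟩ := ih _ hlt (fun σ hσ => hηS σ (Finset.mem_of_mem_erase hσ))
    (fun σ τ hτ h1 h2 => Finset.mem_erase.2 ⟨by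
        rintro rfl
        exact hmax τ (Or.inr (Finset.mem_of_mem_erase hτ)) h2,
      hS σ τ (Finset.mem_of_mem_erase hτ) h1 h2⟩)
    (fun ζ => w ζ + (-c) * Z.bd (Pi.single ξ 1) ζ)
    (fun s => if Z.F η ⊆ s then
      u s + (-c) * Z.phi η (Pi.single ξ 1) s + (-1) * dl (con ξ v') s else 0)
    (by
      intro y hy
      dsimp only at hy
      split_ifs at hy with hF
      swap
      · exact absurd rfl hy
      have h1 : IsChain (· < ·) (y : Set L) ∧ ∀ σ ∈ y, σ ∈ Z.F η ∨ σ ∈ S := by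
        by_cases h1 : u y = 0
        · by_cases h2 : Z.phi η (Pi.single ξ 1) y = 0
          · rw [h1, h2] at hy
            obtain ⟨σ, hσ, h3⟩ := dl_ne_zero (u := con ξ v') (s := y) (by
              intro h3; rw [h3] at hy; simp at hy)
            have h4 := hcs _ h3
            exact ⟨h4.1.mono (by exact_mod_cast Finset.subset_insert _ _),
              fun τ hτ => h4.2.2 τ (Finset.mem_insert_of_mem hτ)⟩
          · exact hphi y h2
        · exact ⟨(hu y h1).1, (hu y h1).2.2⟩
      refine ⟨h1.1, hF, fun σ hσ => ?_⟩
      have h2 : ξ ∉ y := by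
        intro hξy
        refine hy ?_
        have h3 := hle y hξy h1.1 h1.2
        have h4 : ∀ σ ∈ y.erase ξ, σ < ξ := fun σ hσ =>
          lt_of_le_of_ne (h3 σ (Finset.mem_of_mem_erase hσ)) (Finset.ne_of_mem_erase hσ)
        have h5 : Z.F η ⊆ y.erase ξ := by
          intro σ hσ
          refine Finset.mem_erase.2 ⟨?_, hF hσ⟩
          rintro rfl
          exact absurd (Z.le_of_mem_F hσ) (hηS _ hξ.1).not_ge
        have h6 := hv _ h5
        rw [lk, if_pos h4, Finset.insert_erase hξy] at h6
        rw [dl_con (fun y hy => (hv' y hy).2.2) hξy, Z.phi_of_max hF _ hξy h3, h6,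
          Pi.single_eq_same]
        ring
      rcases h1.2 σ hσ with h3 | h3
      · exact Or.inl h3
      · exact Or.inr (Finset.mem_erase.2 ⟨fun e => h2 (e ▸ hσ), h3⟩))
    (by
      intro s hs
      rw [dl_congr (v := fun s => u s + (-c) * Z.phi η (Pi.single ξ 1) s + (-1) * dl (con ξ v') s)
        fun σ _ => if_pos (hs.trans (Finset.subset_insert _ _))]
      rw [dl_add, dl_add, dl_smul, dl_smul, dl_dl (fun y hy => (hcs y hy).1), Z.dl_phi _ _ hs,
        hw s hs, Z.phi_add_smul]
      ring)
  refine ⟨fun ζ => w' ζ + c * (Pi.single ξ 1 : L → ℝ) ζ, fun y => u' y + con ξ v' y,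
    SuppIn.add (fun y hy => ?_) hcs, fun ζ hζ => ?_, fun s hs => ?_⟩
  · have h1 := hu' y hy
    exact ⟨h1.1, h1.2.1, fun σ hσ => (h1.2.2 σ hσ).imp_right Finset.mem_of_mem_erase⟩
  · by_cases e : ζ = ξ
    · subst e; exact Or.inr hξ.1
    · dsimp only at hζ
      rw [Pi.single_eq_of_ne e, mul_zero, add_zero] at hζ
      exact (hw' ζ hζ).imp_right Finset.mem_of_mem_erase
  · have h1 := h' s hs
    rw [if_pos hs] at h1
    rw [Z.phi_add_smul, dl_add]
    linarith

lemma exists_bd_eq {η ζ : L} (hη : η < ζ) {w : L → ℝ} (hw : ∀ ξ, w ξ ≠ 0 → η ≤ ξ ∧ ξ ≤ ζ)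
    (hbd : ∀ θ, η ≤ θ → θ ≤ ζ → Z.bd w θ = 0) :
    ∃ w', (∀ ξ, w' ξ ≠ 0 → η ≤ ξ ∧ ξ ≤ ζ) ∧ ∀ θ, η ≤ θ → Z.bd w' θ = w θ := by
  have hbd' : ∀ θ, η ≤ θ → Z.bd w θ = 0 := by
    intro θ h
    by_cases h1 : θ ≤ ζ
    · exact hbd θ h h1
    · refine Finset.sum_eq_zero fun ξ _ => by_contra fun h2 => h1 ?_
      exact (Z.ε_supp (left_ne_zero_of_mul h2)).1.le.trans (hw ξ (right_ne_zero_of_mul h2)).2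
  have hζF : ζ ∉ Z.F η := fun h => absurd (Z.le_of_mem_F h) hη.not_ge
  have hφ : ∀ y, Z.phi η w y ≠ 0 → IsChain (· < ·) (y : Set L) ∧ Z.F η ⊆ y ∧ ∀ σ ∈ y, σ ≤ ζ := by
    intro y hy
    obtain ⟨h1, h2, ξ, h3, h4, h5, h6, h7⟩ := Z.phi_ne_zero hy
    exact ⟨h1, h2, fun σ hσ => (h6 σ hσ).trans (hw ξ h5).2⟩
  set v : Finset L → ℝ := fun y => (-1) ^ y.card * if ζ ∈ y then 0 else Z.phi η w y with hvdef
  have hv : SuppIn (Z.F η) (· < ζ) v := by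
    intro y hy
    have h1 := right_ne_zero_of_mul hy
    split_ifs at h1 with h2
    · exact absurd rfl h1
    · have h3 := hφ y h1
      exact ⟨h3.1, h3.2.1, fun σ hσ => lt_of_le_of_ne (h3.2.2 σ hσ) fun e => h2 (e ▸ hσ)⟩
  have hcon : ∀ s, Z.F η ⊆ s → dl (con ζ v) s = Z.phi η w s := by
    intro s hs
    by_cases hζ : ζ ∈ s
    · rw [dl_con (fun y hy => (hv y hy).2.2) hζ]
      have h1 : Z.F η ⊆ s.erase ζ := Finset.subset_erase.2 ⟨hs, hζF⟩
      have h2 : dl (Z.phi η w) (s.erase ζ) = 0 := by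
        rw [Z.dl_phi _ _ h1]
        by_contra h
        obtain ⟨_, _, ξ, _, h3, h4, _⟩ := Z.phi_ne_zero h
        exact h4 (hbd' ξ h3)
      have h3 : dl v (s.erase ζ) = ∑ σ, ((-1) ^ s.card * (if σ ∈ s.erase ζ then 0 else
          sg (s.erase ζ) σ * Z.phi η w (insert σ (s.erase ζ))) + if σ = ζ then Z.phi η w s else 0) := by
        refine Finset.sum_congr rfl fun σ _ => ?_
        have hc : (s.erase ζ).card + 1 = s.card := Finset.card_erase_add_one hζ
        by_cases e : σ = ζ
        · subst e
          rw [if_pos rfl, if_neg (Finset.notMem_erase _ _), if_neg (Finset.notMem_erase _ _),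
            Finset.insert_erase hζ]
          simp only [hvdef]
          rw [if_pos hζ]
          by_cases h4 : Z.phi η w s = 0
          · simp [h4]
          have h5 := hφ s h4
          rw [sg_of_forall_lt fun τ hτ => lt_of_le_of_ne (h5.2.2 τ (Finset.mem_of_mem_erase hτ))
            (Finset.ne_of_mem_erase hτ), ← hc, pow_succ]
          have : ((-1 : ℝ) ^ (s.erase σ).card) * (-1) ^ (s.erase σ).card = 1 := by
            rw [← mul_pow]; simp
          linear_combination (Z.phi η w s) * this
        · rw [if_neg e, add_zero]
          split_ifs with h4
          · simp
          · simp only [hvdef]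
            rw [if_neg (by simp [Ne.symm e]), Finset.card_insert_of_notMem h4, hc]
            ring
      rw [h3, Finset.sum_add_distrib, ← Finset.mul_sum]
      change (-1) ^ s.card * dl (Z.phi η w) (s.erase ζ) + _ = _
      rw [h2]
      simp
    · rw [dl, Finset.sum_eq_single ζ]
      · rw [if_neg hζ, con, if_pos (Finset.mem_insert_self _ _), Finset.erase_insert hζ]
        simp only [hvdef]
        rw [if_neg hζ]
        by_cases h4 : Z.phi η w s = 0
        · simp [h4]
        rw [sg_of_forall_lt fun τ hτ => lt_of_le_of_ne ((hφ s h4).2.2 τ hτ) fun e => hζ (e ▸ hτ),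
          ← mul_assoc, ← mul_pow]
        simp
      · intro σ _ hσ
        have h1 : ζ ∉ insert σ s := by
          rw [Finset.mem_insert]
          exact fun h => h.elim (fun h => hσ h.symm) hζ
        rw [con, if_neg h1, mul_zero, ite_self]
      · simp
  obtain ⟨w', u', hu', hw', h⟩ := Z.exists_phi_add_dl η
    (Finset.univ.filter fun σ => η < σ ∧ σ ≤ ζ) (by simp +contextual)
    (fun σ τ hτ h1 h2 => by
      simp only [Finset.mem_filter, Finset.mem_univ, true_and] at hτ ⊢
      exact ⟨h1, h2.le.trans hτ.2⟩) w (con ζ v)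
    (Z.suppIn_con (by simpa using hη) (fun σ τ hτ h1 h2 => by
      simp only [Finset.mem_filter, Finset.mem_univ, true_and] at hτ ⊢
      exact ⟨h1, h2.le.trans hτ.2⟩) hv) hcon
  refine ⟨w', fun ξ hξ => ?_, fun θ hθ => ?_⟩
  · rcases hw' ξ hξ with rfl | h1
    · exact ⟨le_rfl, hη.le⟩
    · simp only [Finset.mem_filter, Finset.mem_univ, true_and] at h1
      exact ⟨h1.1.le, h1.2⟩
  · have h1 : (fun ξ => Z.bd w' ξ + (-1) * w ξ) θ = 0 := by
      refine Z.eq_zero_of_phi (w := fun ξ => Z.bd w' ξ + (-1) * w ξ) (η := η) (fun s hs => ?_) hθ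
      rw [Z.phi_add_smul, ← Z.dl_phi _ _ hs, ← hcon s hs,
        dl_congr (u := con ζ v) (v := fun y => Z.phi η w' y + dl u' y)
          fun σ _ => h _ (hs.trans (Finset.subset_insert _ _)),
        dl_add, dl_dl fun y hy => (hu' y hy).1]
      ring
    dsimp only at h1
    linarith

end LocalCycles

lemma exists_homotopy {ι : Type*} [Fintype ι] [DecidableEq ι] (M : Matrix ι ι ℝ) (hM : M * M = 0)
    (hex : ∀ w, M.mulVec w = 0 → ∃ w', M.mulVec w' = w) : ∃ H, M * H + H * M = 1 := by
  set E := Matrix.toLin' M with hE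
  have hEE : ∀ x, E (E x) = 0 := fun x => by simp [hE, hM]
  obtain ⟨s, hs⟩ := E.rangeRestrict.exists_rightInverse_of_surjective E.range_rangeRestrict
  have hs' : ∀ y, E (s y) = y := fun y => congrArg Subtype.val (LinearMap.congr_fun hs y)
  set q : (ι → ℝ) →ₗ[ℝ] LinearMap.range E :=
    LinearMap.codRestrict _ (LinearMap.id - s ∘ₗ E.rangeRestrict) (by
      intro x
      obtain ⟨w', hw'⟩ := hex (x - s (E.rangeRestrict x)) (by
        change E (x - s (E.rangeRestrict x)) = 0
        rw [map_sub, hs']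
        simp)
      exact ⟨w', hw'⟩) with hq
  have hq' : ∀ x, (q x : ι → ℝ) = x - s (E.rangeRestrict x) := fun x => rfl
  have key : E ∘ₗ (s ∘ₗ q) + (s ∘ₗ q) ∘ₗ E = LinearMap.id := by
    refine LinearMap.ext fun x => ?_
    have h1 : q (E x) = E.rangeRestrict x := by
      apply Subtype.ext
      have : E.rangeRestrict (E x) = 0 := Subtype.ext (hEE x)
      rw [hq', this, map_zero, sub_zero]
      rfl
    simp only [LinearMap.add_apply, LinearMap.comp_apply, LinearMap.id_apply, hs', hq', h1]
    exact sub_add_cancel _ _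
  refine ⟨LinearMap.toMatrix' (s ∘ₗ q), ?_⟩
  apply Matrix.toLin'.injective
  rw [map_add, Matrix.toLin'_mul, Matrix.toLin'_mul, Matrix.toLin'_toMatrix', Matrix.toLin'_one]
  exact key

namespace LocalCycles

variable {L : Type u} [Fintype L] [PartialOrder L] {ρ : L → ℕ} {r₀ : ℕ} (Z : LocalCycles ρ r₀)

/-- The incidence function obtained from compatible fundamental cycles. -/
def incidence : Incidence ρ where
  ε := Z.ε
  supp := Z.ε_supp
  sq := Z.ε_sq
  homotopy := by
    intro η ζ hη
    let I := {x : L // η ≤ x ∧ x ≤ ζ}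
    have hsum : ∀ f : L → ℝ, (∀ x, f x ≠ 0 → η ≤ x ∧ x ≤ ζ) → ∑ x, f x = ∑ x : I, f x := by
      intro f hf
      rw [← Finset.sum_filter_of_ne fun x _ => hf x]
      exact Finset.sum_subtype _ (fun x => by simp) f
    let M : Matrix I I ℝ := fun a b => Z.ε a b
    obtain ⟨H, hH⟩ := exists_homotopy M (by
      ext a b
      rw [Matrix.mul_apply, Matrix.zero_apply, ← Z.ε_sq a b, hsum]
      intro x hx
      exact ⟨a.2.1.trans (Z.ε_supp (left_ne_zero_of_mul hx)).1.le,
        (Z.ε_supp (right_ne_zero_of_mul hx)).1.le.trans b.2.2⟩) (by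
      intro w hw
      let e : (I → ℝ) → L → ℝ := fun w x => if h : η ≤ x ∧ x ≤ ζ then w ⟨x, h⟩ else 0
      have he : ∀ (w : I → ℝ) x, e w x ≠ 0 → η ≤ x ∧ x ≤ ζ := fun w x h => by
        by_contra h1; exact h (dif_neg h1)
      obtain ⟨w', h1, h2⟩ := Z.exists_bd_eq hη (he w) (fun θ h1 h2 => by
        have := congrFun hw ⟨θ, h1, h2⟩
        rw [bd, hsum _ fun x hx => he w x (right_ne_zero_of_mul hx)]
        refine Eq.trans ?_ this
        refine Finset.sum_congr rfl fun x _ => ?_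
        simp only [e, dif_pos x.2]
        rfl)
      refine ⟨fun x => w' x, funext fun x => ?_⟩
      have := h2 x x.2.1
      rw [bd, hsum _ fun x hx => h1 x (right_ne_zero_of_mul hx)] at this
      refine Eq.trans this ?_
      exact dif_pos x.2)
    refine ⟨fun a b => if h : (η ≤ a ∧ a ≤ ζ) ∧ η ≤ b ∧ b ≤ ζ then H ⟨a, h.1⟩ ⟨b, h.2⟩ else 0,
      fun a b h => by_contra fun h1 => h (dif_neg h1), fun a b ha ha' hb hb' => ?_⟩
    have h1 := congrFun (congrFun hH ⟨a, ha, ha'⟩) ⟨b, hb, hb'⟩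
    rw [Matrix.add_apply, Matrix.mul_apply, Matrix.mul_apply, ← Finset.sum_add_distrib,
      Matrix.one_apply] at h1
    rw [hsum]
    · refine Eq.trans (Finset.sum_congr rfl fun x _ => ?_) (h1.trans ?_)
      · dsimp only
        rw [dif_pos ⟨x.2, hb, hb'⟩, dif_pos ⟨⟨ha, ha'⟩, x.2⟩]
      · simp
    · intro x hx
      by_contra h2
      dsimp only at hx
      rw [dif_neg (by tauto), dif_neg (by tauto)] at hx
      simp at hx

end LocalCycles

/-- The order complex of `L` without its maximal element is a homology sphere. -/
structure Sphere {L : Type u} [Fintype L] [PartialOrder L] [BoundedOrder L] (ρ : L → ℕ) : Prop where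
  strictMono : StrictMono ρ
  covBy : ∀ a b, a ⋖ b → ρ b = ρ a + 1
  bot_lt_top : (⊥ : L) < ⊤
  exact : ∀ {x : Finset L}, IsChain (· < ·) (x : Set L) → ⊥ ∈ x → (∀ σ ∈ x, σ < ⊤) →
    ∀ k, k + ρ ⊥ ≠ ρ ⊤ → ∀ u, SuppIn x (· < ⊤) u → (∀ y, u y ≠ 0 → y.card = k) →
    (∀ s, x ⊆ s → dl u s = 0) → ∃ u', SuppIn x (· < ⊤) u' ∧ (∀ y, u' y ≠ 0 → y.card = k + 1) ∧
      ∀ s, x ⊆ s → u s = dl u' s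
  top : ∀ {x : Finset L}, IsChain (· < ·) (x : Set L) → ⊥ ∈ x → (∀ σ ∈ x, σ < ⊤) →
    ∃ z : Finset L → ℝ, (∃ y, z y ≠ 0) ∧ SuppIn x (· < ⊤) z ∧
      (∀ y, z y ≠ 0 → y.card + ρ ⊥ = ρ ⊤) ∧ (∀ s, x ⊆ s → dl z s = 0) ∧
      ∀ u, SuppIn x (· < ⊤) u → (∀ y, u y ≠ 0 → y.card + ρ ⊥ = ρ ⊤) →
        (∀ s, x ⊆ s → dl u s = 0) → ∃ c : ℝ, ∀ y, u y = c * z y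

namespace Sphere

variable {L : Type u} [Fintype L] [PartialOrder L] [BoundedOrder L] {ρ : L → ℕ} (S : Sphere ρ)

lemma exists_between (S : Sphere ρ) {a b : L} (h : a < b) (hρ : ρ b ≠ ρ a + 1) :
    ∃ c, a < c ∧ c < b := by
  by_contra! h1
  exact hρ (S.covBy a b ⟨h, fun c h2 h3 => h1 c h2 h3⟩)

lemma card_le (S : Sphere ρ) {a b : L} (hab : a ≤ b) {y : Finset L}
    (hy : IsChain (· < ·) (y : Set L)) (h : ∀ σ ∈ y, a ≤ σ ∧ σ < b) : y.card + ρ a ≤ ρ b :=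
  card_add_le_of_isChain S.strictMono hy (fun σ hσ =>
    ⟨S.strictMono.monotone (h σ hσ).1, S.strictMono (h σ hσ).2⟩) (S.strictMono.monotone hab)

lemma exists_insert (S : Sphere ρ) {a b : L} {y : Finset L} (hy : IsChain (· < ·) (y : Set L))
    (ha : a ∈ y) (h : ∀ σ ∈ y, a ≤ σ ∧ σ < b) (hc : y.card + ρ a < ρ b) :
    ∃ c, c ∉ y ∧ a ≤ c ∧ c < b ∧ IsChain (· < ·) ((insert c y : Finset L) : Set L) := by
  obtain ⟨r, hr, hry⟩ : ∃ r ∈ Finset.Ico (ρ a) (ρ b), r ∉ y.image ρ := by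
    by_contra! h1
    have := Finset.card_le_card h1
    rw [Nat.card_Ico] at this
    have := Finset.card_image_le (s := y) (f := ρ)
    omega
  rw [Finset.mem_Ico] at hr
  have hry' : ∀ σ ∈ y, ρ σ ≠ r := fun σ hσ e => hry (Finset.mem_image.2 ⟨σ, hσ, e⟩)
  have hab : a < b := (h a ha).2
  obtain ⟨p, hp, hpmax⟩ := (y.filter fun σ => ρ σ < r).exists_max_image ρ
    ⟨a, Finset.mem_filter.2 ⟨ha, lt_of_le_of_ne hr.1 (hry' a ha)⟩⟩
  rw [Finset.mem_filter] at hp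
  obtain ⟨q, hq, hqmin⟩ := ((insert b y).filter fun σ => r < ρ σ).exists_min_image ρ
    ⟨b, Finset.mem_filter.2 ⟨Finset.mem_insert_self _ _, hr.2⟩⟩
  rw [Finset.mem_filter] at hq
  have hchain : IsChain (· < ·) ((insert b y : Finset L) : Set L) := by
    rw [Finset.coe_insert]
    exact hy.insert fun σ hσ _ => Or.inr (h σ hσ).2
  have hcmp : ∀ σ ∈ insert b y, ∀ τ ∈ insert b y, ρ σ ≤ ρ τ → σ ≤ τ := by
    intro σ hσ τ hτ hle
    by_cases e : σ = τ
    · exact e.le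
    rcases hchain hσ hτ e with h1 | h1
    · exact h1.le
    · exact absurd (S.strictMono h1) hle.not_gt
  have hpi := Finset.mem_insert_of_mem (b := b) hp.1
  have hpq : p < q := lt_of_le_of_ne (hcmp p hpi q hq.1 (by omega)) (by rintro rfl; omega)
  obtain ⟨c, hc1, hc2⟩ := S.exists_between hpq (by omega)
  have hlow : ∀ σ ∈ y, ρ σ < r → σ < c := fun σ hσ hlt =>
    (hcmp σ (Finset.mem_insert_of_mem hσ) p hpi
      (hpmax σ (Finset.mem_filter.2 ⟨hσ, hlt⟩))).trans_lt hc1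
  have hhigh : ∀ σ ∈ insert b y, r < ρ σ → c < σ := fun σ hσ hlt =>
    hc2.trans_le (hcmp q hq.1 σ hσ (hqmin σ (Finset.mem_filter.2 ⟨hσ, hlt⟩)))
  have hcomp : ∀ σ ∈ y, σ < c ∨ c < σ := by
    intro σ hσ
    rcases lt_or_gt_of_ne (hry' σ hσ) with h1 | h1
    · exact Or.inl (hlow σ hσ h1)
    · exact Or.inr (hhigh σ (Finset.mem_insert_of_mem hσ) h1)
  refine ⟨c, fun hcy => ?_, (h p hp.1).1.trans hc1.le, hhigh b (Finset.mem_insert_self _ _) hr.2, ?_⟩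
  · rcases hcomp c hcy with h1 | h1 <;> exact lt_irrefl _ h1
  · rw [Finset.coe_insert]
    exact hy.insert fun σ hσ _ => (hcomp σ hσ).symm

lemma exists_flag (S : Sphere ρ) {a b : L} {y : Finset L} (hy : IsChain (· < ·) (y : Set L))
    (ha : a ∈ y) (h : ∀ σ ∈ y, a ≤ σ ∧ σ < b) :
    ∃ y', y ⊆ y' ∧ IsChain (· < ·) (y' : Set L) ∧ (∀ σ ∈ y', a ≤ σ ∧ σ < b) ∧
      y'.card + ρ a = ρ b := by
  obtain ⟨y', hy', hmax⟩ := (Finset.univ.filter fun y' : Finset L => y ⊆ y' ∧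
    IsChain (· < ·) (y' : Set L) ∧ ∀ σ ∈ y', a ≤ σ ∧ σ < b).exists_max_image Finset.card
      ⟨y, by simpa using ⟨hy, h⟩⟩
  simp only [Finset.mem_filter, Finset.mem_univ, true_and] at hy' hmax
  refine ⟨y', hy'.1, hy'.2.1, hy'.2.2, ?_⟩
  by_contra hne
  have h1 := S.card_le (h a ha).2.le hy'.2.1 hy'.2.2
  obtain ⟨c, hc, hac, hcb, hch⟩ := S.exists_insert hy'.2.1 (hy'.1 ha) hy'.2.2 (by omega)
  have h2 := hmax (insert c y') ⟨hy'.1.trans (Finset.subset_insert _ _), hch, fun σ hσ => by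
    rcases Finset.mem_insert.1 hσ with rfl | hσ
    · exact ⟨hac, hcb⟩
    · exact hy'.2.2 σ hσ⟩
  rw [Finset.card_insert_of_notMem hc] at h2
  omega

lemma exists_sat (S : Sphere ρ) (a b : L) : ∃ C : Finset L, a ≤ b → IsChain (· < ·) (C : Set L) ∧
    (∀ σ ∈ C, a ≤ σ ∧ σ < b) ∧ C.card + ρ a = ρ b ∧ (a < b → a ∈ C) := by
  by_cases h : a < b
  · obtain ⟨y, h1, h2, h3, h4⟩ := S.exists_flag (a := a) (b := b) (y := {a})
      (by simp) (by simp) (by simpa using h)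
    exact ⟨y, fun _ => ⟨h2, h3, h4, fun _ => h1 (Finset.mem_singleton_self a)⟩⟩
  · refine ⟨∅, fun h1 => ?_⟩
    have e : a = b := h1.eq_of_not_lt h
    subst e
    simp

/-- A saturated chain of the half-open interval from `a` to `b`. -/
def sat (a b : L) : Finset L := (S.exists_sat a b).choose

lemma isChain_sat {a b : L} (h : a ≤ b) : IsChain (· < ·) (S.sat a b : Set L) :=
  ((S.exists_sat a b).choose_spec h).1

lemma of_mem_sat {a b : L} (h : a ≤ b) {σ : L} (hσ : σ ∈ S.sat a b) : a ≤ σ ∧ σ < b :=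
  ((S.exists_sat a b).choose_spec h).2.1 σ hσ

lemma card_sat {a b : L} (h : a ≤ b) : (S.sat a b).card + ρ a = ρ b :=
  ((S.exists_sat a b).choose_spec h).2.2.1

lemma mem_sat {a b : L} (h : a < b) : a ∈ S.sat a b :=
  ((S.exists_sat a b).choose_spec h.le).2.2.2 h

lemma bot_mem_of_card (S : Sphere ρ) {b : L} {y : Finset L} (hy : IsChain (· < ·) (y : Set L))
    (h : ∀ σ ∈ y, σ < b) (hb : ⊥ < b) (hc : y.card + ρ ⊥ = ρ b) : ⊥ ∈ y := by
  by_contra hn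
  have h1 := S.card_le (a := ⊥) (b := b) bot_le (y := insert ⊥ y) (by
    rw [Finset.coe_insert]
    exact hy.insert fun σ _ h => Or.inl (bot_lt_iff_ne_bot.2 h.symm)) (fun σ hσ => by
      rcases Finset.mem_insert.1 hσ with rfl | hσ
      · exact ⟨le_rfl, hb⟩
      · exact ⟨bot_le, h σ hσ⟩)
  rw [Finset.card_insert_of_notMem hn] at h1
  omega

/-- The fundamental cycle. -/
def z : Finset L → ℝ :=
  (S.top (x := {⊥}) (by simp) (by simp) (by simpa using S.bot_lt_top)).choose

lemma z_spec : (∃ y, S.z y ≠ 0) ∧ SuppIn {⊥} (· < ⊤) S.z ∧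
    (∀ y, S.z y ≠ 0 → y.card + ρ ⊥ = ρ ⊤) ∧ (∀ s, {⊥} ⊆ s → dl S.z s = 0) :=
  let h := (S.top (x := {⊥}) (by simp) (by simp) (by simpa using S.bot_lt_top)).choose_spec
  ⟨h.1, h.2.1, h.2.2.1, h.2.2.2.1⟩

lemma dl_z {s : Finset L} (h : ⊥ ∈ s) : dl S.z s = 0 :=
  S.z_spec.2.2.2 s (Finset.singleton_subset_iff.2 h)

/-- The restriction of a chain function to the star of a chain. -/
def star (x : Finset L) (u : Finset L → ℝ) (y : Finset L) : ℝ := if x ⊆ y then u y else 0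

lemma dl_star {x s : Finset L} (h : x ⊆ s) (u : Finset L → ℝ) : dl (star x u) s = dl u s :=
  dl_congr fun _ _ => if_pos (h.trans (Finset.subset_insert _ _))

lemma suppIn_star_z (x : Finset L) : SuppIn x (· < ⊤) (star x S.z) := by
  intro y hy
  rw [star] at hy
  split_ifs at hy with h
  · have h1 := S.z_spec.2.1 y hy
    exact ⟨h1.1, h, h1.2.2⟩
  · exact absurd rfl hy

lemma star_z_card {x y : Finset L} (hy : star x S.z y ≠ 0) : y.card + ρ ⊥ = ρ ⊤ := by
  rw [star] at hy
  split_ifs at hy with h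
  · exact S.z_spec.2.2.1 y hy
  · exact absurd rfl hy

lemma z_ne_zero_of_star (k : ℕ) : ∀ {x : Finset L}, x.card + k + ρ ⊥ = ρ ⊤ →
    IsChain (· < ·) (x : Set L) → ⊥ ∈ x → (∀ σ ∈ x, σ < ⊤) →
    (∃ y, x ⊆ y ∧ S.z y ≠ 0) → ∀ y, x ⊆ y → IsChain (· < ·) (y : Set L) → (∀ σ ∈ y, σ < ⊤) →
    y.card + ρ ⊥ = ρ ⊤ → S.z y ≠ 0 := by
  induction k with
  | zero =>
    rintro x hx - - - ⟨y, hxy, hy⟩ y' hxy' - - hc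
    have h1 := S.z_spec.2.2.1 y hy
    rwa [← Finset.eq_of_subset_of_card_le hxy' (by omega),
      Finset.eq_of_subset_of_card_le hxy (by omega)]
  | succ k ih =>
    rintro x hx hxc hbx hxt ⟨y₀, hxy₀, hy₀⟩ y₁ hxy₁ hy₁c hy₁t hy₁card hy₁
    have hy₀s := S.z_spec.2.1 y₀ hy₀
    have hy₀card := S.z_spec.2.2.1 y₀ hy₀
    obtain ⟨α, hα⟩ : (y₀ \ x).Nonempty := by
      rw [← Finset.card_pos, Finset.card_sdiff_of_subset hxy₀]; omega
    obtain ⟨β, hβ⟩ : (y₁ \ x).Nonempty := by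
      rw [← Finset.card_pos, Finset.card_sdiff_of_subset hxy₁]; omega
    rw [Finset.mem_sdiff] at hα hβ
    let A : L → Prop := fun σ => ∃ y, insert σ x ⊆ y ∧ S.z y ≠ 0
    have hA : ∀ σ, A σ → σ ∉ x → ∀ y, insert σ x ⊆ y → IsChain (· < ·) (y : Set L) →
        (∀ σ ∈ y, σ < ⊤) → y.card + ρ ⊥ = ρ ⊤ → S.z y ≠ 0 := by
      rintro σ ⟨y, h1, h2⟩ hσ
      have h3 := S.z_spec.2.1 y h2
      exact ih (by rw [Finset.card_insert_of_notMem hσ]; omega)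
        (h3.1.mono (by exact_mod_cast h1)) (Finset.mem_insert_of_mem hbx)
        (fun τ hτ => h3.2.2 τ (h1 hτ)) ⟨y, h1, h2⟩
    have hAα : A α := ⟨y₀, Finset.insert_subset hα.1 hxy₀, hy₀⟩
    have hAβ : ¬ A β := fun h => hA β h hβ.2 y₁ (Finset.insert_subset hβ.1 hxy₁) hy₁c hy₁t hy₁card hy₁
    have hαβ : α ≠ β := fun e => hAβ (e ▸ hAα)
    have hins : ∀ σ τ, σ ∉ x → (insert σ x = insert τ x ↔ σ = τ) := by
      refine fun σ τ hσ => ⟨fun h => ?_, fun h => by rw [h]⟩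
      have := h ▸ Finset.mem_insert_self σ x
      exact (Finset.mem_insert.1 this).resolve_right hσ
    set u : Finset L → ℝ := fun y => (if y = insert α x then sg x α else 0) -
      (if y = insert β x then sg x β else 0) with hu
    have huα : u (insert α x) = sg x α := by
      simp only [hu, if_true]
      rw [if_neg ((hins α β hα.2).not.2 hαβ), sub_zero]
    have huβ : u (insert β x) = - sg x β := by
      simp only [hu, if_true]
      rw [if_neg ((hins β α hβ.2).not.2 hαβ.symm), zero_sub]
    have hu0 : ∀ y, u y ≠ 0 → y = insert α x ∨ y = insert β x := by
      intro y hy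
      by_contra! h
      simp only [hu] at hy
      rw [if_neg h.1, if_neg h.2, sub_zero] at hy
      exact hy rfl
    have hus : SuppIn x (· < ⊤) u := by
      intro y hy
      rcases hu0 y hy with rfl | rfl
      · have h1 := Finset.insert_subset hα.1 hxy₀
        exact ⟨hy₀s.1.mono (by exact_mod_cast h1), Finset.subset_insert _ _,
          fun σ hσ => hy₀s.2.2 σ (h1 hσ)⟩
      · have h1 := Finset.insert_subset hβ.1 hxy₁
        exact ⟨hy₁c.mono (by exact_mod_cast h1), Finset.subset_insert _ _,
          fun σ hσ => hy₁t σ (h1 hσ)⟩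
    have hucard : ∀ y, u y ≠ 0 → y.card = x.card + 1 := by
      intro y hy
      rcases hu0 y hy with rfl | rfl
      · exact Finset.card_insert_of_notMem hα.2
      · exact Finset.card_insert_of_notMem hβ.2
    have hucyc : ∀ s, x ⊆ s → dl u s = 0 := by
      intro s hs
      by_cases e : s = x
      · subst e
        rw [dl, Finset.sum_eq_add α β hαβ]
        · rw [if_neg hα.2, if_neg hβ.2, huα, huβ, mul_neg, sg_mul_self, sg_mul_self]
          norm_num
        · rintro σ - ⟨h1, h2⟩
          split_ifs with h3
          · rfl
          · refine mul_eq_zero_of_right _ (by_contra fun h4 => ?_)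
            rcases hu0 _ h4 with h5 | h5
            · exact h1 ((hins σ α h3).1 h5)
            · exact h2 ((hins σ β h3).1 h5)
        · simp
        · simp
      · by_contra h
        obtain ⟨σ, hσ, h1⟩ := dl_ne_zero h
        have h2 := hucard _ h1
        rw [Finset.card_insert_of_notMem hσ] at h2
        exact e (Finset.eq_of_subset_of_card_le hs (by omega)).symm
    by_cases hk : k = 0
    · subst hk
      obtain ⟨ζ, -, -, -, -, h4⟩ := S.top hxc hbx hxt
      obtain ⟨c₁, hc₁⟩ := h4 u hus (fun y hy => by rw [hucard y hy]; omega) hucyc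
      obtain ⟨c₂, hc₂⟩ := h4 (star x S.z) (S.suppIn_star_z x) (fun y hy => S.star_z_card hy)
        (fun s hs => by rw [dl_star hs]; exact S.dl_z (hs hbx))
      have e₁ : y₁ = insert β x :=
        (Finset.eq_of_subset_of_card_le (Finset.insert_subset hβ.1 hxy₁)
          (by rw [Finset.card_insert_of_notMem hβ.2]; omega)).symm
      have e₀ : y₀ = insert α x :=
        (Finset.eq_of_subset_of_card_le (Finset.insert_subset hα.1 hxy₀)
          (by rw [Finset.card_insert_of_notMem hα.2]; omega)).symm
      have h5 := hc₂ y₁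
      have h6 := hc₂ y₀
      rw [star, if_pos hxy₁, hy₁] at h5
      rw [star, if_pos hxy₀] at h6
      have h7 := hc₁ y₁
      rw [e₁, huβ, ← e₁] at h7
      rcases mul_eq_zero.1 h5.symm with h8 | h8
      · rw [h8, zero_mul] at h6; exact hy₀ h6
      · rw [h8, mul_zero, neg_eq_zero] at h7; exact sg_ne_zero _ _ h7
    · obtain ⟨u', hu's, hu'card, hu'⟩ := S.exact hxc hbx hxt (x.card + 1) (by omega) u hus hucard hucyc
      have hAA : ∀ y, u' y ≠ 0 → ∀ σ ∈ y, ∀ τ ∈ y, σ ∉ x → τ ∉ x → A σ → A τ := by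
        intro y hy σ hσ τ hτ hσx hτx h
        have h1 := hu's y hy
        obtain ⟨y', h2, h3, h4, h5⟩ := S.exists_flag (a := ⊥) (b := ⊤) h1.1 (h1.2.1 hbx)
          fun σ hσ => ⟨bot_le, h1.2.2 σ hσ⟩
        exact ⟨y', Finset.insert_subset (h2 hτ) (h1.2.1.trans h2),
          hA σ h hσx y' (Finset.insert_subset (h2 hσ) (h1.2.1.trans h2)) h3
            (fun σ hσ => (h4 σ hσ).2) h5⟩
      set v : Finset L → ℝ := fun y => if ∃ σ ∈ y, σ ∉ x ∧ A σ then u' y else 0 with hv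
      have hvc : ∀ y, v y ≠ 0 → IsChain (· < ·) (y : Set L) := by
        intro y hy
        simp only [hv] at hy
        split_ifs at hy with h
        · exact (hu's y hy).1
        · exact absurd rfl hy
      have hdv : ∀ σ, σ ∉ x → dl v (insert σ x) = if σ = α then sg x α else 0 := by
        intro σ hσ
        have h1 : dl v (insert σ x) = if A σ then dl u' (insert σ x) else 0 := by
          split_ifs with h
          · exact dl_congr fun τ _ => if_pos ⟨σ, by simp, hσ, h⟩
          · by_contra h1
            obtain ⟨τ, hτ, h2⟩ := dl_ne_zero h1
            simp only [hv] at h2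
            split_ifs at h2 with h3
            · obtain ⟨τ', h4, h5, h6⟩ := h3
              exact h (hAA _ h2 τ' h4 σ (by simp) h5 hσ h6)
            · exact h2 rfl
        rw [h1, ← hu' _ (Finset.subset_insert _ _)]
        by_cases e : σ = α
        · subst e
          rw [if_pos hAα, if_pos rfl, huα]
        · rw [if_neg e]
          split_ifs with h
          · by_contra h2
            rcases hu0 _ h2 with h3 | h3
            · exact e ((hins σ α hσ).1 h3)
            · exact hAβ ((hins σ β hσ).1 h3 ▸ h)
          · rfl
      have h1 := dl_dl hvc x
      rw [dl, Finset.sum_eq_single α] at h1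
      · rw [if_neg hα.2, hdv α hα.2, if_pos rfl, sg_mul_self] at h1
        exact one_ne_zero h1
      · intro σ _ hσ
        split_ifs with h
        · rfl
        · rw [hdv σ h, if_neg hσ, mul_zero]
      · simp

lemma z_ne_zero {y : Finset L} (hy : IsChain (· < ·) (y : Set L)) (ht : ∀ σ ∈ y, σ < ⊤)
    (hc : y.card + ρ ⊥ = ρ ⊤) : S.z y ≠ 0 := by
  have h1 := S.strictMono S.bot_lt_top
  obtain ⟨y₀, hy₀⟩ := S.z_spec.1
  exact S.z_ne_zero_of_star (ρ ⊤ - ρ ⊥ - 1) (x := {⊥})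
    (by rw [Finset.card_singleton]; omega) (by simp) (by simp)
    (by simpa using S.bot_lt_top) ⟨y₀, (S.z_spec.2.1 y₀ hy₀).2.1, hy₀⟩ y
    (Finset.singleton_subset_iff.2 (S.bot_mem_of_card hy ht S.bot_lt_top hc)) hy ht hc

lemma exists_smul_z_add_dl {x : Finset L} (hx : IsChain (· < ·) (x : Set L)) (hbx : ⊥ ∈ x)
    (hxt : ∀ σ ∈ x, σ < ⊤) {u : Finset L → ℝ} (hu : SuppIn x (· < ⊤) u)
    (hcyc : ∀ s, x ⊆ s → dl u s = 0) :
    ∃ c u', SuppIn x (· < ⊤) u' ∧ ∀ s, x ⊆ s → u s = c * S.z s + dl u' s := by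
  let v : ℕ → Finset L → ℝ := fun k y => if y.card = k then u y else 0
  have hv : ∀ k y, v k y ≠ 0 → y.card = k ∧ u y ≠ 0 := by
    intro k y h
    simp only [v] at h
    split_ifs at h with h1
    · exact ⟨h1, h⟩
    · exact absurd rfl h
  have hvs : ∀ k, SuppIn x (· < ⊤) (v k) := fun k y hy => hu y (hv k y hy).2
  have hvcyc : ∀ k s, x ⊆ s → dl (v k) s = 0 := by
    intro k s hs
    by_cases h : s.card + 1 = k
    · rw [← hcyc s hs]
      exact dl_congr fun σ hσ => if_pos (by rw [Finset.card_insert_of_notMem hσ, h])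
    · by_contra h1
      obtain ⟨σ, hσ, h2⟩ := dl_ne_zero h1
      have := (hv _ _ h2).1
      rw [Finset.card_insert_of_notMem hσ] at this
      exact h this
  have h1 : ∀ k, ∃ u', k + ρ ⊥ ≠ ρ ⊤ → SuppIn x (· < ⊤) u' ∧
      (∀ y, u' y ≠ 0 → y.card = k + 1) ∧ ∀ s, x ⊆ s → v k s = dl u' s := by
    intro k
    by_cases h : k + ρ ⊥ = ρ ⊤
    · exact ⟨fun _ => 0, fun h1 => absurd h h1⟩
    · obtain ⟨u', h'⟩ := S.exact hx hbx hxt k h (v k) (hvs k) (fun y hy => (hv k y hy).1) (hvcyc k)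
      exact ⟨u', fun _ => h'⟩
  choose u' hu' using h1
  obtain ⟨ζ, -, -, -, -, h4⟩ := S.top hx hbx hxt
  have hlt := S.strictMono S.bot_lt_top
  obtain ⟨c₁, hc₁⟩ := h4 (v (ρ ⊤ - ρ ⊥)) (hvs _) (fun y hy => by rw [(hv _ y hy).1]; omega)
    (hvcyc _)
  obtain ⟨c₂, hc₂⟩ := h4 (star x S.z) (S.suppIn_star_z x) (fun y hy => S.star_z_card hy)
    (fun s hs => by rw [dl_star hs]; exact S.dl_z (hs hbx))
  have hc₂0 : c₂ ≠ 0 := by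
    rintro rfl
    obtain ⟨y, h5, h6, h7, h8⟩ := S.exists_flag (a := ⊥) (b := ⊤) hx hbx
      fun σ hσ => ⟨bot_le, hxt σ hσ⟩
    have h9 := hc₂ y
    rw [star, if_pos h5, zero_mul] at h9
    exact S.z_ne_zero h6 (fun σ hσ => (h7 σ hσ).2) h8 h9
  refine ⟨c₁ / c₂, fun y => if y.card - 1 + ρ ⊥ = ρ ⊤ then 0 else u' (y.card - 1) y,
    fun y hy => ?_, fun s hs => ?_⟩
  · dsimp only at hy
    split_ifs at hy with h
    · exact absurd rfl hy
    · exact (hu' _ h).1 y hy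
  · by_cases h : s.card + ρ ⊥ = ρ ⊤
    · have h5 : v (ρ ⊤ - ρ ⊥) s = u s := if_pos (by omega)
      have h6 := hc₂ s
      rw [star, if_pos hs] at h6
      have h7 : dl (fun y => if y.card - 1 + ρ ⊥ = ρ ⊤ then 0 else u' (y.card - 1) y) s = 0 := by
        by_contra h7
        obtain ⟨σ, hσ, h8⟩ := dl_ne_zero h7
        rw [Finset.card_insert_of_notMem hσ] at h8
        exact h8 (if_pos h)
      rw [h7, ← h5, hc₁, h6]
      field_simp
      ring
    · have h5 : v s.card s = u s := if_pos rfl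
      have h6 : S.z s = 0 := by_contra fun h6 => h (S.z_spec.2.2.1 s h6)
      rw [h6, mul_zero, zero_add, ← h5, (hu' _ h).2.2 s hs]
      refine dl_congr fun σ hσ => ?_
      rw [Finset.card_insert_of_notMem hσ]
      exact (if_neg h).symm

end Sphere

lemma sg_union_of_not_lt {P : Type*} [Fintype P] [PartialOrder P] {s U : Finset P} {σ : P}
    (h : ∀ τ ∈ U, ¬ τ < σ) : sg (s ∪ U) σ = sg s σ := by
  rw [sg, sg, Finset.filter_union, Finset.filter_false_of_mem h, Finset.union_empty]

namespace Sphere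

variable {L : Type u} [Fintype L] [PartialOrder L] [BoundedOrder L] {ρ : L → ℕ} (S : Sphere ρ)

lemma lt_of_notMem_sat {ξ σ : L} {y : Finset L} (hy : IsChain (· < ·) (y : Set L))
    (ht : ∀ σ ∈ y, σ < ⊤) (hU : S.sat ξ ⊤ ⊆ y) (hσ : σ ∈ y) (h : σ ∉ S.sat ξ ⊤) : σ < ξ := by
  rcases (le_top : ξ ≤ ⊤).eq_or_lt with rfl | hξ
  · exact ht σ hσ
  have h1 := S.mem_sat hξ
  rcases hy hσ (hU h1) (by rintro rfl; exact h h1) with h2 | h2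
  · exact h2
  · exfalso
    have h3 := S.card_le (a := ξ) (b := ⊤) le_top (y := insert σ (S.sat ξ ⊤))
      (hy.mono (by exact_mod_cast Finset.insert_subset hσ hU)) (fun τ hτ => by
        rcases Finset.mem_insert.1 hτ with rfl | hτ
        · exact ⟨h2.le, ht _ hσ⟩
        · exact S.of_mem_sat le_top hτ)
    rw [Finset.card_insert_of_notMem h] at h3
    have := S.card_sat (le_top : ξ ≤ ⊤)
    omega

lemma isChain_union_sat {ξ : L} {y : Finset L} (hy : IsChain (· < ·) (y : Set L))
    (h : ∀ σ ∈ y, σ < ξ) : IsChain (· < ·) ((y ∪ S.sat ξ ⊤ : Finset L) : Set L) := by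
  intro σ hσ τ hτ hne
  rw [Finset.mem_coe, Finset.mem_union] at hσ hτ
  rcases hσ with hσ | hσ <;> rcases hτ with hτ | hτ
  · exact hy hσ hτ hne
  · exact Or.inl ((h σ hσ).trans_le (S.of_mem_sat le_top hτ).1)
  · exact Or.inr ((h τ hτ).trans_le (S.of_mem_sat le_top hσ).1)
  · exact S.isChain_sat le_top hσ hτ hne

lemma lt_top_of_mem_union_sat {ξ : L} {y : Finset L} (h : ∀ σ ∈ y, σ < ξ) :
    ∀ σ ∈ y ∪ S.sat ξ ⊤, σ < ⊤ := by
  intro σ hσ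
  rcases Finset.mem_union.1 hσ with hσ | hσ
  · exact (h σ hσ).trans_le le_top
  · exact (S.of_mem_sat le_top hσ).2

lemma disjoint_sat {ξ : L} {y : Finset L} (h : ∀ σ ∈ y, σ < ξ) : Disjoint y (S.sat ξ ⊤) :=
  Finset.disjoint_left.2 fun σ h1 h2 => absurd (h σ h1) (S.of_mem_sat le_top h2).1.not_gt

lemma card_union_sat {ξ : L} {y : Finset L} (h : ∀ σ ∈ y, σ < ξ) :
    (y ∪ S.sat ξ ⊤).card + ρ ξ = y.card + ρ ⊤ := by
  rw [Finset.card_union_of_disjoint (S.disjoint_sat h)]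
  have := S.card_sat (le_top : ξ ≤ ⊤)
  omega

/-- The link of a saturated upper chain. -/
def res (ξ : L) (u : Finset L → ℝ) (t : Finset L) : ℝ :=
  if ∀ σ ∈ t, σ < ξ then u (t ∪ S.sat ξ ⊤) else 0

/-- The join with a saturated upper chain. -/
def ext (ξ : L) (u : Finset L → ℝ) (y : Finset L) : ℝ :=
  if S.sat ξ ⊤ ⊆ y then u (y \ S.sat ξ ⊤) else 0

lemma dl_res {ξ : L} {u : Finset L → ℝ}
    (hu : ∀ y, u y ≠ 0 → IsChain (· < ·) (y : Set L) ∧ ∀ σ ∈ y, σ < ⊤) {s : Finset L}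
    (hs : ∀ σ ∈ s, σ < ξ) : dl (S.res ξ u) s = dl u (s ∪ S.sat ξ ⊤) := by
  refine Finset.sum_congr rfl fun σ _ => ?_
  by_cases h2 : σ ∈ s
  · simp [h2]
  rw [if_neg h2]
  by_cases h4 : σ < ξ
  · have h3 : ∀ τ ∈ S.sat ξ ⊤, ¬ τ < σ := fun τ hτ =>
      (h4.trans_le (S.of_mem_sat le_top hτ).1).not_gt
    have h5 : σ ∉ S.sat ξ ⊤ := fun h => absurd h4 (S.of_mem_sat le_top h).1.not_gt
    rw [if_neg (by simp [h2, h5]), sg_union_of_not_lt h3, res, if_pos, Finset.insert_union]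
    intro τ hτ
    rcases Finset.mem_insert.1 hτ with rfl | hτ
    · exact h4
    · exact hs τ hτ
  · rw [res, if_neg fun h => h4 (h σ (Finset.mem_insert_self _ _)), mul_zero]
    by_contra h
    split_ifs at h with h5
    · exact h rfl
    · have h6 := hu _ (right_ne_zero_of_mul (Ne.symm h))
      refine h4 (S.lt_of_notMem_sat h6.1 h6.2 (Finset.Subset.trans Finset.subset_union_right
        (Finset.subset_insert _ _)) (Finset.mem_insert_self _ _) fun h7 => h5 ?_)
      exact Finset.mem_union_right _ h7

lemma dl_res_of_not {ξ : L} {u : Finset L → ℝ} {s : Finset L} (hs : ¬ ∀ σ ∈ s, σ < ξ) :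
    dl (S.res ξ u) s = 0 := by
  by_contra h
  obtain ⟨σ, -, h1⟩ := dl_ne_zero h
  exact h1 (if_neg fun h2 => hs fun τ hτ => h2 τ (Finset.mem_insert_of_mem hτ))

lemma dl_ext {ξ : L} {u : Finset L → ℝ} (hu : ∀ y, u y ≠ 0 → ∀ σ ∈ y, σ < ξ) {s : Finset L}
    (hs : S.sat ξ ⊤ ⊆ s) : dl (S.ext ξ u) s = dl u (s \ S.sat ξ ⊤) := by
  refine Finset.sum_congr rfl fun σ _ => ?_
  by_cases h0 : u (insert σ (s \ S.sat ξ ⊤)) = 0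
  · by_cases h1 : σ ∈ s
    · simp [h1, h0]
    · have h2 : σ ∉ S.sat ξ ⊤ := fun h => h1 (hs h)
      rw [ext, Finset.insert_sdiff_of_notMem _ h2]
      simp [h0]
  have h3 := hu _ h0 σ (Finset.mem_insert_self _ _)
  have h2 : σ ∉ S.sat ξ ⊤ := fun h => absurd h3 (S.of_mem_sat le_top h).1.not_gt
  by_cases h1 : σ ∈ s
  · simp [h1, h2]
  · rw [if_neg h1, if_neg (by simp [h1]), ext, Finset.insert_sdiff_of_notMem _ h2,
      if_pos (hs.trans (Finset.subset_insert _ _))]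
    conv_lhs => rw [← Finset.sdiff_union_of_subset hs]
    rw [sg_union_of_not_lt fun τ hτ => (h3.trans_le (S.of_mem_sat le_top hτ).1).not_gt,
      Finset.sdiff_union_of_subset hs]

/-- The chain attached to an element. -/
def fl (η : L) : Finset L := insert η (S.sat ⊥ η)

lemma bot_mem_fl (η : L) : ⊥ ∈ S.fl η := by
  rcases (bot_le : ⊥ ≤ η).eq_or_lt with rfl | h
  · exact Finset.mem_insert_self _ _
  · exact Finset.mem_insert_of_mem (S.mem_sat h)

lemma le_of_mem_fl {η σ : L} (h : σ ∈ S.fl η) : σ ≤ η := by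
  rcases Finset.mem_insert.1 h with rfl | h
  · exact le_rfl
  · exact (S.of_mem_sat bot_le h).2.le

lemma isChain_fl (η : L) : IsChain (· < ·) (S.fl η : Set L) := by
  rw [fl, Finset.coe_insert]
  exact (S.isChain_sat bot_le).insert fun σ hσ _ => Or.inr (S.of_mem_sat bot_le hσ).2

lemma res_z_ne_zero {ξ : L} {y : Finset L} (hy : IsChain (· < ·) (y : Set L))
    (h : ∀ σ ∈ y, σ < ξ) (hc : y.card + ρ ⊥ = ρ ξ) : S.res ξ S.z y ≠ 0 := by
  rw [res, if_pos h]
  refine S.z_ne_zero (S.isChain_union_sat hy h) (S.lt_top_of_mem_union_sat h) ?_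
  have := S.card_union_sat h
  omega

lemma of_res_z_ne_zero {ξ : L} {y : Finset L} (h : S.res ξ S.z y ≠ 0) :
    IsChain (· < ·) (y : Set L) ∧ (∀ σ ∈ y, σ < ξ) ∧ y.card + ρ ⊥ = ρ ξ := by
  rw [res] at h
  split_ifs at h with h1
  · have h2 := S.z_spec.2.1 _ h
    have h3 := S.z_spec.2.2.1 _ h
    have h4 := S.card_union_sat h1
    exact ⟨h2.1.mono (by exact_mod_cast Finset.subset_union_left), h1, by omega⟩
  · exact absurd rfl h

lemma z_supp (y : Finset L) (h : S.z y ≠ 0) : IsChain (· < ·) (y : Set L) ∧ ∀ σ ∈ y, σ < ⊤ :=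
  ⟨(S.z_spec.2.1 y h).1, (S.z_spec.2.1 y h).2.2⟩

lemma dl_res_z {ξ : L} {s : Finset L} (h : ⊥ ∈ s) : dl (S.res ξ S.z) s = 0 := by
  by_cases h1 : ∀ σ ∈ s, σ < ξ
  · rw [S.dl_res S.z_supp h1, S.dl_z (Finset.mem_union_left _ h)]
  · exact S.dl_res_of_not h1

lemma exists_smul_res_add_dl {η ξ : L} (h : η < ξ) {u : Finset L → ℝ}
    (hu : SuppIn (S.fl η) (· < ξ) u) (hcyc : ∀ s, S.fl η ⊆ s → dl u s = 0) :
    ∃ c u', SuppIn (S.fl η) (· < ξ) u' ∧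
      ∀ s, S.fl η ⊆ s → u s = c * S.res ξ S.z s + dl u' s := by
  have hfl : ∀ σ ∈ S.fl η, σ < ξ := fun σ hσ => (S.le_of_mem_fl hσ).trans_lt h
  obtain ⟨c, u', hu', hc⟩ := S.exists_smul_z_add_dl (x := S.fl η ∪ S.sat ξ ⊤)
    (S.isChain_union_sat (S.isChain_fl η) hfl) (Finset.mem_union_left _ (S.bot_mem_fl η))
    (S.lt_top_of_mem_union_sat hfl) (u := S.ext ξ u) (by
      intro y hy
      rw [ext] at hy
      split_ifs at hy with h1
      · have h2 := hu _ hy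
        rw [← Finset.sdiff_union_of_subset h1]
        exact ⟨S.isChain_union_sat h2.1 h2.2.2, Finset.union_subset_union h2.2.1 subset_rfl,
          S.lt_top_of_mem_union_sat h2.2.2⟩
      · exact absurd rfl hy) (by
      intro s hs
      rw [Finset.union_subset_iff] at hs
      rw [S.dl_ext (fun y hy => (hu y hy).2.2) hs.2]
      exact hcyc _ (Finset.subset_sdiff.2 ⟨hs.1, S.disjoint_sat hfl⟩))
  refine ⟨c, S.res ξ u', fun y hy => ?_, fun s hs => ?_⟩
  · rw [res] at hy
    split_ifs at hy with h1
    · have h2 := hu' _ hy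
      refine ⟨h2.1.mono (by exact_mod_cast Finset.subset_union_left), fun σ hσ => ?_, h1⟩
      rcases Finset.mem_union.1 (h2.2.1 (Finset.mem_union_left _ hσ)) with h3 | h3
      · exact h3
      · exact absurd (hfl σ hσ) (S.of_mem_sat le_top h3).1.not_gt
    · exact absurd rfl hy
  · by_cases h1 : ∀ σ ∈ s, σ < ξ
    · have h2 := hc (s ∪ S.sat ξ ⊤) (Finset.union_subset_union hs subset_rfl)
      rw [S.dl_res (fun y hy => ⟨(hu' y hy).1, (hu' y hy).2.2⟩) h1, res, if_pos h1, ← h2, ext,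
        if_pos Finset.subset_union_right, Finset.union_sdiff_cancel_right (S.disjoint_sat h1)]
    · rw [S.dl_res_of_not h1, res, if_neg h1, mul_zero, zero_add]
      exact by_contra fun h2 => h1 (hu s h2).2.2

lemma fl_bot : S.fl ⊥ = {⊥} := by
  ext σ
  rw [Finset.mem_singleton]
  exact ⟨fun h => le_bot_iff.1 (S.le_of_mem_fl h), fun h => by rw [h]; exact S.bot_mem_fl _⟩

lemma exists_res_insert {θ ξ : L} (h : θ < ξ) (hρ : ρ ξ = ρ θ + 1) :
    ∃ c : ℝ, ∀ y, (∀ σ ∈ y, σ < θ) → S.res ξ S.z (insert θ y) = c * S.res θ S.z y := by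
  rcases (bot_le : ⊥ ≤ θ).eq_or_lt with rfl | hθ
  · refine ⟨S.res ξ S.z (insert ⊥ ∅) / S.res ⊥ S.z ∅, fun y hy => ?_⟩
    have e : y = ∅ := Finset.eq_empty_of_forall_notMem fun σ hσ => not_lt_bot (hy σ hσ)
    rw [e, div_mul_cancel₀]
    exact S.res_z_ne_zero (by simp) (by simp) (by simp)
  have hle : ∀ y : Finset L, θ ∈ y → S.res ξ S.z y ≠ 0 → ∀ σ ∈ y, σ ≤ θ := by
    intro y hy h0 σ hσ
    have h1 := S.of_res_z_ne_zero h0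
    by_cases e : σ = θ
    · exact e.le
    rcases h1.1 hσ hy e with h2 | h2
    · exact h2.le
    · have := S.strictMono h2
      have := S.strictMono (h1.2.1 σ hσ)
      omega
  have hbot : ∀ {ξ : L} {y : Finset L}, ⊥ < ξ → S.res ξ S.z y ≠ 0 → ⊥ ∈ y := by
    intro ξ y h1 h2
    have h3 := S.of_res_z_ne_zero h2
    exact S.bot_mem_of_card h3.1 h3.2.1 h1 h3.2.2
  have hg : SuppIn (S.fl ⊥) (· < θ) (LocalCycles.lk θ (S.res ξ S.z)) := by
    intro y hy
    rw [LocalCycles.lk] at hy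
    split_ifs at hy with h1
    · have h2 := S.of_res_z_ne_zero hy
      refine ⟨h2.1.mono (by exact_mod_cast Finset.subset_insert _ _), ?_, h1⟩
      rw [S.fl_bot, Finset.singleton_subset_iff]
      exact (Finset.mem_insert.1 (hbot (hθ.trans h) hy)).resolve_left hθ.ne
    · exact absurd rfl hy
  obtain ⟨c, u', hu', hc⟩ := S.exists_smul_res_add_dl hθ hg (by
    intro s hs
    rw [S.fl_bot, Finset.singleton_subset_iff] at hs
    by_cases h1 : ∀ σ ∈ s, σ < θ
    · rw [LocalCycles.dl_lk (fun y hy h0 => ⟨(S.of_res_z_ne_zero h0).1, hle y hy h0⟩) h1]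
      exact S.dl_res_z (Finset.mem_insert_of_mem hs)
    · by_contra h2
      obtain ⟨σ, -, h3⟩ := dl_ne_zero h2
      exact h1 fun τ hτ => (hg _ h3).2.2 τ (Finset.mem_insert_of_mem hτ))
  refine ⟨c, fun y hy => ?_⟩
  have hθy : θ ∉ y := fun h1 => lt_irrefl _ (hy θ h1)
  by_cases h1 : S.fl ⊥ ⊆ y
  · have h2 := hc y h1
    rw [LocalCycles.lk, if_pos hy] at h2
    by_cases hcard : y.card + ρ ⊥ = ρ θ
    · have h3 : dl u' y = 0 := by
        by_contra h3
        obtain ⟨σ, hσ, h4⟩ := dl_ne_zero h3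
        have h5 := hu' _ h4
        have h6 := S.card_le hθ.le h5.1 fun σ hσ => ⟨bot_le, h5.2.2 σ hσ⟩
        rw [Finset.card_insert_of_notMem hσ] at h6
        omega
      rw [h2, h3, add_zero]
    · have h3 : S.res θ S.z y = 0 := by_contra fun h3 => hcard (S.of_res_z_ne_zero h3).2.2
      rw [h3, mul_zero]
      refine by_contra fun h4 => hcard ?_
      have := (S.of_res_z_ne_zero h4).2.2
      rw [Finset.card_insert_of_notMem hθy] at this
      omega
  · rw [S.fl_bot, Finset.singleton_subset_iff] at h1
    have h3 : S.res θ S.z y = 0 := by_contra fun h3 => h1 (hbot hθ h3)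
    rw [h3, mul_zero]
    refine by_contra fun h4 => h1 ?_
    exact (Finset.mem_insert.1 (hbot (hθ.trans h) h4)).resolve_left hθ.ne

/-- The compatible fundamental cycles of the lower intervals. -/
def localCycles : LocalCycles ρ (ρ ⊥) where
  T ξ := S.res ξ S.z
  k θ ξ := if h : θ < ξ ∧ ρ ξ = ρ θ + 1 then (S.exists_res_insert h.1 h.2).choose else 0
  G θ := S.sat ⊥ θ
  strictMono := S.strictMono
  le_rank x := S.strictMono.monotone bot_le
  supp := S.of_res_z_ne_zero
  cycle {η _ _} h := S.dl_res_z (h (S.bot_mem_fl η))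
  T_insert := by
    intro θ ξ y h hy
    by_cases hρ : ρ ξ = ρ θ + 1
    · rw [dif_pos ⟨h, hρ⟩]
      exact (S.exists_res_insert h hρ).choose_spec y hy
    · rw [dif_neg fun h => hρ h.2, zero_mul]
      by_contra h1
      have h2 := S.of_res_z_ne_zero h1
      rw [Finset.card_insert_of_notMem fun h1 => lt_irrefl _ (hy θ h1)] at h2
      have h3 := S.card_le (bot_le : ⊥ ≤ θ)
        (h2.1.mono (by exact_mod_cast Finset.subset_insert _ _)) fun σ hσ => ⟨bot_le, hy σ hσ⟩
      have := S.strictMono h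
      omega
  k_supp {θ ξ} h := by_contra fun h1 => h (dif_neg h1)
  T_G θ := S.res_z_ne_zero (S.isChain_sat bot_le) (fun σ hσ => (S.of_mem_sat bot_le hσ).2)
    (S.card_sat bot_le)
  exists_ne {η ξ} h := by
    obtain ⟨y, h1, h2, h3, h4⟩ := S.exists_flag (a := ⊥) (b := ξ) (S.isChain_fl η)
      (S.bot_mem_fl η) fun σ hσ => ⟨bot_le, (S.le_of_mem_fl hσ).trans_lt h⟩
    exact ⟨y, h1, S.res_z_ne_zero h2 (fun σ hσ => (h3 σ hσ).2) h4⟩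
  exact h _ hu hcyc := S.exists_smul_res_add_dl h hu hcyc

theorem interval_sub_bool_mem_cone (S : Sphere ρ) (hlat : ∀ x y : L, ∃ z, IsLUB {x, y} z) :
    interval ρ ⊥ ⊤ - bool (ρ ⊤ - ρ ⊥) ∈ cone :=
  interval_sub_bool_mem_cone_of_incidence S.localCycles.incidence S.strictMono S.covBy hlat
    S.bot_lt_top

end Sphere

lemma exists_of_finrank_eq_one {V : Type u} [AddCommGroup V] [Module ℝ V] {W : Submodule ℝ V}
    (h : Module.finrank ℝ W = 1) : ∃ z : W, z ≠ 0 ∧ ∀ w : W, ∃ c : ℝ, c • z = w :=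
  finrank_eq_one_iff'.1 h

section Cell

variable {P : Type u} [Fintype P] [PartialOrder P]

lemma mem_cellSpace {m : P} {x : Finset P} {k : ℕ} {f : Finset P →₀ ℝ} :
    f ∈ cellSpace Set.univ m x k ↔
      ∀ y, f y ≠ 0 → IsChain (· < ·) (y : Set P) ∧ m ∈ y ∧ x ⊆ y ∧ y.card = k := by
  have h : cellSpace Set.univ m x k = Finsupp.supported ℝ ℝ
      {y : Finset P | chainIn Set.univ m y ∧ x ⊆ y ∧ y.card = k} := by
    rw [Finsupp.supported_eq_span_single, cellSpace]
    congr 1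
    ext f
    simp only [Set.mem_ofPred_eq, Set.mem_image]
    exact ⟨fun ⟨y, h1, h2, h3, h4⟩ => ⟨y, ⟨h1, h2, h3⟩, h4.symm⟩,
      fun ⟨y, ⟨h1, h2, h3⟩, h4⟩ => ⟨y, h1, h2, h3, h4.symm⟩⟩
  rw [h, Finsupp.mem_supported]
  refine forall_congr' fun y => ?_
  rw [Finset.mem_coe, Finsupp.mem_support_iff]
  simp only [Set.mem_ofPred_eq, chainIn, Set.subset_univ, true_and]
  tauto

lemma bnd_apply (x : Finset P) (f : Finset P →₀ ℝ) (s : Finset P) :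
    bnd x f s = ∑ σ, if σ ∈ s ∨ σ ∈ x then 0 else sg s σ * f (insert σ s) := by
  have h1 : bnd x f s = ∑ y, ∑ σ, if σ ∈ y ∧ σ ∉ x ∧ y.erase σ = s then sg y σ * f y else 0 := by
    rw [bnd, Finsupp.lsum_apply, Finsupp.sum_fintype _ _ (by simp), Finsupp.finsetSum_apply]
    refine Finset.sum_congr rfl fun y _ => ?_
    simp only [LinearMap.smulRight_apply, LinearMap.id_apply, Finsupp.smul_apply,
      Finsupp.finsetSum_apply, smul_eq_mul, Finset.mul_sum]
    refine Finset.sum_subset_zero_on_sdiff (Finset.subset_univ _) (fun σ hσ => ?_) fun σ hσ => ?_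
    · refine if_neg fun h => ?_
      simp_all
    · rw [Finset.mem_sdiff] at hσ
      rw [Finsupp.single_apply]
      by_cases h : y.erase σ = s
      · rw [if_pos h, if_pos ⟨hσ.1, hσ.2, h⟩, sg]; ring
      · rw [if_neg h, if_neg fun h1 => h h1.2.2]; ring
  rw [h1, Finset.sum_comm]
  refine Finset.sum_congr rfl fun σ _ => ?_
  by_cases h : σ ∈ s ∨ σ ∈ x
  · rw [if_pos h]
    refine Finset.sum_eq_zero fun y _ => if_neg ?_
    rintro ⟨h2, h3, rfl⟩
    simp_all
  · rw [if_neg h, Finset.sum_eq_single (insert σ s)]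
    · rw [if_pos, sg_insert_of_not_lt (lt_irrefl σ)]
      simp_all
    · intro y _ hy
      refine if_neg ?_
      rintro ⟨h2, h3, rfl⟩
      exact hy (Finset.insert_erase h2).symm
    · simp

lemma bnd_apply_of_subset {x s : Finset P} (h : x ⊆ s) (f : Finset P →₀ ℝ) :
    bnd x f s = dl f s := by
  rw [bnd_apply, dl]
  refine Finset.sum_congr rfl fun σ _ => ?_
  exact if_congr (or_iff_left_of_imp fun h1 => h h1) rfl rfl

lemma bnd_apply_of_not_subset {x s : Finset P} (h : ¬ x ⊆ s) {f : Finset P →₀ ℝ}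
    (hf : ∀ y, f y ≠ 0 → x ⊆ y) : bnd x f s = 0 := by
  rw [bnd_apply]
  refine Finset.sum_eq_zero fun σ _ => ?_
  split_ifs with h1
  · rfl
  · refine mul_eq_zero_of_right _ (by_contra fun h2 => h fun τ hτ => ?_)
    rcases Finset.mem_insert.1 (hf _ h2 hτ) with rfl | h3
    · exact absurd (Or.inr hτ) h1
    · exact h3

lemma bnd_eq_zero_iff {x : Finset P} {f : Finset P →₀ ℝ} (hf : ∀ y, f y ≠ 0 → x ⊆ y) :
    bnd x f = 0 ↔ ∀ s, x ⊆ s → dl f s = 0 := by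
  refine ⟨fun h s hs => by rw [← bnd_apply_of_subset hs, h]; rfl, fun h => ?_⟩
  ext s
  by_cases hs : x ⊆ s
  · rw [bnd_apply_of_subset hs, h s hs]; rfl
  · rw [bnd_apply_of_not_subset hs hf]; rfl

lemma map_bnd_le {m : P} {x : Finset P} (hx : m ∈ x) (k : ℕ) :
    Submodule.map (bnd x) (cellSpace Set.univ m x (k + 1)) ≤
      LinearMap.ker (bnd x) ⊓ cellSpace Set.univ m x k := by
  rintro _ ⟨f, hf, rfl⟩
  rw [SetLike.mem_coe, mem_cellSpace] at hf
  have hb : ∀ y, bnd x f y ≠ 0 → x ⊆ y := fun y h => by_contra fun h1 =>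
    h (bnd_apply_of_not_subset h1 fun y hy => (hf y hy).2.2.1)
  refine ⟨?_, ?_⟩
  · rw [SetLike.mem_coe, LinearMap.mem_ker, bnd_eq_zero_iff hb]
    intro s hs
    rw [← dl_dl (u := f) (fun y hy => (hf y hy).1) s]
    exact dl_congr fun σ _ => bnd_apply_of_subset (hs.trans (Finset.subset_insert _ _)) f
  · rw [SetLike.mem_coe, mem_cellSpace]
    intro y hy
    have h1 := hb y hy
    rw [bnd_apply_of_subset h1] at hy
    obtain ⟨σ, hσ, h2⟩ := dl_ne_zero hy
    have h3 := hf _ h2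
    rw [Finset.card_insert_of_notMem hσ] at h3
    exact ⟨h3.1.mono (by exact_mod_cast Finset.subset_insert _ _), h1 hx, h1, by omega⟩

lemma _root_.GorensteinOn.exists_bnd_eq {m : P} {n : ℕ} (h : GorensteinOn Set.univ m n)
    {x : Finset P} (hx : m ∈ x) (hc : IsChain (· < ·) (x : Set P)) {k : ℕ} (hk : k ≠ n + 1)
    {f : Finset P →₀ ℝ} (hf : f ∈ cellSpace Set.univ m x k) (hb : bnd x f = 0) :
    ∃ g ∈ cellSpace Set.univ m x (k + 1), bnd x g = f := by
  have h1 := h x ⟨hx, Set.subset_univ _, hc⟩ k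
  rw [if_neg hk, add_zero] at h1
  have h2 : f ∈ LinearMap.ker (bnd x) ⊓ cellSpace Set.univ m x k := ⟨hb, hf⟩
  rw [← Submodule.eq_of_le_of_finrank_eq (map_bnd_le hx k) h1.symm] at h2
  exact h2

lemma _root_.GorensteinOn.exists_cycle {m : P} {n : ℕ} (h : GorensteinOn Set.univ m n)
    {x : Finset P} (hx : m ∈ x) (hc : IsChain (· < ·) (x : Set P))
    (hn : ∀ y : Finset P, IsChain (· < ·) (y : Set P) → y.card ≤ n + 1) :
    ∃ z ∈ cellSpace Set.univ m x (n + 1), z ≠ 0 ∧ bnd x z = 0 ∧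
      ∀ f ∈ cellSpace Set.univ m x (n + 1), bnd x f = 0 → ∃ c : ℝ, f = c • z := by
  have h1 := h x ⟨hx, Set.subset_univ _, hc⟩ (n + 1)
  have h2 : cellSpace Set.univ m x (n + 1 + 1) = ⊥ := by
    refine eq_bot_iff.2 fun f hf => ?_
    rw [mem_cellSpace] at hf
    rw [Submodule.mem_bot]
    ext y
    by_contra h3
    have h4 := hf y h3
    have := hn y h4.1
    omega
  rw [h2, Submodule.map_bot, finrank_bot, if_pos rfl, zero_add] at h1
  obtain ⟨⟨z, hz1, hz2⟩, hz, h3⟩ := exists_of_finrank_eq_one h1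
  refine ⟨z, hz2, fun h4 => hz (Subtype.ext h4), hz1, fun f hf hb => ?_⟩
  obtain ⟨c, hc⟩ := h3 ⟨f, hb, hf⟩
  exact ⟨c, (congrArg Subtype.val hc).symm⟩

end Cell

section Top

variable {P : Type u} [Fintype P] [PartialOrder P]

/-- The elements of `P` whose image lies in `s`. -/
def down (s : Finset (WithTop P)) : Finset P := Finset.univ.filter fun a => (a : WithTop P) ∈ s

/-- The image of `y` in `WithTop P`. -/
def up (y : Finset P) : Finset (WithTop P) := y.map ⟨WithTop.some, WithTop.coe_injective⟩

lemma mem_down {s : Finset (WithTop P)} {a : P} : a ∈ down s ↔ (a : WithTop P) ∈ s := by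
  simp [down]

lemma coe_mem_up {y : Finset P} {a : P} : (a : WithTop P) ∈ up y ↔ a ∈ y := by
  simp [up]

lemma top_notMem_up (y : Finset P) : ⊤ ∉ up y := by
  simp [up]

lemma card_up (y : Finset P) : (up y).card = y.card := Finset.card_map _

lemma down_up (y : Finset P) : down (up y) = y := by
  ext a; rw [mem_down, coe_mem_up]

lemma up_down {s : Finset (WithTop P)} (h : ⊤ ∉ s) : up (down s) = s := by
  ext a
  induction a with
  | top => simp [h, top_notMem_up]
  | coe a => rw [coe_mem_up, mem_down]

lemma lt_top_of_mem_up {y : Finset P} {σ : WithTop P} (h : σ ∈ up y) : σ < ⊤ :=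
  lt_top_iff_ne_top.2 fun h1 => top_notMem_up y (h1 ▸ h)

lemma isChain_up {y : Finset P} :
    IsChain (· < ·) (up y : Set (WithTop P)) ↔ IsChain (· < ·) (y : Set P) := by
  constructor
  · intro h a ha b hb hab
    have := h (x := (a : WithTop P)) (Finset.mem_coe.2 (coe_mem_up.2 ha))
      (y := (b : WithTop P)) (Finset.mem_coe.2 (coe_mem_up.2 hb)) (by simpa using hab)
    simpa using this
  · intro h a ha b hb hab
    induction a with
    | top => exact absurd ha (top_notMem_up y)
    | coe a =>
      induction b with
      | top => exact absurd hb (top_notMem_up y)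
      | coe b =>
        simpa using h (Finset.mem_coe.2 (coe_mem_up.1 ha)) (Finset.mem_coe.2 (coe_mem_up.1 hb))
          (by simpa using hab)

lemma up_subset_up {x y : Finset P} : up x ⊆ up y ↔ x ⊆ y := Finset.map_subset_map

lemma up_insert (a : P) (y : Finset P) : up (insert a y) = insert (a : WithTop P) (up y) :=
  Finset.map_insert _ _ _

lemma sg_up (y : Finset P) (a : P) : sg (up y) (a : WithTop P) = sg y a := by
  rw [sg, sg, ← card_up (y.filter _)]
  congr 2
  ext b
  induction b with
  | top => simp [top_notMem_up]
  | coe b => simp [coe_mem_up]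

lemma dl_up {u : Finset (WithTop P) → ℝ} (hu : ∀ y, ⊤ ∈ y → u y = 0) (s : Finset P) :
    dl u (up s) = dl (fun y => u (up y)) s := by
  have h1 (F : WithTop P → ℝ) : ∑ σ, F σ = F ⊤ + ∑ a : P, F a := Fintype.sum_option F
  rw [dl, dl, h1]
  refine (congrArg₂ (· + ·) ?_ (Finset.sum_congr rfl fun a _ => ?_)).trans (zero_add _)
  · rw [hu, mul_zero, ite_self]
    simp
  · rw [sg_up, up_insert]
    simp only [coe_mem_up]
    congr!

end Top

section Push

variable {P : Type u} [Fintype P] [PartialOrder P]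

/-- The restriction to sets avoiding `⊤` of a function. -/
def pull (u : Finset (WithTop P) → ℝ) : Finset P →₀ ℝ :=
  Finsupp.equivFunOnFinite.symm fun y => u (up y)

/-- The extension by zero to sets containing `⊤`. -/
def push (f : Finset P → ℝ) (s : Finset (WithTop P)) : ℝ := if ⊤ ∈ s then 0 else f (down s)

lemma pull_apply (u : Finset (WithTop P) → ℝ) (y : Finset P) : pull u y = u (up y) := rfl

lemma push_up (f : Finset P → ℝ) (y : Finset P) : push f (up y) = f y := by
  rw [push, if_neg (top_notMem_up y), down_up]

lemma push_top (f : Finset P → ℝ) {s : Finset (WithTop P)} (h : ⊤ ∈ s) : push f s = 0 := if_pos h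

lemma eq_up_of_push_ne_zero {f : Finset P → ℝ} {s : Finset (WithTop P)} (h : push f s ≠ 0) :
    ∃ y, s = up y ∧ f y ≠ 0 := by
  have h1 : ⊤ ∉ s := fun h1 => h (push_top f h1)
  exact ⟨down s, (up_down h1).symm, by rwa [push, if_neg h1] at h⟩

lemma dl_push (f : Finset P → ℝ) (s : Finset P) : dl (push f) (up s) = dl f s := by
  rw [dl_up fun y => push_top f]
  simp only [push_up]

lemma dl_push_top (f : Finset P → ℝ) {s : Finset (WithTop P)} (h : ⊤ ∈ s) : dl (push f) s = 0 :=
  by_contra fun h1 => by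
    obtain ⟨σ, -, h2⟩ := dl_ne_zero h1
    exact h2 (push_top f (by simp [h]))

lemma dl_pull {u : Finset (WithTop P) → ℝ} (hu : ∀ y, ⊤ ∈ y → u y = 0) (s : Finset P) :
    dl (pull u) s = dl u (up s) := (dl_up hu s).symm

/-- The extension of a rank function to `WithTop`. -/
def rankTop (rk : P → ℕ) (N : ℕ) : WithTop P → ℕ := WithTop.recTopCoe N rk

@[simp] lemma rankTop_coe (rk : P → ℕ) (N : ℕ) (a : P) : rankTop rk N a = rk a := rfl

@[simp] lemma rankTop_top (rk : P → ℕ) (N : ℕ) : rankTop rk N ⊤ = N := rfl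

lemma strictMono_of_covBy {L : Type u} [Fintype L] [PartialOrder L] {ρ : L → ℕ}
    (h : ∀ a b, a ⋖ b → ρ b = ρ a + 1) : StrictMono ρ := by
  have := Fintype.toLocallyFiniteOrder (α := L)
  exact (strictMono_iff_forall_covBy ρ).2 fun a b hab => by rw [h a b hab]; omega

lemma suppIn_top {x : Finset P} {u : Finset (WithTop P) → ℝ} :
    SuppIn (up x) (· < ⊤) u ↔ ∀ y, u y ≠ 0 → ∃ y', y = up y' ∧
      IsChain (· < ·) (y' : Set P) ∧ x ⊆ y' := by
  refine forall₂_congr fun y hy => ⟨fun ⟨h1, h2, h3⟩ => ?_, ?_⟩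
  · have h4 := up_down (s := y) fun h => lt_irrefl _ (h3 _ h)
    exact ⟨down y, h4.symm, isChain_up.1 (by rwa [h4]), up_subset_up.1 (by rwa [h4])⟩
  · rintro ⟨y, rfl, h1, h2⟩
    exact ⟨isChain_up.2 h1, up_subset_up.2 h2, fun σ => lt_top_of_mem_up⟩

end Push

section Star

variable {P : Type u} [Fintype P] [PartialOrder P] [OrderBot P] {rk : P → ℕ} {n : ℕ}

lemma covBy_rankTop (h : IsGradedOn Set.univ (⊥ : P) rk n) (a b : WithTop P) (hab : a ⋖ b) :
    rankTop rk (rk ⊥ + n + 1) b = rankTop rk (rk ⊥ + n + 1) a + 1 := by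
  induction a with
  | top => exact absurd hab.1 not_top_lt
  | coe a =>
    induction b with
    | top =>
      rw [rankTop_top, rankTop_coe, h.2.2.2 a trivial fun b _ hb =>
        hab.2 (WithTop.coe_lt_coe.2 hb) (WithTop.coe_lt_top b)]
    | coe b =>
      exact h.2.2.1 a trivial b trivial (WithTop.coe_lt_coe.1 hab.1) fun ⟨c, _, h1, h2⟩ =>
        hab.2 (WithTop.coe_lt_coe.2 h1) (WithTop.coe_lt_coe.2 h2)

lemma bot_mem_up {x : Finset P} : ⊥ ∈ up x ↔ ⊥ ∈ x := coe_mem_up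

lemma pull_mem_cellSpace {x : Finset P} (hx : ⊥ ∈ x) {k : ℕ} {u : Finset (WithTop P) → ℝ}
    (hu : SuppIn (up x) (· < ⊤) u) (hk : ∀ y, u y ≠ 0 → y.card = k) :
    pull u ∈ cellSpace Set.univ ⊥ x k := by
  rw [mem_cellSpace]
  intro y hy
  have h1 := hu _ hy
  have h2 := up_subset_up.1 h1.2.1
  exact ⟨isChain_up.1 h1.1, h2 hx, h2, by rw [← card_up, hk _ hy]⟩

lemma bnd_pull {x : Finset P} {u : Finset (WithTop P) → ℝ} (hu : SuppIn (up x) (· < ⊤) u)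
    (h : ∀ s, up x ⊆ s → dl u s = 0) : bnd x (pull u) = 0 := by
  rw [bnd_eq_zero_iff fun y hy => up_subset_up.1 (hu _ hy).2.1]
  intro s hs
  rw [dl_pull (fun y hy => by_contra fun h => lt_irrefl _ ((hu y h).2.2 _ hy)),
    h _ (up_subset_up.2 hs)]

lemma suppIn_push {x : Finset P} {k : ℕ} {f : Finset P →₀ ℝ}
    (h : f ∈ cellSpace Set.univ ⊥ x k) : SuppIn (up x) (· < ⊤) (push f) := by
  rw [mem_cellSpace] at h
  rw [suppIn_top]
  intro y hy
  obtain ⟨y, rfl, h1⟩ := eq_up_of_push_ne_zero hy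
  exact ⟨y, rfl, (h y h1).1, (h y h1).2.2.1⟩

lemma card_of_push_ne_zero {x : Finset P} {k : ℕ} {f : Finset P →₀ ℝ}
    (h : f ∈ cellSpace Set.univ ⊥ x k) {y : Finset (WithTop P)} (hy : push f y ≠ 0) :
    y.card = k := by
  rw [mem_cellSpace] at h
  obtain ⟨y, rfl, h1⟩ := eq_up_of_push_ne_zero hy
  rw [card_up, (h y h1).2.2.2]

lemma exists_eq_up {x : Finset (WithTop P)} (hc : IsChain (· < ·) (x : Set (WithTop P)))
    (hb : ⊥ ∈ x) (ht : ∀ σ ∈ x, σ < ⊤) :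
    ∃ x' : Finset P, x = up x' ∧ IsChain (· < ·) (x' : Set P) ∧ ⊥ ∈ x' := by
  have h := up_down (s := x) fun h => lt_irrefl _ (ht _ h)
  exact ⟨down x, h.symm, isChain_up.1 (by rwa [h]), bot_mem_up.1 (by rwa [h])⟩

theorem sphere (h : IsGorensteinStarOn Set.univ (⊥ : P) rk n) :
    Sphere (rankTop rk (rk ⊥ + n + 1)) := by
  have hbot : rankTop rk (rk ⊥ + n + 1) ⊥ = rk ⊥ := rfl
  have hmono : StrictMono (rankTop rk (rk ⊥ + n + 1)) := strictMono_of_covBy (covBy_rankTop h.1)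
  refine ⟨hmono, covBy_rankTop h.1, WithTop.coe_lt_top _, ?_, ?_⟩
  · intro x hc hb ht k hk u hu hcard hcyc
    obtain ⟨x, rfl, hc', hb'⟩ := exists_eq_up hc hb ht
    rw [hbot, rankTop_top] at hk
    obtain ⟨g, hg, hgf⟩ := h.2.exists_bnd_eq hb' hc' (by omega)
      (pull_mem_cellSpace hb' hu hcard) (bnd_pull hu hcyc)
    refine ⟨push g, suppIn_push hg, fun y => card_of_push_ne_zero hg, fun s hs => ?_⟩
    by_cases h1 : ⊤ ∈ s
    · rw [dl_push_top _ h1]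
      exact by_contra fun h2 => lt_irrefl _ ((hu s h2).2.2 _ h1)
    · rw [← up_down h1] at hs ⊢
      rw [dl_push, ← bnd_apply_of_subset (up_subset_up.1 hs), hgf, pull_apply]
  · intro x hc hb ht
    obtain ⟨x, rfl, hc', hb'⟩ := exists_eq_up hc hb ht
    obtain ⟨z, hz, hz0, hzb, huniq⟩ := h.2.exists_cycle hb' hc' fun y hy => by
      have h1 := card_add_le_of_isChain hmono (isChain_up.2 hy) (r := rk ⊥) (m := rk ⊥ + n + 1)
        (fun σ hσ => ⟨hmono.monotone bot_le, hmono (lt_top_of_mem_up hσ)⟩) (by omega)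
      rw [card_up] at h1
      omega
    have hz' := mem_cellSpace.1 hz
    refine ⟨push z, ?_, suppIn_push hz, fun y hy => ?_, fun s hs => ?_, fun u hu hcard hcyc => ?_⟩
    · obtain ⟨y, hy⟩ := Finsupp.ne_iff.1 hz0
      exact ⟨up y, by rwa [push_up]⟩
    · rw [card_of_push_ne_zero hz hy, hbot, rankTop_top]
      omega
    · by_cases h1 : ⊤ ∈ s
      · exact dl_push_top _ h1
      · rw [← up_down h1] at hs ⊢
        rw [dl_push, ← bnd_apply_of_subset (up_subset_up.1 hs), hzb]
        rfl
    · obtain ⟨c, hcz⟩ := huniq _ (pull_mem_cellSpace hb' hu fun y hy => by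
        have := hcard y hy
        rw [hbot, rankTop_top] at this
        omega) (bnd_pull hu hcyc)
      refine ⟨c, fun y => ?_⟩
      by_cases h1 : ⊤ ∈ y
      · rw [push_top _ h1, mul_zero]
        exact by_contra fun h2 => lt_irrefl _ ((hu y h2).2.2 _ h1)
      · rw [← up_down h1, push_up]
        exact DFunLike.congr_fun hcz (down y)

end Star

lemma wtRanks_append_singleton (N r : ℕ) {l : List ℕ} (hl : l ≠ []) :
    wtRanks N (l ++ [r]) = wtRanks r l * vb * (va - vb) ^ (N - 1 - r) := by
  induction l with
  | nil => exact absurd rfl hl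
  | cons s l ih =>
    cases l with
    | nil => simp [wtRanks, Nat.sub_right_comm]
    | cons t l =>
      have h := ih (by simp)
      simp only [List.cons_append, wtRanks] at h ⊢
      rw [h]
      simp only [mul_assoc]

lemma sort_insert_max {s : Finset ℕ} {r : ℕ} (h : ∀ a ∈ s, a < r) :
    (insert r s).sort (· ≤ ·) = s.sort (· ≤ ·) ++ [r] := by
  have h1 : insert r s = (s.sort (· ≤ ·) ++ [r]).toFinset := by
    ext a; simp
  rw [h1, List.toFinset_sort]
  · rw [List.pairwise_append]
    refine ⟨Finset.pairwise_sort _ _, List.pairwise_singleton _ _, fun a ha b hb => ?_⟩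
    rw [List.mem_singleton.1 hb]
    exact (h a ((Finset.mem_sort _).1 ha)).le
  · rw [List.nodup_append]
    refine ⟨Finset.sort_nodup _ _, List.nodup_singleton _, fun a ha b hb => ?_⟩
    rw [List.mem_singleton.1 hb]
    exact (h a ((Finset.mem_sort _).1 ha)).ne

section ChainSum

variable {P : Type u} [Fintype P] [PartialOrder P] {rk : P → ℕ} {m : P}

/-- The sum of the weights of the chains of `S`, the formal maximal element having rank `N`. -/
def chainSum (rk : P → ℕ) (m : P) (S : Set P) (N : ℕ) : NC :=
  ∑ y : Finset P, if chainIn S m y then wtRanks N ((y.image rk).sort (· ≤ ·)) else 0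

lemma wtRanks_insert (hrk : StrictMono rk) (N : ℕ) {θ : P} {y : Finset P} (hy : y.Nonempty)
    (h : ∀ σ ∈ y, σ < θ) : wtRanks N (((insert θ y).image rk).sort (· ≤ ·)) =
      wtRanks (rk θ) ((y.image rk).sort (· ≤ ·)) * vb * (va - vb) ^ (N - 1 - rk θ) := by
  rw [Finset.image_insert, sort_insert_max, wtRanks_append_singleton]
  · intro h1
    have h2 := Finset.length_sort (s := y.image rk) (· ≤ ·)
    rw [h1] at h2
    exact (hy.image rk).card_ne_zero h2.symm
  · intro a ha
    obtain ⟨σ, hσ, rfl⟩ := Finset.mem_image.1 ha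
    exact hrk (h σ hσ)

lemma sum_chainIn_max {S : Set P} (hS : IsLowerSet S) {θ : P} (hθ : θ ∈ S) (hm : m < θ)
    (F : Finset P → NC) :
    (∑ y : Finset P, if chainIn S m y ∧ θ ∈ y ∧ ∀ σ ∈ y, σ ≤ θ then F y else 0) =
      ∑ y : Finset P, if chainIn (Set.Iio θ) m y then F (insert θ y) else 0 := by
  rw [← Finset.sum_filter, ← Finset.sum_filter]
  have hlt : ∀ y : Finset P, chainIn S m y ∧ θ ∈ y ∧ (∀ σ ∈ y, σ ≤ θ) →
      chainIn (Set.Iio θ) m (y.erase θ) := by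
    rintro y ⟨⟨h1, h2, h3⟩, h4, h5⟩
    refine ⟨Finset.mem_erase.2 ⟨hm.ne, h1⟩, fun σ hσ => ?_,
      h3.mono (by exact_mod_cast Finset.erase_subset _ _)⟩
    have h6 := Finset.mem_erase.1 (Finset.mem_coe.1 hσ)
    exact (h5 σ h6.2).lt_of_ne h6.1
  have hni : ∀ y : Finset P, chainIn (Set.Iio θ) m y → θ ∉ y := fun y hy h =>
    lt_irrefl θ (hy.2.1 h)
  refine Finset.sum_bij' (fun y _ => y.erase θ) (fun y _ => insert θ y) ?_ ?_ ?_ ?_ ?_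
  · intro y hy
    exact Finset.mem_filter.2 ⟨Finset.mem_univ _, hlt y (Finset.mem_filter.1 hy).2⟩
  · intro y hy
    have h1 := (Finset.mem_filter.1 hy).2
    refine Finset.mem_filter.2 ⟨Finset.mem_univ _, ⟨Finset.mem_insert_of_mem h1.1, ?_, ?_⟩,
      Finset.mem_insert_self _ _, ?_⟩
    · intro σ hσ
      rcases Finset.mem_insert.1 (Finset.mem_coe.1 hσ) with rfl | h2
      · exact hθ
      · exact hS (h1.2.1 h2).le hθ
    · rw [Finset.coe_insert]
      exact h1.2.2.insert fun σ hσ _ => Or.inr (h1.2.1 hσ)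
    · intro σ hσ
      rcases Finset.mem_insert.1 hσ with rfl | h2
      · exact le_rfl
      · exact (h1.2.1 h2).le
  · intro y hy
    exact Finset.insert_erase (Finset.mem_filter.1 hy).2.2.1
  · intro y hy
    exact Finset.erase_insert (hni y (Finset.mem_filter.1 hy).2)
  · intro y hy
    rw [Finset.insert_erase (Finset.mem_filter.1 hy).2.2.1]

lemma exists_max_of_isChain {y : Finset P} (hy : IsChain (· < ·) (y : Set P)) (hne : y.Nonempty) :
    ∃ θ ∈ y, ∀ σ ∈ y, σ ≤ θ := by
  obtain ⟨θ, h1, h2⟩ := y.exists_maximal hne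
  refine ⟨θ, h1, fun σ hσ => ?_⟩
  by_cases e : σ = θ
  · exact e.le
  · rcases hy hσ h1 e with h3 | h3
    · exact h3.le
    · exact h2 hσ h3.le

lemma chainSum_eq (hrk : StrictMono rk) (hm : ∀ σ, m ≤ σ) {S : Set P} (hS : IsLowerSet S)
    (hmS : m ∈ S) (N : ℕ) : chainSum rk m S N = (va - vb) ^ (N - 1 - rk m) +
      ∑ θ, if θ ∈ S ∧ θ ≠ m then
        chainSum rk m (Set.Iio θ) (rk θ) * vb * (va - vb) ^ (N - 1 - rk θ) else 0 := by
  have h0 : ∀ y : Finset P,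
      (if chainIn S m y then wtRanks N ((y.image rk).sort (· ≤ ·)) else 0) =
      ∑ θ, if chainIn S m y ∧ θ ∈ y ∧ ∀ σ ∈ y, σ ≤ θ then
        wtRanks N ((y.image rk).sort (· ≤ ·)) else 0 := by
    intro y
    by_cases h : chainIn S m y
    · obtain ⟨θ, h1, h2⟩ := exists_max_of_isChain h.2.2 ⟨m, h.1⟩
      rw [if_pos h, Finset.sum_eq_single θ, if_pos ⟨h, h1, h2⟩]
      · exact fun σ _ hσ => if_neg fun h3 => hσ ((h2 σ h3.2.1).antisymm (h3.2.2 θ h1))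
      · simp
    · rw [if_neg h]
      exact (Finset.sum_eq_zero fun θ _ => if_neg fun h1 => h h1.1).symm
  rw [chainSum, Finset.sum_congr rfl fun y _ => h0 y, Finset.sum_comm,
    ← Finset.add_sum_erase _ _ (Finset.mem_univ m), ← Finset.add_sum_erase _ (fun θ =>
      if θ ∈ S ∧ θ ≠ m then _ else _) (Finset.mem_univ m), if_neg (fun h => h.2 rfl), zero_add]
  congr 1
  · rw [Finset.sum_eq_single {m}, if_pos]
    · simp [wtRanks]
    · simp [chainIn, hmS]
    · intro y _ hy
      refine if_neg fun h => hy (Finset.eq_singleton_iff_unique_mem.2 ⟨h.1.1, fun σ hσ => ?_⟩)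
      exact (h.2.2 σ hσ).antisymm (hm σ)
    · simp
  · refine Finset.sum_congr rfl fun θ hθ => ?_
    have hne := Finset.ne_of_mem_erase hθ
    by_cases hθS : θ ∈ S
    · have hmθ := (hm θ).lt_of_ne hne.symm
      rw [if_pos ⟨hθS, hne⟩, sum_chainIn_max hS hθS hmθ, chainSum, Finset.sum_mul, Finset.sum_mul]
      refine Finset.sum_congr rfl fun y _ => ?_
      by_cases h : chainIn (Set.Iio θ) m y
      · rw [if_pos h, if_pos h, wtRanks_insert hrk N ⟨m, h.1⟩ fun σ hσ => h.2.1 hσ]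
      · rw [if_neg h, if_neg h, zero_mul, zero_mul]
    · rw [if_neg fun h => hθS h.1]
      exact Finset.sum_eq_zero fun y _ => if_neg fun h => hθS (h.1.2.1 h.2.1)

lemma chainSum_Iio_eq (hrk : StrictMono rk) (hm : ∀ σ, m ≤ σ) {I : P → NC}
    (hI : ∀ θ, θ ≠ m → I θ = (va - vb) ^ (rk θ - 1 - rk m) +
      ∑ σ, if σ < θ ∧ σ ≠ m then I σ * vb * (va - vb) ^ (rk θ - 1 - rk σ) else 0)
    (θ : P) (hθ : θ ≠ m) : chainSum rk m (Set.Iio θ) (rk θ) = I θ := by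
  induction θ using WellFoundedLT.induction with
  | ind θ ih =>
    rw [chainSum_eq hrk hm (isLowerSet_Iio θ) ((hm θ).lt_of_ne hθ.symm), hI θ hθ]
    congr 1
    refine Finset.sum_congr rfl fun σ _ => ?_
    rw [Set.mem_Iio]
    by_cases h : σ < θ ∧ σ ≠ m
    · rw [if_pos h, if_pos h, ih σ h.1 h.2]
    · rw [if_neg h, if_neg h]

lemma absIndexOn_univ_eq (hrk : StrictMono rk) (hm : ∀ σ, m ≤ σ) {I : P → NC} (n : ℕ)
    (hI : ∀ θ, θ ≠ m → I θ = (va - vb) ^ (rk θ - 1 - rk m) +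
      ∑ σ, if σ < θ ∧ σ ≠ m then I σ * vb * (va - vb) ^ (rk θ - 1 - rk σ) else 0) :
    absIndexOn Set.univ m rk n = (va - vb) ^ (rk m + n + 1 - 1 - rk m) +
      ∑ σ, if σ ≠ m then I σ * vb * (va - vb) ^ (rk m + n + 1 - 1 - rk σ) else 0 := by
  refine (chainSum_eq hrk hm isLowerSet_univ trivial _).trans ?_
  congr 1
  refine Finset.sum_congr rfl fun σ _ => ?_
  by_cases h : σ ≠ m
  · rw [if_pos h, if_pos ⟨trivial, h⟩, chainSum_Iio_eq hrk hm hI σ h]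
  · rw [if_neg h, if_neg fun h1 => h h1.2]

end ChainSum

lemma absIndexOn_univ_eq_interval {P : Type u} [Fintype P] [PartialOrder P] [OrderBot P]
    {rk : P → ℕ} {n : ℕ} (hrk : StrictMono rk) :
    absIndexOn Set.univ ⊥ rk n =
      interval (rankTop rk (rk ⊥ + n + 1)) (⊥ : WithTop P) ⊤ := by
  have hsum (F : WithTop P → NC) : ∑ σ, F σ = F ⊤ + ∑ a : P, F a := Fintype.sum_option F
  have hbot : rankTop rk (rk ⊥ + n + 1) ⊥ = rk ⊥ := rfl
  have key : ∀ ξ : WithTop P, ⊥ < ξ → interval (rankTop rk (rk ⊥ + n + 1)) ⊥ ξ =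
      (va - vb) ^ (rankTop rk (rk ⊥ + n + 1) ξ - 1 - rk ⊥) +
      ∑ σ : P, if (σ : WithTop P) < ξ ∧ σ ≠ ⊥ then
        interval (rankTop rk (rk ⊥ + n + 1)) ⊥ (σ : WithTop P) * vb *
          (va - vb) ^ (rankTop rk (rk ⊥ + n + 1) ξ - 1 - rk σ) else 0 := by
    intro ξ hξ
    rw [interval_eq_right hξ, hsum, if_neg not_top_lt, zero_add, hbot, Nat.sub_right_comm]
    congr 1
    refine Finset.sum_congr rfl fun σ _ => ?_
    by_cases h : (σ : WithTop P) < ξ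
    · by_cases h1 : σ = ⊥
      · rw [if_pos h, if_neg fun h2 => h2.2 h1, h1, interval_eq_zero (show ¬ (⊥ : WithTop P) < ((⊥ : P) : WithTop P) from lt_irrefl _)]
        simp
      · rw [if_pos h, if_pos ⟨h, h1⟩, rankTop_coe, Nat.sub_right_comm]
    · rw [if_neg h, if_neg fun h1 => h h1.1]
  rw [key ⊤ (WithTop.coe_lt_top _), absIndexOn_univ_eq hrk (fun _ => bot_le)
    (I := fun σ => interval (rankTop rk (rk ⊥ + n + 1)) ⊥ (σ : WithTop P))]
  · simp only [WithTop.coe_lt_top, true_and, rankTop_top]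
  · intro θ hθ
    rw [key θ (WithTop.coe_lt_coe.2 (bot_lt_iff_ne_bot.2 hθ))]
    simp only [WithTop.coe_lt_coe, rankTop_coe]

lemma sum_ssubsets_card {α : Type u} [DecidableEq α] (A : Finset α) (F : ℕ → NC) :
    ∑ s ∈ A.ssubsets, F s.card = ∑ j ∈ Finset.range A.card, (A.card.choose j : ℚ) • F j := by
  have h := Finset.sum_powerset_apply_card F (x := A)
  rw [Finset.sum_range_succ, ← Finset.sum_erase_add _ _ (Finset.mem_powerset_self A),
    Nat.choose_self, one_smul] at h
  rw [Finset.ssubsets, add_right_cancel h]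
  exact Finset.sum_congr rfl fun j _ => (Nat.cast_smul_eq_nsmul ℚ _ _).symm

lemma absIndexOn_boolean {n : ℕ} (h : (∅ : Finset (Fin (n + 1))) ≠ Finset.univ) :
    absIndexOn (Set.univ : Set {S : Finset (Fin (n + 1)) // S ≠ Finset.univ}) ⟨∅, h⟩
      (fun S => S.val.card) n = bool (n + 1) := by
  have key : ∀ A : Finset (Fin (n + 1)), bool A.card = (va - vb) ^ (A.card - 1) +
      ∑ S : {S : Finset (Fin (n + 1)) // S ≠ Finset.univ}, if S.1 ⊂ A ∧ S ≠ ⟨∅, h⟩ then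
        bool S.1.card * vb * (va - vb) ^ (A.card - 1 - S.1.card) else 0 := by
    intro A
    rw [bool_eq]
    congr 1
    have h1 := sum_ssubsets_card A fun j => if 0 < j then
      bool j * vb * (va - vb) ^ (A.card - j - 1) else 0
    simp only [smul_ite, smul_zero] at h1
    rw [← h1]
    have h2 := Finset.sum_subtype (F := inferInstance) (p := fun S => S ≠ Finset.univ)
      (Finset.univ.filter fun S : Finset (Fin (n + 1)) => S ≠ Finset.univ) (by simp)
      fun S => if S ⊂ A ∧ S ≠ ∅ then bool S.card * vb * (va - vb) ^ (A.card - 1 - S.card) else 0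
    have h3 (S : {S : Finset (Fin (n + 1)) // S ≠ Finset.univ}) : S ≠ ⟨∅, h⟩ ↔ S.1 ≠ ∅ :=
      Subtype.ext_iff.not
    simp only [h3]
    rw [← h2]
    refine Finset.sum_subset_zero_on_sdiff ?_ ?_ ?_
    · intro S hS
      have h4 := Finset.mem_ssubsets.1 hS
      exact Finset.mem_filter.2 ⟨Finset.mem_univ _, fun h5 => h4.not_subset (h5 ▸ A.subset_univ)⟩
    · intro S hS
      exact if_neg fun h4 => (Finset.mem_sdiff.1 hS).2 (Finset.mem_ssubsets.2 h4.1)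
    · intro S hS
      rw [Nat.sub_right_comm]
      exact if_congr (by simp [Finset.card_pos, Finset.nonempty_iff_ne_empty,
        Finset.mem_ssubsets.1 hS]) rfl rfl
  rw [absIndexOn_univ_eq (I := fun S => bool S.1.card)]
  · have h1 := key Finset.univ
    rw [Finset.card_univ, Fintype.card_fin] at h1
    rw [h1]
    simp only [Finset.card_empty, zero_add, Nat.sub_zero]
    congr 1
    refine Finset.sum_congr rfl fun S _ => if_congr ?_ rfl rfl
    rw [Finset.ssubset_univ_iff]
    exact (and_iff_right S.2).symm
  · exact fun S T h => Finset.card_lt_card h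
  · exact fun S => Finset.empty_subset S.1
  · intro S hS
    rw [key]
    exact congrArg₂ (· + ·) rfl (Finset.sum_congr rfl fun T _ => by congr!)

end NC

end

/-- **Corollary (Stanley's conjecture).** Among all Gorenstein* lattices of rank `n`
the `cd`-index is coefficientwise minimized by the Boolean algebra: `Ψ_Λ ≥ Ψ_B`
coefficientwise, where `B` is the Boolean algebra of rank `n+1` (subsets of an
`(n+1)`-set) with its maximal element removed. -/
theorem cd_index_boolean_minimizes
    {Λ : Type*} [Fintype Λ] [PartialOrder Λ] [OrderBot Λ]
    (rk : Λ → ℕ) (n : ℕ)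
    (hlat : ∀ x y : WithTop Λ, ∃ z, IsLUB {x, y} z)
    (hgor : IsGorensteinStarOn (Set.univ : Set Λ) (⊥ : Λ) rk n) :
    ∃ f g : List Bool →₀ ℤ,
      absIndexOn (Set.univ : Set Λ) (⊥ : Λ) rk n = cdEval f ∧
      absIndexOn (Set.univ : Set {S : Finset (Fin (n + 1)) // S ≠ Finset.univ})
        ⟨∅, by simp [Finset.eq_univ_iff_forall]⟩ (fun S => S.val.card) n = cdEval g ∧
      ∀ w, g w ≤ f w := by
  have hS := NC.sphere hgor
  have hΛ := hS.interval_sub_bool_mem_cone hlat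
  rw [← NC.absIndexOn_univ_eq_interval (rk := rk) (n := n) fun a b hab =>
    hS.strictMono (WithTop.coe_lt_coe.2 hab)] at hΛ
  obtain ⟨h, hh, h0⟩ := NC.exists_cdEval_of_mem_cone hΛ
  obtain ⟨g, hg, -⟩ := NC.exists_cdEval_of_mem_cone (NC.bool_mem_cone n)
  refine ⟨g + h, g, ?_, ?_, fun w => ?_⟩
  · rw [NC.cdEval_add, ← hg, ← hh]
    change _ = _ + (_ - NC.bool (rk ⊥ + n + 1 - rk ⊥))
    rw [show rk ⊥ + n + 1 - rk ⊥ = n + 1 by omega, add_sub_cancel]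
  · rw [NC.absIndexOn_boolean, hg]
  · simpa using h0 w
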